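/- Let k ≥ 1 and n ∈ ℕ with 2n ≥ k² + 3. Let E ⊆ (ℝ^{2n})^k be a Jordan measurable set admitting projection bounds (E_r)_{1≤r≤k}. Then there exists a constant Ĉ > 0, depending only on n and k, such that 0 ≤ ∫_{X_{2n}} (χ̂_E)² dμ − ( ∫_{X_{2n}} χ̂_E dμ )² ≤ Ĉ · max{ vol_{r_1}(E_{r_1}) · vol_{r_2}(E_{r_2}) : 0 ≤ r_1, r_2 ≤ k, 1 ≤ r_1 + r_2 ≤ 2k−1 }, where χ̂_E denotes the rank-k primitive Siegel transform of the characteristic function of E. -/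

import Mathlib

open Matrix MeasureTheory

noncomputable section

instance (m : ℕ) : MeasurableSpace (Matrix (Fin m) (Fin m) ℝ) := MeasurableSpace.pi

noncomputable instance (m : ℕ) : TopologicalSpace (Matrix.SpecialLinearGroup (Fin m) ℝ) :=
  instTopologicalSpaceSubtype

instance (m : ℕ) : MeasurableSpace (Matrix.SpecialLinearGroup (Fin m) ℝ) :=
  Subtype.instMeasurableSpace

abbrev SLR (m : ℕ) := Matrix.SpecialLinearGroup (Fin m) ℝ

/-- `SL_m(ℤ)`, viewed as a subgroup of `SL_m(ℝ)`. -/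
def SLZ (m : ℕ) : Subgroup (SLR m) :=
  (Matrix.SpecialLinearGroup.map (n := Fin m) (Int.castRingHom ℝ)).range

/-- The space `X_m = SL_m(ℝ)/SL_m(ℤ)`. -/
abbrev Xspace (m : ℕ) := SLR m ⧸ SLZ m

/-- Jordan measurability: bounded with null topological boundary. -/
def JordanMeasurable {k d : ℕ} (S : Set (Fin k → Fin d → ℝ)) : Prop :=
  Bornology.IsBounded S ∧ volume (frontier S) = 0

/-- `vol_r`, with the convention `vol_0 = 1`. -/
def jvol (d r : ℕ) (S : Set (Fin r → Fin d → ℝ)) : ℝ :=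
  if r = 0 then 1 else (volume S).toReal

/-- A primitive integer vector: nonzero with coprime coordinates. -/
def IsPrimitiveVec {d : ℕ} (v : Fin d → ℤ) : Prop := v ≠ 0 ∧ Finset.univ.gcd v = 1

/-! ### Siegel transforms -/

def act {d : ℕ} {ι : Type*} (g : SLR d) (y : ι → Fin d → ℝ) : ι → Fin d → ℝ :=
  fun i => (g : Matrix (Fin d) (Fin d) ℝ).mulVec (y i)

def zc {d : ℕ} {ι : Type*} (z : ι → Fin d → ℤ) : ι → Fin d → ℝ := fun i j => (z i j : ℝ)

def GInv {d : ℕ} {ι : Type*} (Z : Set (ι → Fin d → ℤ)) : Prop :=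
  ∀ γ : Matrix.SpecialLinearGroup (Fin d) ℤ, ∀ z ∈ Z, (fun i => γ.1.mulVec (z i)) ∈ Z

def fhat {d : ℕ} {ι : Type*} (Z : Set (ι → Fin d → ℤ)) (F : (ι → Fin d → ℝ) → ENNReal)
    (x : Xspace d) : ENNReal := ∑' z : Z, F (act (Quotient.out x) (zc z.1))

lemma act_mul {d : ℕ} {ι : Type*} (g h : SLR d) (y : ι → Fin d → ℝ) :
    act (g * h) y = act g (act h y) := by
  funext i; simp [act, Matrix.mulVec_mulVec]

lemma act_one {d : ℕ} {ι : Type*} (y : ι → Fin d → ℝ) : act (1 : SLR d) y = y := by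
  funext i; simp [act]

lemma measurable_act {d : ℕ} {ι : Type*} [Fintype ι] (g : SLR d) :
    Measurable (act (ι := ι) g) := by
  have : Continuous (act (ι := ι) g) := by unfold act; fun_prop
  exact this.measurable

lemma measurable_act_left {d : ℕ} {ι : Type*} [Fintype ι] (y : ι → Fin d → ℝ) :
    Measurable (fun g : SLR d => act g y) := by
  unfold act
  refine measurable_pi_lambda _ fun i => measurable_pi_lambda _ fun a => ?_
  simp only [Matrix.mulVec, dotProduct]
  refine Finset.measurable_sum _ fun b _ => Measurable.mul_const ?_ _
  exact (measurable_pi_apply b).comp ((measurable_pi_apply a).comp measurable_subtype_coe)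

lemma act_zc_map {d : ℕ} {ι : Type*} (γ : Matrix.SpecialLinearGroup (Fin d) ℤ)
    (z : ι → Fin d → ℤ) :
    act (Matrix.SpecialLinearGroup.map (n := Fin d) (Int.castRingHom ℝ) γ) (zc z)
      = zc (fun i => γ.1.mulVec (z i)) := by
  funext i a
  simp [act, zc, Matrix.mulVec, dotProduct]

lemma fhat_mk {d : ℕ} {ι : Type*} {Z : Set (ι → Fin d → ℤ)} (hZ : GInv Z)
    (F : (ι → Fin d → ℝ) → ENNReal) (g : SLR d) :
    fhat Z F (QuotientGroup.mk g) = ∑' z : Z, F (act g (zc z.1)) := by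
  obtain ⟨h, hh⟩ := QuotientGroup.mk_out_eq_mul (SLZ d) g
  obtain ⟨γ, hγ⟩ := h.2
  unfold fhat
  have : (Quotient.out (QuotientGroup.mk g : Xspace d)) = g * h.1 := hh
  rw [this, ← hγ]
  let e : Z ≃ Z :=
    { toFun := fun z => ⟨fun i => γ.1.mulVec (z.1 i), hZ γ _ z.2⟩
      invFun := fun z => ⟨fun i => (γ⁻¹).1.mulVec (z.1 i), hZ γ⁻¹ _ z.2⟩
      left_inv := by
        intro z; apply Subtype.ext; funext i
        simp only [Matrix.mulVec_mulVec]
        rw [← Matrix.SpecialLinearGroup.coe_mul]; simp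
      right_inv := by
        intro z; apply Subtype.ext; funext i
        simp only [Matrix.mulVec_mulVec]
        rw [← Matrix.SpecialLinearGroup.coe_mul]; simp }
  rw [← e.tsum_eq (fun z : Z => F (act g (zc z.1)))]
  refine tsum_congr fun z => ?_
  rw [act_mul, act_zc_map]
  rfl

lemma measurable_X {d : ℕ} {β : Type*} [MeasurableSpace β] {f : Xspace d → β}
    (h : Measurable (fun g : SLR d => f (QuotientGroup.mk g))) : Measurable f :=
  measurable_from_quotient.2 h

lemma measurable_fhat {d : ℕ} {ι : Type*} [Fintype ι] {Z : Set (ι → Fin d → ℤ)} (hZ : GInv Z)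
    {F : (ι → Fin d → ℝ) → ENNReal} (hF : Measurable F) : Measurable (fhat Z F) := by
  apply measurable_X
  simp only [fhat_mk hZ]
  exact Measurable.tsum fun z => hF.comp (measurable_act_left _)

lemma fhat_smul {d : ℕ} {ι : Type*} {Z : Set (ι → Fin d → ℤ)} (hZ : GInv Z)
    (F : (ι → Fin d → ℝ) → ENNReal) (g : SLR d) (x : Xspace d) :
    fhat Z F (g • x) = fhat Z (fun y => F (act g y)) x := by
  induction x using QuotientGroup.induction_on with
  | H h =>
    have : g • (QuotientGroup.mk h : Xspace d) = QuotientGroup.mk (g * h) := rfl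
    rw [this, fhat_mk hZ, fhat_mk hZ]
    simp only [act_mul]

def kap {d : ℕ} {ι : Type*} (Z : Set (ι → Fin d → ℤ)) (x : Xspace d) :
    Measure (ι → Fin d → ℝ) :=
  Measure.sum fun z : Z => Measure.dirac (act (Quotient.out x) (zc z.1))

lemma lintegral_kap {d : ℕ} {ι : Type*} {Z : Set (ι → Fin d → ℤ)}
    {F : (ι → Fin d → ℝ) → ENNReal} (hF : Measurable F) (x : Xspace d) :
    ∫⁻ y, F y ∂(kap Z x) = fhat Z F x := by
  unfold kap fhat
  rw [lintegral_sum_measure]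
  exact tsum_congr fun z => lintegral_dirac' _ hF

lemma measurable_kap {d : ℕ} {ι : Type*} [Fintype ι] {Z : Set (ι → Fin d → ℤ)} (hZ : GInv Z) :
    Measurable (kap Z) := by
  refine Measure.measurable_of_measurable_coe _ fun s hs => ?_
  have : (fun x => kap Z x s) = fhat Z (s.indicator 1) := by
    funext x
    rw [← lintegral_kap (measurable_one.indicator hs), lintegral_indicator_one hs]
  rw [this]
  exact measurable_fhat hZ (measurable_one.indicator hs)

def nu {d : ℕ} {ι : Type*} (μ : Measure (Xspace d)) (Z : Set (ι → Fin d → ℤ)) :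
    Measure (ι → Fin d → ℝ) := μ.bind (kap Z)

lemma lintegral_nu {d : ℕ} {ι : Type*} [Fintype ι] (μ : Measure (Xspace d))
    {Z : Set (ι → Fin d → ℤ)} (hZ : GInv Z)
    {F : (ι → Fin d → ℝ) → ENNReal} (hF : Measurable F) :
    ∫⁻ y, F y ∂(nu μ Z) = ∫⁻ x, fhat Z F x ∂μ := by
  unfold nu
  rw [Measure.lintegral_bind (measurable_kap hZ).aemeasurable hF.aemeasurable]
  exact lintegral_congr fun x => lintegral_kap hF x

def InvM {d : ℕ} (μ : Measure (Xspace d)) : Prop :=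
  ∀ γ : SLR d, Measure.map (fun x => γ • x) μ = μ

lemma measurable_smulX {d : ℕ} (γ : SLR d) : Measurable (fun x : Xspace d => γ • x) := by
  apply measurable_X
  have : (fun g : SLR d => γ • (QuotientGroup.mk g : Xspace d)) =
    fun g => QuotientGroup.mk (γ * g) := rfl
  rw [this]
  have h1 : Measurable (QuotientGroup.mk : SLR d → Xspace d) := measurable_quotient_mk''
  refine h1.comp ?_
  refine Measurable.subtype_mk ?_
  have : Continuous fun A : Matrix (Fin d) (Fin d) ℝ => (γ : Matrix (Fin d) (Fin d) ℝ) * A := by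
    fun_prop
  refine measurable_pi_lambda _ fun i => measurable_pi_lambda _ fun j => ?_
  simp only [Matrix.mul_apply]
  refine Finset.measurable_sum _ fun b _ => Measurable.const_mul ?_ _
  exact (measurable_pi_apply j).comp ((measurable_pi_apply b).comp measurable_subtype_coe)

lemma nu_inv {d : ℕ} {ι : Type*} [Fintype ι] {μ : Measure (Xspace d)} (hμ : InvM μ)
    {Z : Set (ι → Fin d → ℤ)} (hZ : GInv Z) (g : SLR d) :
    (nu μ Z).map (act g) = nu μ Z := by
  refine Measure.ext_of_lintegral _ fun F hF => ?_
  rw [lintegral_map hF (measurable_act g), lintegral_nu μ hZ (F := fun y => F (act g y)) (hF.comp (measurable_act g)),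
    lintegral_nu μ hZ hF]
  conv_rhs => rw [← hμ g]
  rw [lintegral_map (measurable_fhat hZ hF) (measurable_smulX g)]
  refine lintegral_congr fun x => ?_
  rw [fhat_smul hZ]

/-- comparison principle -/
lemma nu_le {d : ℕ} {ι κ α : Type*} [Fintype ι] [Fintype κ] [Countable α]
    (μ : Measure (Xspace d))
    {Z : Set (ι → Fin d → ℤ)} (hZ : GInv Z) {Y : Set (κ → Fin d → ℤ)} (hY : GInv Y)
    {F : (ι → Fin d → ℝ) → ENNReal} (hF : Measurable F)
    {G : α → (κ → Fin d → ℝ) → ENNReal} (hG : ∀ a, Measurable (G a))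
    (h : ∀ g : SLR d, ∑' z : Z, F (act g (zc z.1)) ≤ ∑' a, ∑' y : Y, G a (act g (zc y.1))) :
    ∫⁻ y, F y ∂(nu μ Z) ≤ ∑' a, ∫⁻ y, G a y ∂(nu μ Y) := by
  rw [lintegral_nu μ hZ hF]
  simp only [lintegral_nu μ hY (hG _)]
  rw [← lintegral_tsum fun a => (measurable_fhat hY (hG a)).aemeasurable]
  refine lintegral_mono fun x => ?_
  exact h _

lemma nu_mono {d : ℕ} {ι : Type*} [Fintype ι] (μ : Measure (Xspace d))
    {Z Y : Set (ι → Fin d → ℤ)} (hZ : GInv Z) (hY : GInv Y) (h : Z ⊆ Y) :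
    nu μ Z ≤ nu μ Y := by
  refine Measure.le_iff.2 fun s hs => ?_
  rw [← lintegral_indicator_one hs, ← lintegral_indicator_one hs,
    lintegral_nu μ hZ (measurable_one.indicator hs), lintegral_nu μ hY (measurable_one.indicator hs)]
  refine lintegral_mono fun x => ?_
  unfold fhat
  exact ENNReal.tsum_mono_subtype (fun z => (s.indicator 1 (act (Quotient.out x) (zc z)) : ENNReal)) h

def Ind (d : ℕ) (ι : Type*) : Set (ι → Fin d → ℤ) := {z | LinearIndependent ℝ (zc z)}

lemma act_li {d : ℕ} {ι : Type*} (g : SLR d) {y : ι → Fin d → ℝ} :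
    LinearIndependent ℝ (act g y) ↔ LinearIndependent ℝ y := by
  have key : ∀ (g : SLR d) (y : ι → Fin d → ℝ), LinearIndependent ℝ y →
      LinearIndependent ℝ (act g y) := by
    intro g y hy
    refine hy.map' (Matrix.mulVecLin (g : Matrix (Fin d) (Fin d) ℝ)) ?_
    rw [LinearMap.ker_eq_bot]
    intro a b hab
    have : (g⁻¹).1.mulVec (g.1.mulVec a) = (g⁻¹).1.mulVec (g.1.mulVec b) := by
      simpa using congrArg ((g⁻¹).1.mulVec) hab
    simp only [Matrix.mulVec_mulVec] at this
    rw [← Matrix.SpecialLinearGroup.coe_mul] at this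
    simpa using this
  refine ⟨fun h => ?_, key g y⟩
  have := key g⁻¹ _ h
  rwa [← act_mul, inv_mul_cancel, act_one] at this

lemma ginv_Ind (d : ℕ) (ι : Type*) : GInv (Ind d ι) := by
  intro γ z hz
  simp only [Ind, Set.mem_ofPred_eq] at *
  rw [← act_zc_map, act_li]; exact hz

lemma measurableSet_li (d : ℕ) (ι : Type*) [Fintype ι] :
    MeasurableSet {y : ι → Fin d → ℝ | LinearIndependent ℝ y} :=
  (isOpen_setOfPred_linearIndependent).measurableSet

lemma nu_dep {d : ℕ} {ι : Type*} [Fintype ι] (μ : Measure (Xspace d))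
    {Z : Set (ι → Fin d → ℤ)} (hZ : GInv Z) (h : Z ⊆ Ind d ι) :
    nu μ Z {y | ¬ LinearIndependent ℝ y} = 0 := by
  have hs : MeasurableSet {y : ι → Fin d → ℝ | ¬ LinearIndependent ℝ y} :=
    (measurableSet_li d ι).compl
  rw [← lintegral_indicator_one hs, lintegral_nu μ hZ (measurable_one.indicator hs)]
  have : fhat Z ({y : ι → Fin d → ℝ | ¬ LinearIndependent ℝ y}.indicator 1) = fun _ => 0 := by
    funext x
    unfold fhat
    rw [ENNReal.tsum_eq_zero]
    intro z
    apply Set.indicator_of_notMem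
    simp only [Set.mem_ofPred_eq, not_not]
    exact (act_li _).2 (h z.2)
  rw [this]; simp

/-! ### Uniqueness of invariant measures -/

lemma exists_append_li {V : Type*} [AddCommGroup V] [Module ℝ V] [Module.Finite ℝ V]
    {r : ℕ} {v : Fin r → V} (hv : LinearIndependent ℝ v) :
    ∀ s : ℕ, r + s ≤ Module.finrank ℝ V → ∃ u : Fin s → V, LinearIndependent ℝ (Fin.append v u) := by
  intro s
  induction s with
  | zero =>
    intro _
    refine ⟨Fin.elim0, ?_⟩
    rw [Fin.append_elim0]
    exact hv
  | succ s ih =>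
    intro h
    obtain ⟨u, hu⟩ := ih (by omega)
    obtain ⟨x, hx⟩ := exists_linearIndependent_snoc_of_lt_finrank hu (by omega)
    refine ⟨Fin.snoc u x, ?_⟩
    rw [Fin.append_snoc]
    exact hx

/-- matrix with columns `v`, `u` -/
def Mx {r s : ℕ} (v : Fin r → Fin (r + s) → ℝ) (u : Fin s → Fin (r + s) → ℝ) :
    Matrix (Fin (r + s)) (Fin (r + s)) ℝ := fun i j => Fin.append v u j i

lemma Mx_act {r s : ℕ} (g : SLR (r + s)) (v : Fin r → Fin (r + s) → ℝ)
    (u : Fin s → Fin (r + s) → ℝ) : Mx (act g v) (act g u) = g.1 * Mx v u := by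
  ext i j
  rw [Matrix.mul_apply]
  unfold Mx
  refine Fin.addCases (fun a => ?_) (fun a => ?_) j
  · simp [act, Matrix.mulVec, dotProduct]
  · simp [act, Matrix.mulVec, dotProduct]

lemma Mx_det_ne {r s : ℕ} (v : Fin r → Fin (r + s) → ℝ)
    (u : Fin s → Fin (r + s) → ℝ) :
    (Mx v u).det ≠ 0 ↔ LinearIndependent ℝ (Fin.append v u) := by
  have h2 : (Mx v u).col = Fin.append v u := by funext i j; rfl
  rw [← isUnit_iff_ne_zero, ← Matrix.isUnit_iff_isUnit_det, ← Matrix.linearIndependent_cols_iff_isUnit, h2]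

lemma continuous_Mx {r s : ℕ} : Continuous (fun p : (Fin r → Fin (r + s) → ℝ) × (Fin s → Fin (r + s) → ℝ) =>
    Mx p.1 p.2) := by
  refine continuous_matrix fun i j => ?_
  unfold Mx
  refine Fin.addCases (fun a => ?_) (fun a => ?_) j
  · simp only [Fin.append_left]; fun_prop
  · simp only [Fin.append_right]; fun_prop

def scl {s D : ℕ} (t : ℝ) (u : Fin (s+1) → Fin D → ℝ) : Fin (s+1) → Fin D → ℝ :=
  fun j => if j = Fin.last s then t • u j else u j

lemma Mx_scl_det {r s : ℕ} (t : ℝ) (v : Fin r → Fin (r + (s+1)) → ℝ)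
    (u : Fin (s+1) → Fin (r + (s+1)) → ℝ) : (Mx v (scl t u)).det = t * (Mx v u).det := by
  have : Mx v (scl t u) = (Mx v u).updateCol (Fin.natAdd r (Fin.last s)) (t • (Mx v u).col (Fin.natAdd r (Fin.last s))) := by
    ext i j
    rw [Matrix.updateCol_apply]
    refine Fin.addCases (fun a => ?_) (fun a => ?_) j
    · have : Fin.castAdd (s+1) a ≠ Fin.natAdd r (Fin.last s) := by
        intro h
        have := congrArg Fin.val h
        simp at this; omega
      rw [if_neg this]
      simp only [Mx, Fin.append_left]
    · by_cases ha : a = Fin.last s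
      · subst ha
        rw [if_pos rfl]
        simp only [Mx, Fin.append_right, scl, if_true, Pi.smul_apply, smul_eq_mul, Matrix.col_apply]
      · have : Fin.natAdd r a ≠ Fin.natAdd r (Fin.last s) := by
          intro h; apply ha; exact (Fin.natAdd_inj r).1 h
        rw [if_neg this]
        simp only [Mx, Fin.append_right, scl, if_neg ha]
  rw [this, Matrix.det_updateCol_smul]
  congr 2
  ext i j
  rw [Matrix.updateCol_apply]
  split_ifs with h
  · rw [h]; rfl
  · rfl

lemma scl_act {s D : ℕ} (t : ℝ) (g : SLR D) (u : Fin (s+1) → Fin D → ℝ) :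
    scl t (act g u) = act g (scl t u) := by
  funext j
  by_cases h : j = Fin.last s
  · simp only [scl, act, if_pos h, Matrix.mulVec_smul]
  · simp only [scl, act, if_neg h]

abbrev Pr (r s : ℕ) := (Fin r → Fin (r + (s+1)) → ℝ) × (Fin (s+1) → Fin (r + (s+1)) → ℝ)

def pdet {r s : ℕ} (p : Pr r s) : ℝ := (Mx p.1 p.2).det

lemma continuous_pdet {r s : ℕ} : Continuous (pdet (r := r) (s := s)) :=
  Continuous.matrix_det continuous_Mx

def pact {r s : ℕ} (g : SLR (r + (s+1))) (p : Pr r s) : Pr r s := (act g p.1, act g p.2)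

lemma pdet_pact {r s : ℕ} (g : SLR (r + (s+1))) (p : Pr r s) : pdet (pact g p) = pdet p := by
  unfold pdet pact; simp only []; rw [Mx_act, Matrix.det_mul, g.2, one_mul]

def mkSL {m : ℕ} (A : Matrix (Fin m) (Fin m) ℝ) (h : A.det = 1) : SLR m := ⟨A, h⟩

lemma mkSL_coe {m : ℕ} (A : Matrix (Fin m) (Fin m) ℝ) (h : A.det = 1) :
    (mkSL A h : Matrix (Fin m) (Fin m) ℝ) = A := rfl

def psi {r s : ℕ} (p : Pr r s) : SLR (r + (s+1)) :=
  if h : pdet p ≠ 0 then mkSL (Mx p.1 (scl (pdet p)⁻¹ p.2)) (by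
    rw [Mx_scl_det]; exact inv_mul_cancel₀ h) else 1

lemma psi_coe {r s : ℕ} (p : Pr r s) (h : pdet p ≠ 0) :
    (psi p : Matrix _ _ ℝ) = Mx p.1 (scl (pdet p)⁻¹ p.2) := by
  unfold psi; rw [dif_pos h, mkSL_coe]

lemma psi_coe0 {r s : ℕ} (p : Pr r s) (h : ¬ pdet p ≠ 0) : psi p = 1 := by
  unfold psi; rw [dif_neg h]

lemma psi_pact {r s : ℕ} (g : SLR (r + (s+1))) (p : Pr r s) (h : pdet p ≠ 0) :
    psi (pact g p) = g * psi p := by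
  apply Subtype.ext
  have h' : pdet (pact g p) ≠ 0 := by rwa [pdet_pact]
  rw [psi_coe _ h', pdet_pact]
  rw [Matrix.SpecialLinearGroup.coe_mul, psi_coe _ h]
  have : (pact g p).2 = act g p.2 := rfl
  rw [this, scl_act]
  exact Mx_act g _ _

lemma measurable_SLR {α : Type*} [MeasurableSpace α] {m : ℕ} {f : α → SLR m}
    (h : ∀ i j, Measurable fun a => (f a : Matrix (Fin m) (Fin m) ℝ) i j) : Measurable f := by
  refine measurable_comap_iff.2 ?_
  exact measurable_pi_lambda _ fun i => measurable_pi_lambda _ fun j => h i j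

lemma measurable_entry {m : ℕ} (a b : Fin m) :
    Measurable fun g : SLR m => (g : Matrix (Fin m) (Fin m) ℝ) a b :=
  (measurable_pi_apply b).comp ((measurable_pi_apply a).comp measurable_subtype_coe)

lemma measurable_Mx_entry {r s : ℕ} (i j : Fin (r + (s+1))) :
    Measurable (fun p : Pr r s => Mx p.1 (scl (pdet p)⁻¹ p.2) i j) := by
  unfold Mx
  refine Fin.addCases (fun a => ?_) (fun a => ?_) j
  · simp only [Fin.append_left]; fun_prop
  · simp only [Fin.append_right, scl]
    by_cases ha : a = Fin.last s
    · simp only [ha, if_true, Pi.smul_apply, smul_eq_mul]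
      refine Measurable.mul (continuous_pdet.measurable.inv) ?_
      fun_prop
    · simp only [ha, if_false]; fun_prop

lemma measurable_psi {r s : ℕ} : Measurable (psi (r := r) (s := s)) := by
  refine measurable_SLR fun i j => ?_
  have h0 : (fun p : Pr r s => (psi p : Matrix _ _ ℝ) i j) = fun p => if pdet p ≠ 0 then
      Mx p.1 (scl (pdet p)⁻¹ p.2) i j else (1 : Matrix _ _ ℝ) i j := by
    funext p
    by_cases h : pdet p ≠ 0
    · rw [if_pos h, psi_coe p h]
    · rw [if_neg h, psi_coe0 p h]; rfl
  rw [h0]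
  refine Measurable.ite ?_ (measurable_Mx_entry i j) measurable_const
  exact (isOpen_ne.preimage continuous_pdet).measurableSet

instance (m : ℕ) : MeasurableMul₂ (SLR m) := by
  refine ⟨measurable_SLR fun i j => ?_⟩
  simp only [Matrix.SpecialLinearGroup.coe_mul, Matrix.mul_apply]
  exact Finset.measurable_sum _ fun b _ =>
    ((measurable_entry _ _).comp measurable_fst).mul ((measurable_entry _ _).comp measurable_snd)

instance (m : ℕ) : MeasurableInv (SLR m) := by
  refine ⟨measurable_SLR fun i j => ?_⟩
  simp only [Matrix.SpecialLinearGroup.coe_inv]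
  have : Continuous fun A : Matrix (Fin m) (Fin m) ℝ => A.adjugate i j := by
    have : Continuous fun A : Matrix (Fin m) (Fin m) ℝ => A.adjugate := Continuous.matrix_adjugate continuous_id
    exact this.matrix_elem i j
  have h1 : @Continuous (Fin m → Fin m → ℝ) ℝ _ _ (fun A => Matrix.adjugate A i j) := this
  have h2 : @Measurable (Fin m → Fin m → ℝ) ℝ _ _ (fun A => Matrix.adjugate A i j) :=
    Continuous.measurable h1
  exact h2.comp measurable_subtype_coe

lemma vol_mulVec {d : ℕ} (g : SLR d) : MeasurePreserving (fun x : Fin d → ℝ => g.1.mulVec x) := by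
  refine ⟨?_, ?_⟩
  · exact (by fun_prop : Continuous fun x : Fin d → ℝ => g.1.mulVec x).measurable
  · have := Real.map_matrix_volume_pi_eq_smul_volume_pi (M := g.1) (by rw [g.2]; exact one_ne_zero)
    rw [g.2] at this
    simp only [inv_one, abs_one, ENNReal.ofReal_one, one_smul] at this
    exact this

lemma vol_act {d : ℕ} {ι : Type*} [Fintype ι] (g : SLR d) :
    MeasurePreserving (act (ι := ι) g) volume volume :=
  volume_preserving_pi (fun _ => vol_mulVec g)

lemma vol_not_li (d : ℕ) : ∀ r, r ≤ d →
    volume {v : Fin r → Fin d → ℝ | ¬ LinearIndependent ℝ v} = 0 := by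
  intro r
  induction r with
  | zero =>
    intro _
    have : {v : Fin 0 → Fin d → ℝ | ¬ LinearIndependent ℝ v} = ∅ := by
      ext v; simp
    rw [this]; simp
  | succ r ih =>
    intro h
    have hmp := (volume_preserving_piFinSuccAbove (fun _ : Fin (r+1) => Fin d → ℝ) 0).symm
    have hms : MeasurableSet {v : Fin (r+1) → Fin d → ℝ | ¬ LinearIndependent ℝ v} :=
      (measurableSet_li d (Fin (r+1))).compl
    rw [← hmp.measure_preimage hms.nullMeasurableSet]
    rw [Measure.volume_eq_prod, ← Measure.prod_swap, Measure.map_apply measurable_swap (hmp.measurable hms),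
      Measure.measure_prod_null (measurable_swap (hmp.measurable hms))]
    have := ih (by omega)
    have h2 : ∀ᵐ v : Fin r → Fin d → ℝ, LinearIndependent ℝ v := by
      rw [ae_iff]; exact this
    filter_upwards [h2] with v hv
    have hlt : Submodule.span ℝ (Set.range v) ≠ ⊤ := by
      intro htop
      have h1 := finrank_range_le_card (R := ℝ) v
      rw [Set.finrank, htop, finrank_top] at h1
      simp at h1; omega
    refine measure_mono_null ?_ (Measure.addHaar_submodule volume _ hlt)
    intro x hx
    by_contra hx2
    apply hx
    have h3 : LinearIndependent ℝ (Fin.cons x v : Fin (r+1) → Fin d → ℝ) :=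
      linearIndependent_finCons.2 ⟨hv, hx2⟩
    have h4 : (MeasurableEquiv.piFinSuccAbove (fun _ : Fin (r+1) => Fin d → ℝ) 0).symm (x, v)
        = (Fin.cons x v : Fin (r+1) → Fin d → ℝ) := by
      simp only [MeasurableEquiv.piFinSuccAbove_symm_apply]
      exact Fin.insertNth_zero' x v
    simp only [Prod.swap_prod_mk]
    rw [h4]
    exact h3

lemma exists_SL_append {r s : ℕ} {v : Fin r → Fin (r + (s+1)) → ℝ} (hv : LinearIndependent ℝ v) :
    ∃ u : Fin (s+1) → Fin (r + (s+1)) → ℝ, pdet (v, u) = 1 := by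
  obtain ⟨u, hu⟩ := exists_append_li hv (s+1) (by simp)
  have h := (Mx_det_ne v u).2 hu
  refine ⟨scl (Mx v u).det⁻¹ u, ?_⟩
  unfold pdet
  rw [Mx_scl_det]
  exact inv_mul_cancel₀ h

def stdv (r s : ℕ) : Fin r → Fin (r + s) → ℝ := fun i => Pi.single (Fin.castAdd s i) 1

lemma exists_act_eq {r s : ℕ} {v : Fin r → Fin (r + (s+1)) → ℝ} (hv : LinearIndependent ℝ v) :
    ∃ g : SLR (r + (s+1)), act g (stdv r (s+1)) = v := by
  obtain ⟨u, hu⟩ := exists_SL_append hv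
  refine ⟨mkSL (Mx v u) hu, ?_⟩
  funext i j
  have h1 : ((mkSL (Mx v u) hu : SLR _) : Matrix _ _ ℝ) = Mx v u := rfl
  unfold act
  rw [h1]
  simp [stdv, Mx]

def Dset (r s : ℕ) : Set (Pr r s) := {p | 1/2 < pdet p ∧ pdet p < 2}

lemma isOpen_Dset (r s : ℕ) : IsOpen (Dset r s) :=
  (isOpen_lt continuous_const continuous_pdet).inter (isOpen_lt continuous_pdet continuous_const)

def lam {r s : ℕ} (ν : Measure (Fin r → Fin (r + (s+1)) → ℝ)) : Measure (SLR (r + (s+1))) :=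
  ((ν.prod volume).restrict (Dset r s)).map psi

lemma lintegral_lam {r s : ℕ} (ν : Measure (Fin r → Fin (r + (s+1)) → ℝ))
    {F : SLR (r + (s+1)) → ENNReal} (hF : Measurable F) :
    ∫⁻ g, F g ∂(lam ν) = ∫⁻ p, (Dset r s).indicator (fun p => F (psi p)) p ∂(ν.prod volume) := by
  unfold lam
  rw [lintegral_map hF measurable_psi, lintegral_indicator (isOpen_Dset r s).measurableSet]

lemma lam_inv {r s : ℕ} (ν : Measure (Fin r → Fin (r + (s+1)) → ℝ)) [SFinite ν]
    (hν : ∀ g, ν.map (act g) = ν) : (lam ν).IsMulLeftInvariant := by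
  refine ⟨fun g => Measure.ext_of_lintegral _ fun F hF => ?_⟩
  have hm : Measurable fun h : SLR (r + (s+1)) => g * h := measurable_const_mul g
  rw [lintegral_map hF hm, lintegral_lam ν (F := fun h => F (g * h)) (hF.comp hm), lintegral_lam ν hF]
  have hmp : MeasurePreserving (pact (r := r) (s := s) g) (ν.prod volume) (ν.prod volume) :=
    MeasurePreserving.prod ⟨measurable_act g, hν g⟩ (vol_act g)
  have hF2 : Measurable fun p : Pr r s => F (psi p) := hF.comp measurable_psi
  rw [← hmp.lintegral_comp (hF2.indicator (isOpen_Dset r s).measurableSet)]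
  refine lintegral_congr fun p => ?_
  by_cases h : p ∈ Dset r s
  · have h' : pact g p ∈ Dset r s := by
      simp only [Dset, Set.mem_ofPred_eq, pdet_pact]; exact h
    have h0 : pdet p ≠ 0 := by have := h.1; linarith
    rw [Set.indicator_of_mem h, Set.indicator_of_mem h', psi_pact g p h0]
  · have h' : pact g p ∉ Dset r s := by
      simp only [Dset, Set.mem_ofPred_eq, pdet_pact]; exact h
    rw [Set.indicator_of_notMem h, Set.indicator_of_notMem h']

/-- first columns -/
def cols {r s : ℕ} (A : Matrix (Fin (r + s)) (Fin (r + s)) ℝ) : Fin r → Fin (r + s) → ℝ :=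
  fun j i => A i (Fin.castAdd s j)

lemma continuous_cols {r s : ℕ} : Continuous (cols (r := r) (s := s)) := by
  unfold cols
  fun_prop

lemma cols_psi {r s : ℕ} (p : Pr r s) (h : pdet p ≠ 0) : cols (psi p : Matrix _ _ ℝ) = p.1 := by
  rw [psi_coe p h]
  funext j i
  simp [cols, Mx]

def Oset {r s : ℕ} (U : Set (Fin r → Fin (r + (s+1)) → ℝ)) :
    Set (Matrix (Fin (r + (s+1))) (Fin (r + (s+1))) ℝ) :=
  {A | cols A ∈ U ∧ ∀ i j, |A i j| < 2}

lemma isOpen_Oset {r s : ℕ} {U : Set (Fin r → Fin (r + (s+1)) → ℝ)} (hU : IsOpen U) :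
    IsOpen (Oset U) := by
  have : Oset U = cols ⁻¹' U ∩ ⋂ i, ⋂ j, {A | |A i j| < 2} := by
    ext A; simp [Oset]
  rw [this]
  refine (hU.preimage continuous_cols).inter (isOpen_iInter_of_finite fun i =>
    isOpen_iInter_of_finite fun j => isOpen_lt ?_ continuous_const)
  fun_prop

lemma lam_O {r s : ℕ} (ν : Measure (Fin r → Fin (r + (s+1)) → ℝ)) [SFinite ν]
    {U : Set (Fin r → Fin (r + (s+1)) → ℝ)} (hU : IsOpen U) (hνU : ν U ≠ ⊤) :
    lam ν {g : SLR (r + (s+1)) | (g : Matrix _ _ ℝ) ∈ Oset U} ≠ ⊤ := by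
  have hmO : MeasurableSet {g : SLR (r + (s+1)) | (g : Matrix _ _ ℝ) ∈ Oset U} := by
    have h1 : @IsOpen (Fin (r + (s+1)) → Fin (r + (s+1)) → ℝ) _ (Oset U) := isOpen_Oset hU
    exact measurable_subtype_coe h1.measurableSet
  unfold lam
  rw [Measure.map_apply measurable_psi hmO]
  rw [Measure.restrict_apply (measurable_psi hmO)]
  have hsub : (psi ⁻¹' {g : SLR (r + (s+1)) | (g : Matrix _ _ ℝ) ∈ Oset U}) ∩ Dset r s ⊆
      U ×ˢ (Set.pi Set.univ fun _ => Metric.ball (0 : Fin (r + (s+1)) → ℝ) 4) := by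
    rintro p ⟨hp, hD⟩
    have h0 : pdet p ≠ 0 := by have := hD.1; linarith
    simp only [Set.mem_preimage, Set.mem_ofPred_eq, Oset] at hp
    rw [cols_psi p h0] at hp
    refine ⟨hp.1, fun j _ => ?_⟩
    rw [mem_ball_zero_iff, pi_norm_lt_iff (by norm_num)]
    intro i
    have := hp.2 i (Fin.natAdd r j)
    rw [psi_coe p h0] at this
    simp only [Mx, Fin.append_right, scl] at this
    rw [Real.norm_eq_abs]
    split_ifs at this
    · simp only [Pi.smul_apply, smul_eq_mul, abs_mul, abs_inv] at this
      have h1 : 0 < |pdet p| := abs_pos.2 h0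
      have h2 : |pdet p| < 2 := by rw [abs_of_pos (by linarith [hD.1])]; exact hD.2
      rw [inv_mul_lt_iff₀ h1] at this
      linarith
    · linarith
  refine ne_top_of_le_ne_top ?_ (measure_mono hsub)
  rw [Measure.prod_prod, volume_pi_pi]
  refine ENNReal.mul_ne_top hνU ?_
  exact ENNReal.prod_ne_top fun i _ => measure_ball_lt_top.ne

lemma exists_cover {r s : ℕ} {U : Set (Fin r → Fin (r + (s+1)) → ℝ)} (hU : IsOpen U)
    (he : stdv r (s+1) ∈ U) :
    ∃ T : Set (SLR (r + (s+1))), T.Countable ∧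
      ∀ h : SLR (r + (s+1)), ∃ g ∈ T, ((g * h : SLR _) : Matrix _ _ ℝ) ∈ Oset U := by
  have : SecondCountableTopology (Matrix (Fin (r + (s+1))) (Fin (r + (s+1))) ℝ) :=
    inferInstanceAs (SecondCountableTopology (Fin (r + (s+1)) → Fin (r + (s+1)) → ℝ))
  obtain ⟨T, hT, hT2⟩ := TopologicalSpace.isOpen_iUnion_countable
    (fun g : SLR (r + (s+1)) => {A : Matrix (Fin (r + (s+1))) (Fin (r + (s+1))) ℝ | g.1 * A ∈ Oset U})
    (fun g => (isOpen_Oset hU).preimage (by fun_prop))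
  refine ⟨T, hT, fun h => ?_⟩
  have : h.1 ∈ ⋃ g : SLR (r + (s+1)), {A : Matrix (Fin (r + (s+1))) (Fin (r + (s+1))) ℝ | g.1 * A ∈ Oset U} := by
    refine Set.mem_iUnion.2 ⟨h⁻¹, ?_⟩
    have h1 : (h⁻¹).1 * h.1 = 1 := by
      rw [← Matrix.SpecialLinearGroup.coe_mul]; simp
    simp only [Set.mem_ofPred_eq]
    rw [h1]
    refine ⟨?_, fun i j => ?_⟩
    · convert he
      funext j i
      simp [cols, stdv, Matrix.one_apply, Pi.single_apply]
    · rw [Matrix.one_apply]; split_ifs <;> norm_num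
  rw [← hT2] at this
  simp only [Set.mem_iUnion] at this
  obtain ⟨g, hg, hgA⟩ := this
  exact ⟨g, hg, hgA⟩

lemma measurableSet_O {r s : ℕ} {U : Set (Fin r → Fin (r + (s+1)) → ℝ)} (hU : IsOpen U) :
    MeasurableSet {g : SLR (r + (s+1)) | (g : Matrix _ _ ℝ) ∈ Oset U} := by
  have h1 : @IsOpen (Fin (r + (s+1)) → Fin (r + (s+1)) → ℝ) _ (Oset U) := isOpen_Oset hU
  exact measurable_subtype_coe h1.measurableSet

lemma lam_translate {r s : ℕ} (ν : Measure (Fin r → Fin (r + (s+1)) → ℝ)) [SFinite ν]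
    (hν : ∀ g, ν.map (act g) = ν) (g : SLR (r + (s+1)))
    {U : Set (Fin r → Fin (r + (s+1)) → ℝ)} :
    lam ν {h : SLR (r + (s+1)) | ((g * h : SLR _) : Matrix _ _ ℝ) ∈ Oset U} =
    lam ν {g : SLR (r + (s+1)) | (g : Matrix _ _ ℝ) ∈ Oset U} := by
  have := lam_inv ν hν
  exact measure_preimage_mul (lam ν) g {g : SLR (r + (s+1)) | (g : Matrix _ _ ℝ) ∈ Oset U}

lemma lam_sigmaFinite {r s : ℕ} (ν : Measure (Fin r → Fin (r + (s+1)) → ℝ)) [SFinite ν]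
    (hν : ∀ g, ν.map (act g) = ν)
    {U : Set (Fin r → Fin (r + (s+1)) → ℝ)} (hU : IsOpen U) (he : stdv r (s+1) ∈ U)
    (hνU : ν U ≠ ⊤) : SigmaFinite (lam ν) := by
  obtain ⟨T, hT, hc⟩ := exists_cover hU he
  refine Measure.sigmaFinite_of_countable (S := (fun g : SLR (r + (s+1)) =>
    {h : SLR (r + (s+1)) | ((g * h : SLR _) : Matrix _ _ ℝ) ∈ Oset U}) '' T) (hT.image _) ?_ ?_
  · rintro _ ⟨g, hg, rfl⟩
    simp only []
    rw [lam_translate ν hν]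
    exact (lam_O ν hU hνU).lt_top
  · refine Set.eq_univ_of_forall fun h => ?_
    obtain ⟨g, hg, hgh⟩ := hc h
    exact ⟨_, ⟨g, hg, rfl⟩, hgh⟩

lemma lam_vol_O_ne {r s : ℕ} 
    {U : Set (Fin r → Fin (r + (s+1)) → ℝ)} (hU : IsOpen U) (he : stdv r (s+1) ∈ U) :
    lam (volume : Measure (Fin r → Fin (r + (s+1)) → ℝ)) {g : SLR (r + (s+1)) | (g : Matrix _ _ ℝ) ∈ Oset U} ≠ 0 := by
  intro h0
  obtain ⟨T, hT, hc⟩ := exists_cover hU he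
  have h1 : lam (volume : Measure (Fin r → Fin (r + (s+1)) → ℝ)) Set.univ = 0 := by
    refine measure_mono_null (t := ⋃ g ∈ T, {h : SLR (r + (s+1)) | ((g * h : SLR _) : Matrix _ _ ℝ) ∈ Oset U}) ?_ ?_
    · intro h _
      obtain ⟨g, hg, hgh⟩ := hc h
      exact Set.mem_biUnion hg hgh
    · rw [measure_biUnion_null_iff hT]
      intro g _
      rw [lam_translate _ (fun g => (vol_act g).map_eq)]
      exact h0
  unfold lam at h1
  rw [Measure.map_apply measurable_psi MeasurableSet.univ] at h1
  simp only [Set.preimage_univ, Measure.restrict_apply_univ] at h1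
  have hne : (Dset r s).Nonempty := by
    have hl : LinearIndependent ℝ (stdv r (s+1)) := by
      have := (Pi.basisFun ℝ (Fin (r + (s+1)))).linearIndependent.comp (Fin.castAdd (s+1)) (Fin.castAdd_injective _ _)
      convert this using 1
      funext i
      simp [stdv]
    obtain ⟨u, hu⟩ := exists_SL_append hl
    exact ⟨_, by rw [hu]; norm_num, by rw [hu]; norm_num⟩
  have e1 : Measure.IsOpenPosMeasure (volume : Measure (Fin r → Fin (r + (s+1)) → ℝ)) := inferInstance
  have e2 : Measure.IsOpenPosMeasure (volume : Measure (Fin (s+1) → Fin (r + (s+1)) → ℝ)) := inferInstance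
  have e3 := Measure.prod.instIsOpenPosMeasure (μ := (volume : Measure (Fin r → Fin (r + (s+1)) → ℝ)))
    (ν := (volume : Measure (Fin (s+1) → Fin (r + (s+1)) → ℝ)))
  have := (isOpen_Dset r s).measure_pos ((volume : Measure (Fin r → Fin (r + (s+1)) → ℝ)).prod volume) hne
  exact this.ne' h1

lemma nu_sigmaFinite {r s : ℕ} (ν : Measure (Fin r → Fin (r + (s+1)) → ℝ))
    (hν : ∀ g, ν.map (act g) = ν) (hli : ν {v | ¬ LinearIndependent ℝ v} = 0)
    {U : Set (Fin r → Fin (r + (s+1)) → ℝ)} (hU : IsOpen U) (he : stdv r (s+1) ∈ U)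
    (hνU : ν U ≠ ⊤) : SigmaFinite ν := by
  obtain ⟨T, hT, hT2⟩ := TopologicalSpace.isOpen_iUnion_countable
    (fun g : SLR (r + (s+1)) => {v : Fin r → Fin (r + (s+1)) → ℝ | act g v ∈ U})
    (fun g => hU.preimage (by unfold act; fun_prop))
  refine Measure.sigmaFinite_of_countable (S := insert {v | ¬ LinearIndependent ℝ v} ((fun g : SLR (r + (s+1)) =>
    {v : Fin r → Fin (r + (s+1)) → ℝ | act g v ∈ U}) '' T)) ((hT.image _).insert _) ?_ ?_
  · rintro _ (rfl | ⟨g, hg, rfl⟩)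
    · rw [hli]; simp
    · have : ν {v : Fin r → Fin (r + (s+1)) → ℝ | act g v ∈ U} = ν U := by
        conv_rhs => rw [← hν g]
        rw [Measure.map_apply (measurable_act g) hU.measurableSet]; rfl
      simp only []
      rw [this]; exact hνU.lt_top
  · refine Set.eq_univ_of_forall fun v => ?_
    by_cases hv : LinearIndependent ℝ v
    · obtain ⟨g, hg⟩ := exists_act_eq hv
      have : v ∈ ⋃ g : SLR (r + (s+1)), {v : Fin r → Fin (r + (s+1)) → ℝ | act g v ∈ U} := by
        refine Set.mem_iUnion.2 ⟨g⁻¹, ?_⟩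
        simp only [Set.mem_ofPred_eq]
        rw [← hg, ← act_mul, inv_mul_cancel, act_one]; exact he
      rw [← hT2] at this
      simp only [Set.mem_iUnion] at this
      obtain ⟨g, hg, hgA⟩ := this
      exact ⟨_, Or.inr ⟨g, hg, rfl⟩, hgA⟩
    · exact ⟨_, Or.inl rfl, hv⟩

theorem unique_aux {r s : ℕ} (ν : Measure (Fin r → Fin (r + (s+1)) → ℝ))
    (hν : ∀ g, ν.map (act g) = ν) (hli : ν {v | ¬ LinearIndependent ℝ v} = 0)
    {U : Set (Fin r → Fin (r + (s+1)) → ℝ)} (hU : IsOpen U) (he : stdv r (s+1) ∈ U)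
    (hνU : ν U ≠ ⊤) (hvU : volume U ≠ ⊤) : ∃ c : ENNReal, c ≠ ⊤ ∧ ν = c • volume := by
  have hσ := nu_sigmaFinite ν hν hli hU he hνU
  have hvv : ∀ g : SLR (r + (s+1)), (volume : Measure (Fin r → Fin (r + (s+1)) → ℝ)).map (act g) = volume :=
    fun g => (vol_act g).map_eq
  have i1 := lam_inv ν hν
  have i2 := lam_inv volume hvv
  have s1 := lam_sigmaFinite ν hν hU he hνU
  have s2 := lam_sigmaFinite volume hvv hU he hvU
  have hne := lam_vol_O_ne hU he
  have key := measure_eq_div_smul (lam ν) (lam volume) hne (lam_O volume hU hvU)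
  set c := lam ν {g : SLR (r + (s+1)) | (g : Matrix _ _ ℝ) ∈ Oset U} /
    lam (volume : Measure (Fin r → Fin (r + (s+1)) → ℝ)) {g : SLR (r + (s+1)) | (g : Matrix _ _ ℝ) ∈ Oset U} with hc
  have hct : c ≠ ⊤ := ENNReal.div_ne_top (lam_O ν hU hνU) hne
  refine ⟨c, hct, ?_⟩
  obtain ⟨Ψ, hΨpos, hΨm, hΨi⟩ := exists_pos_lintegral_lt_of_sigmaFinite
    (lam (volume : Measure (Fin r → Fin (r + (s+1)) → ℝ))) (ε := 1) one_ne_zero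
  set H : Pr r s → ENNReal := (Dset r s).indicator (fun p => (Ψ (psi p) : ENNReal)) with hH
  have hHm : Measurable H := 
    ((hΨm.comp measurable_psi).coe_nnreal_ennreal).indicator (isOpen_Dset r s).measurableSet
  set W : (Fin r → Fin (r + (s+1)) → ℝ) → ENNReal := fun v => ∫⁻ u, H (v, u) with hW
  have hWm : Measurable W := hHm.lintegral_prod_right'
  have hint : ∀ (ν : Measure (Fin r → Fin (r + (s+1)) → ℝ)) [SFinite ν]
      (A : Set (Fin r → Fin (r + (s+1)) → ℝ)), MeasurableSet A →
      ν.withDensity W A = ∫⁻ g, {g : SLR (r + (s+1)) | cols (g : Matrix _ _ ℝ) ∈ A}.indicator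
        (fun g => (Ψ g : ENNReal)) g ∂(lam ν) := by
    intro ν _ A hA
    have hmc : MeasurableSet {g : SLR (r + (s+1)) | cols (g : Matrix _ _ ℝ) ∈ A} := by
      have h1 : @Measurable (Fin (r + (s+1)) → Fin (r + (s+1)) → ℝ) _ _ _ (cols (r := r) (s := s+1)) := by
        unfold cols; fun_prop
      exact (h1.comp measurable_subtype_coe) hA
    rw [withDensity_apply _ hA, lintegral_lam ν (hΨm.coe_nnreal_ennreal.indicator hmc)]
    have hmm : Measurable ((Dset r s).indicator (fun p => {g : SLR (r + (s+1)) | cols (g : Matrix _ _ ℝ) ∈ A}.indicator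
        (fun g => (Ψ g : ENNReal)) (psi p))) := (Measurable.indicator ((hΨm.coe_nnreal_ennreal.indicator hmc).comp measurable_psi) (isOpen_Dset r s).measurableSet)
    rw [lintegral_prod _ hmm.aemeasurable]
    rw [← lintegral_indicator hA]
    refine lintegral_congr fun v => ?_
    by_cases hv : v ∈ A
    · rw [Set.indicator_of_mem hv]
      refine lintegral_congr fun u => ?_
      by_cases hp : (v, u) ∈ Dset r s
      · have h0 : pdet (v, u) ≠ 0 := by have := hp.1; linarith
        rw [hH, Set.indicator_of_mem hp, Set.indicator_of_mem hp, Set.indicator_of_mem]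
        simp only [Set.mem_ofPred_eq]
        rw [cols_psi _ h0]; exact hv
      · rw [hH, Set.indicator_of_notMem hp, Set.indicator_of_notMem hp]
    · rw [Set.indicator_of_notMem hv]
      rw [← lintegral_zero (μ := (volume : Measure (Fin (s+1) → Fin (r + (s+1)) → ℝ)))]
      refine lintegral_congr fun u => ?_
      by_cases hp : (v, u) ∈ Dset r s
      · have h0 : pdet (v, u) ≠ 0 := by have := hp.1; linarith
        rw [Set.indicator_of_mem hp, Set.indicator_of_notMem]
        simp only [Set.mem_ofPred_eq]
        rw [cols_psi _ h0]; exact hv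
      · rw [Set.indicator_of_notMem hp]
  have hwd : ν.withDensity W = c • (volume : Measure (Fin r → Fin (r + (s+1)) → ℝ)).withDensity W := by
    refine Measure.ext fun A hA => ?_
    rw [hint ν A hA, Measure.smul_apply, hint volume A hA, key, lintegral_smul_measure]
  have hfin : (volume : Measure (Fin r → Fin (r + (s+1)) → ℝ)).withDensity W Set.univ ≠ ⊤ := by
    rw [hint volume _ MeasurableSet.univ]
    refine ne_top_of_lt (lt_of_le_of_lt ?_ hΨi)
    refine lintegral_mono fun g => ?_
    exact Set.indicator_le_self _ _ _
  have hWpos : ∀ v, LinearIndependent ℝ v → W v ≠ 0 := by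
    intro v hv h0
    obtain ⟨u, hu⟩ := exists_SL_append hv
    have hm : Measurable fun u => H (v, u) := hHm.comp measurable_prodMk_left
    rw [hW] at h0
    simp only [] at h0
    rw [lintegral_eq_zero_iff hm] at h0
    have hop : IsOpen {u | (v, u) ∈ Dset r s} := (isOpen_Dset r s).preimage (by fun_prop)
    have hz : volume {u | (v, u) ∈ Dset r s} = 0 := by
      refine measure_mono_null ?_ h0
      intro u hu h1
      simp only [Set.mem_ofPred_eq] at hu h1
      rw [hH, Set.indicator_of_mem hu] at h1
      have := hΨpos (psi (v,u))
      simp at h1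
      exact this.ne' h1
    exact (hop.measure_pos volume ⟨u, by constructor <;> rw [hu] <;> norm_num⟩).ne' hz
  have hae1 : ∀ᵐ v ∂ν, W v ≠ 0 := by
    have : ∀ᵐ v ∂ν, LinearIndependent ℝ v := by rw [ae_iff]; exact hli
    filter_upwards [this] with v hv using hWpos v hv
  have hae2 : ∀ᵐ v : Fin r → Fin (r + (s+1)) → ℝ, W v ≠ 0 := by
    have : ∀ᵐ v : Fin r → Fin (r + (s+1)) → ℝ, LinearIndependent ℝ v := by
      rw [ae_iff]; exact vol_not_li _ r (by omega)
    filter_upwards [this] with v hv using hWpos v hv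
  have hae3 : ∀ᵐ v ∂ν, W v ≠ ⊤ := by
    have : ∫⁻ v, W v ∂ν ≠ ⊤ := by
      rw [← setLIntegral_univ, ← withDensity_apply _ MeasurableSet.univ, hwd, Measure.smul_apply]
      exact ENNReal.mul_ne_top hct hfin
    filter_upwards [ae_lt_top hWm this] with v hv using hv.ne
  have hae4 : ∀ᵐ v : Fin r → Fin (r + (s+1)) → ℝ, W v ≠ ⊤ := by
    have : ∫⁻ v, W v ≠ ⊤ := by
      rw [← setLIntegral_univ, ← withDensity_apply _ MeasurableSet.univ]
      exact hfin
    filter_upwards [ae_lt_top hWm this] with v hv using hv.ne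
  rw [← withDensity_inv_same hWm hae1 hae3, hwd, withDensity_smul_measure, withDensity_inv_same hWm hae2 hae4]

theorem unique {d r : ℕ} (hr : r < d) (ν : Measure (Fin r → Fin d → ℝ))
    (hν : ∀ g, ν.map (act g) = ν) (hli : ν {v | ¬ LinearIndependent ℝ v} = 0)
    {U : Set (Fin r → Fin d → ℝ)} (hU : IsOpen U)
    (he : (fun i : Fin r => (Pi.single (Fin.castLE hr.le i) 1 : Fin d → ℝ)) ∈ U)
    (hνU : ν U ≠ ⊤) : ∃ c : ENNReal, c ≠ ⊤ ∧ ν = c • volume := by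
  obtain ⟨s, rfl⟩ : ∃ s, d = r + (s+1) := ⟨d - r - 1, by omega⟩
  refine unique_aux ν hν hli (U := U ∩ Metric.ball 0 2) (hU.inter Metric.isOpen_ball) ⟨he, ?_⟩ 
    (ne_top_of_le_ne_top hνU (measure_mono Set.inter_subset_left))
    (ne_top_of_le_ne_top measure_ball_lt_top.ne (measure_mono Set.inter_subset_right))
  rw [mem_ball_zero_iff, pi_norm_lt_iff (by norm_num)]
  intro i
  rw [pi_norm_lt_iff (by norm_num)]
  intro j
  simp only [stdv, Pi.single_apply]
  split_ifs <;> norm_num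

/-! ### Linear substitutions -/

def TA {d : ℕ} {ι κ : Type*} [Fintype κ] (A : Matrix ι κ ℝ) (w : κ → Fin d → ℝ) :
    ι → Fin d → ℝ := fun i => ∑ j, A i j • w j

lemma TA_act {d : ℕ} {ι κ : Type*} [Fintype κ] (A : Matrix ι κ ℝ) (g : SLR d) (w : κ → Fin d → ℝ) :
    TA A (act g w) = act g (TA A w) := by
  funext i
  simp only [TA, act]
  rw [Matrix.mulVec_sum]
  simp only [Matrix.mulVec_smul]

lemma continuous_TA {d : ℕ} {ι κ : Type*} [Fintype κ] (A : Matrix ι κ ℝ) :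
    Continuous (TA (d := d) A) := by
  unfold TA; fun_prop

def TAl (d : ℕ) {ι : Type*} [Fintype ι] (A : Matrix ι ι ℝ) :
    (ι → Fin d → ℝ) →ₗ[ℝ] (ι → Fin d → ℝ) where
  toFun := TA A
  map_add' x y := by funext i; simp [TA, Finset.sum_add_distrib]
  map_smul' c x := by
    funext i; simp only [TA, Pi.smul_apply, RingHom.id_apply, Finset.smul_sum]
    refine Finset.sum_congr rfl fun j _ => smul_comm _ _ _

def swapE (d : ℕ) (ι : Type*) : (ι → Fin d → ℝ) ≃ₗ[ℝ] (Fin d → ι → ℝ) where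
  toFun w := fun a i => w i a
  invFun w := fun i a => w a i
  map_add' _ _ := rfl
  map_smul' _ _ := rfl
  left_inv _ := rfl
  right_inv _ := rfl

lemma det_TAl (d : ℕ) {ι : Type*} [Fintype ι] [DecidableEq ι] (A : Matrix ι ι ℝ) :
    LinearMap.det (TAl d A) = A.det ^ d := by
  have h := LinearMap.det_conj (TAl d A) (swapE d ι)
  rw [← h]
  have h2 : (swapE d ι : _ →ₗ[ℝ] _) ∘ₗ TAl d A ∘ₗ ((swapE d ι).symm : _ →ₗ[ℝ] _) =
      LinearMap.pi (fun a : Fin d => (Matrix.toLin' A).comp (LinearMap.proj a)) := by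
    ext1 a
    apply LinearMap.ext
    intro x
    funext b i
    simp [swapE, TAl, TA, Matrix.mulVec, dotProduct]
  rw [h2, LinearMap.det_pi]
  simp

lemma map_TA {d : ℕ} {ι : Type*} [Fintype ι] [DecidableEq ι] {A : Matrix ι ι ℝ} (hA : A.det ≠ 0) :
    (volume : Measure (ι → Fin d → ℝ)).map (TA A) = ENNReal.ofReal (|A.det|⁻¹ ^ d) • volume := by
  have h : LinearMap.det (TAl d A) ≠ 0 := by rw [det_TAl]; exact pow_ne_zero _ hA
  have := Measure.map_linearMap_addHaar_eq_smul_addHaar (volume : Measure (ι → Fin d → ℝ)) h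
  rw [det_TAl] at this
  rw [show (TA A : (ι → Fin d → ℝ) → _) = TAl d A from rfl, this]
  congr 2
  rw [abs_inv, abs_pow, inv_pow]

lemma lintegral_TA {d : ℕ} {ι : Type*} [Fintype ι] [DecidableEq ι] {A : Matrix ι ι ℝ} (hA : A.det ≠ 0)
    {F : (ι → Fin d → ℝ) → ENNReal} (hF : Measurable F) :
    ∫⁻ w, F (TA A w) = ENNReal.ofReal (|A.det|⁻¹ ^ d) * ∫⁻ w, F w := by
  rw [← lintegral_map hF (continuous_TA A).measurable, map_TA hA, lintegral_smul_measure]; rfl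

/-! ### Reindexing -/

lemma measurable_ri {d : ℕ} {ι κ : Type*} (e : κ → ι) :
    Measurable (fun w : ι → Fin d → ℝ => fun i => w (e i)) := by fun_prop

lemma vol_ri {d : ℕ} {ι κ : Type*} [Fintype ι] [Fintype κ] (e : κ ≃ ι) :
    MeasurePreserving (fun w : ι → Fin d → ℝ => fun i => w (e i)) := by
  have h := volume_measurePreserving_piCongrLeft (fun _ : κ => Fin d → ℝ) e.symm
  suffices hh : (fun w : ι → Fin d → ℝ => fun i => w (e i)) = 
      (MeasurableEquiv.piCongrLeft (fun _ : κ => Fin d → ℝ) e.symm) by rw [hh]; exact h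
  funext w i
  have h2 := MeasurableEquiv.piCongrLeft_apply_apply (β := fun _ : κ => Fin d → ℝ) (e := e.symm) (x := w) (i := e i)
  rw [e.symm_apply_apply] at h2
  exact h2.symm

/-- nu of reindexed set -/
lemma nu_ri {d : ℕ} {ι κ : Type*} [Fintype ι] [Fintype κ] (e : κ ≃ ι) (μ : Measure (Xspace d))
    {Z : Set (ι → Fin d → ℤ)} (hZ : GInv Z) {Y : Set (κ → Fin d → ℤ)} (hY : GInv Y)
    (h : ∀ z, z ∈ Z ↔ (fun i => z (e i)) ∈ Y) :
    (nu μ Z).map (fun w => fun i => w (e i)) = nu μ Y := by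
  refine Measure.ext_of_lintegral _ fun F hF => ?_
  rw [lintegral_map hF (measurable_ri e), lintegral_nu μ hZ (F := fun w => F (fun i => w (e i))) (hF.comp (measurable_ri e)), lintegral_nu μ hY hF]
  refine lintegral_congr fun x => ?_
  unfold fhat
  let E : Z ≃ Y :=
    { toFun := fun z => ⟨fun i => z.1 (e i), (h _).1 z.2⟩
      invFun := fun y => ⟨fun i => y.1 (e.symm i), (h _).2 (by simp)⟩
      left_inv := by intro z; simp
      right_inv := by intro z; simp }
  rw [← E.tsum_eq]
  rfl

def Prop1 {d : ℕ} {ι : Type*} [Fintype ι] (μ : Measure (Xspace d)) (Z : Set (ι → Fin d → ℤ)) : Prop :=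
  ∃ c : ENNReal, c ≠ ⊤ ∧ nu μ Z = c • volume

lemma prop1_ri {d : ℕ} {ι κ : Type*} [Fintype ι] [Fintype κ] (e : κ ≃ ι) (μ : Measure (Xspace d))
    {Z : Set (ι → Fin d → ℤ)} (hZ : GInv Z) {Y : Set (κ → Fin d → ℤ)} (hY : GInv Y)
    (h : ∀ z, z ∈ Z ↔ (fun i => z (e i)) ∈ Y) {c : ENNReal} (hc : nu μ Z = c • volume) :
    nu μ Y = c • volume := by
  rw [← nu_ri e μ hZ hY h, hc, Measure.map_smul, (vol_ri e).map_eq]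

/-- Uniqueness for `nu` -/
lemma prop1_of_fin {d r : ℕ} (hr : r < d) {μ : Measure (Xspace d)} (hμ : InvM μ)
    {Z : Set (Fin r → Fin d → ℤ)} (hZ : GInv Z) (hI : Z ⊆ Ind d (Fin r))
    {U : Set (Fin r → Fin d → ℝ)} (hU : IsOpen U)
    (he : (fun i : Fin r => (Pi.single (Fin.castLE hr.le i) 1 : Fin d → ℝ)) ∈ U)
    (hνU : nu μ Z U ≠ ⊤) : Prop1 μ Z :=
  unique hr (nu μ Z) (nu_inv hμ hZ) (nu_dep μ hZ hI) hU he hνU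

/-! ### Saturated tuples -/

def vc {d : ℕ} (x : Fin d → ℤ) : Fin d → ℝ := fun j => (x j : ℝ)

def vcl (d : ℕ) : (Fin d → ℤ) →ₗ[ℤ] (Fin d → ℝ) where
  toFun := vc
  map_add' x y := by funext j; simp [vc]
  map_smul' c x := by funext j; simp [vc]

lemma vc_add {d : ℕ} (x y : Fin d → ℤ) : vc (x + y) = vc x + vc y := (vcl d).map_add x y
lemma vc_sub {d : ℕ} (x y : Fin d → ℤ) : vc (x - y) = vc x - vc y := (vcl d).map_sub x y
lemma vc_smul {d : ℕ} (n : ℤ) (x : Fin d → ℤ) : vc (n • x) = (n : ℝ) • vc x := by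
  funext j; simp [vc]
lemma vc_sum {d : ℕ} {ι : Type*} (s : Finset ι) (f : ι → Fin d → ℤ) :
    vc (∑ i ∈ s, f i) = ∑ i ∈ s, vc (f i) := map_sum (vcl d) f s
lemma vc_comb {d : ℕ} {ι : Type*} [Fintype ι] (n : ι → ℤ) (z : ι → Fin d → ℤ) :
    vc (∑ i, n i • z i) = ∑ i, (n i : ℝ) • zc z i := by
  rw [vc_sum]; exact Finset.sum_congr rfl fun i _ => vc_smul _ _
lemma vc_inj {d : ℕ} : Function.Injective (vc (d := d)) := by
  intro x y h; funext j
  have := congrFun h j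
  simpa [vc] using this

def Sat (d r : ℕ) : Set (Fin r → Fin d → ℤ) :=
  {z | LinearIndependent ℝ (zc z) ∧ ∀ x : Fin d → ℤ, vc x ∈ Submodule.span ℝ (Set.range (zc z)) →
    ∃ n : Fin r → ℤ, x = ∑ j, n j • z j}

lemma span_smul_mem {E : Type*} [AddCommGroup E] [Module ℝ E] {S : Submodule ℝ E} {x : E} {m : ℝ}
    (hm : m ≠ 0) (h : m • x ∈ S) : x ∈ S := by
  have := S.smul_mem m⁻¹ h
  rwa [smul_smul, inv_mul_cancel₀ hm, one_smul] at this

lemma sat_functional {d r : ℕ} {z : Fin r → Fin d → ℤ} (hz : z ∈ Sat d r) {u : Fin d → ℤ}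
    (hu : vc u ∉ Submodule.span ℝ (Set.range (zc z))) :
    ∃ (a : ℕ) (b : Fin d → ℤ) (n : Fin r → ℤ) (f : (Fin d → ℤ) →ₗ[ℤ] ℤ), 1 ≤ a ∧
      (∀ j, f (z j) = 0) ∧ f b = 1 ∧ u = (a : ℤ) • b + ∑ j, n j • z j := by
  classical
  set N : Submodule ℤ (Fin d → ℤ) := Submodule.span ℤ (Set.range z) with hN
  have hNmem : ∀ x ∈ N, ∃ n : Fin r → ℤ, x = ∑ j, n j • z j := by
    intro x hx
    obtain ⟨n, hn⟩ := (Submodule.mem_span_range_iff_exists_fun ℤ).1 hx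
    exact ⟨n, hn.symm⟩
  have hNsat : ∀ x, x ∈ N ↔ vc x ∈ Submodule.span ℝ (Set.range (zc z)) := by
    intro x
    constructor
    · intro hx
      obtain ⟨n, rfl⟩ := hNmem x hx
      rw [vc_comb]
      exact Submodule.sum_mem _ fun j _ => Submodule.smul_mem _ _ (Submodule.subset_span ⟨j, rfl⟩)
    · intro hx
      obtain ⟨n, rfl⟩ := hz.2 x hx
      exact Submodule.sum_mem _ fun j _ => Submodule.smul_mem _ _ (Submodule.subset_span ⟨j, rfl⟩)
  have htf : Module.IsTorsionFree ℤ ((Fin d → ℤ) ⧸ N) := by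
    rw [Module.isTorsionFree_iff_smul_eq_zero]
    intro m x
    induction x using Submodule.Quotient.induction_on with
    | H x =>
      intro h
      by_contra hcon
      push Not at hcon
      apply hcon.2
      rw [← Submodule.Quotient.mk_smul, Submodule.Quotient.mk_eq_zero, hNsat, vc_smul] at h
      rw [Submodule.Quotient.mk_eq_zero, hNsat]
      exact span_smul_mem (by exact_mod_cast hcon.1) h
  have hfree : Module.Free ℤ ((Fin d → ℤ) ⧸ N) := inferInstance
  set B := Module.Free.chooseBasis ℤ ((Fin d → ℤ) ⧸ N) with hB
  set ub : (Fin d → ℤ) ⧸ N := N.mkQ u with hub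
  have hub0 : ub ≠ 0 := by
    intro h
    rw [hub, Submodule.mkQ_apply, Submodule.Quotient.mk_eq_zero, hNsat] at h
    exact hu h
  have hexi : ∃ i, B.repr ub i ≠ 0 := by
    by_contra hcon
    push Not at hcon
    exact hub0 (B.ext_elem (by intro i; rw [hcon i]; simp))
  obtain ⟨i0, hi0⟩ := hexi
  set I : Submodule ℤ ℤ := LinearMap.range (LinearMap.applyₗ (R := ℤ) (M₂ := ℤ) ub) with hI
  obtain ⟨G, hG⟩ := (IsPrincipalIdealRing.principal (R := ℤ) I).principal
  have hIn : I = Submodule.span ℤ {(G.natAbs : ℤ)} := by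
    rw [hG]; exact (Int.span_natAbs G).symm
  have hdiv : ∀ i, (G.natAbs : ℤ) ∣ B.repr ub i := by
    intro i
    have : B.repr ub i ∈ I := ⟨B.coord i, by simp⟩
    rw [hIn] at this
    exact Ideal.mem_span_singleton.1 this
  have ha : G.natAbs ≠ 0 := by
    intro h
    have := hdiv i0
    rw [h] at this
    exact hi0 (by simpa using this)
  have haI : (G.natAbs : ℤ) ∈ I := by rw [hIn]; exact Submodule.mem_span_singleton_self _
  obtain ⟨f0, hf0⟩ := haI
  have hf0' : f0 ub = (G.natAbs : ℤ) := hf0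
  choose q hq using hdiv
  obtain ⟨b, hb⟩ := N.mkQ_surjective (∑ i, q i • B i)
  have hub2 : ub = (G.natAbs : ℤ) • N.mkQ b := by
    rw [hb]
    conv_lhs => rw [← B.sum_repr ub]
    rw [Finset.smul_sum]
    refine Finset.sum_congr rfl fun i _ => ?_
    rw [hq i, smul_smul]
  have hmem : u - (G.natAbs : ℤ) • b ∈ N := by
    rw [← Submodule.Quotient.mk_eq_zero, ← Submodule.mkQ_apply, map_sub, map_smul, ← hub2, sub_self]
  obtain ⟨n, hn⟩ := hNmem _ hmem
  refine ⟨G.natAbs, b, n, f0 ∘ₗ N.mkQ, by omega, fun j => ?_, ?_, ?_⟩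
  · have : N.mkQ (z j) = 0 := by
      rw [Submodule.mkQ_apply, Submodule.Quotient.mk_eq_zero]
      exact Submodule.subset_span ⟨j, rfl⟩
    simp only [LinearMap.comp_apply, this, map_zero]
  · rw [hub2, map_smul, smul_eq_mul] at hf0'
    have h2 : (G.natAbs : ℤ) ≠ 0 := by exact_mod_cast ha
    simp only [LinearMap.comp_apply]
    exact mul_left_cancel₀ h2 (by rw [hf0', mul_one])
  · rw [← hn]; abel

/-- real extension of an integral functional -/
lemma functional_real {d : ℕ} (f : (Fin d → ℤ) →ₗ[ℤ] ℤ) :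
    ∃ F : (Fin d → ℝ) →ₗ[ℝ] ℝ, ∀ x, F (vc x) = f x := by
  classical
  refine ⟨∑ i, (f (Pi.single i 1) : ℝ) • LinearMap.proj i, fun x => ?_⟩
  simp only [LinearMap.sum_apply, LinearMap.smul_apply, LinearMap.proj_apply, vc, smul_eq_mul]
  conv_rhs => rw [LinearMap.pi_apply_eq_sum_univ f x]
  push_cast
  refine Finset.sum_congr rfl fun i _ => ?_
  rw [mul_comm]
  simp only [smul_eq_mul]
  push_cast
  congr 3
  funext j
  simp [Pi.single_apply, eq_comm]

lemma zc_snoc {d r : ℕ} (z : Fin r → Fin d → ℤ) (b : Fin d → ℤ) :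
    zc (Fin.snoc z b : Fin (r+1) → Fin d → ℤ) = (Fin.snoc (zc z) (vc b) : Fin (r+1) → Fin d → ℝ) := by
  funext i
  refine Fin.lastCases ?_ (fun i => ?_) i
  · funext j; simp [zc, vc]
  · funext j; simp [zc]

lemma gen {d r : ℕ} {z : Fin r → Fin d → ℤ} (hz : z ∈ Sat d r) {u : Fin d → ℤ}
    (hu : vc u ∉ Submodule.span ℝ (Set.range (zc z))) :
    ∃ (a : ℕ) (b : Fin d → ℤ) (c : Fin r → ℕ), 1 ≤ a ∧ (∀ j, c j < a) ∧
      (Fin.snoc z b : Fin (r+1) → Fin d → ℤ) ∈ Sat d (r+1) ∧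
      u = (a : ℤ) • b + ∑ j, (c j : ℤ) • z j := by
  obtain ⟨a, b, n, f, ha, hfz, hfb, hu2⟩ := sat_functional hz hu
  have ha0 : (a : ℤ) ≠ 0 := by positivity
  set b' := b + ∑ j, (n j / (a:ℤ)) • z j with hb'
  have hfb' : f b' = 1 := by
    rw [hb', map_add, hfb, map_sum]
    simp only [map_smul, hfz, smul_zero, Finset.sum_const_zero, add_zero]
  obtain ⟨F, hF⟩ := functional_real f
  have hFspan : ∀ y ∈ Submodule.span ℝ (Set.range (zc z)), F y = 0 := by
    intro y hy
    have : Submodule.span ℝ (Set.range (zc z)) ≤ LinearMap.ker F := by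
      rw [Submodule.span_le]
      rintro _ ⟨j, rfl⟩
      have : F (zc z j) = f (z j) := hF (z j)
      simp [this, hfz]
    exact this hy
  have hFb : F (vc b') = 1 := by rw [hF, hfb']; simp
  refine ⟨a, b', fun j => (n j % (a:ℤ)).toNat, ha, fun j => ?_, ⟨?_, ?_⟩, ?_⟩
  · show (n j % (a:ℤ)).toNat < a
    have h1 := Int.emod_nonneg (n j) ha0
    have h2 := Int.emod_lt_of_pos (n j) (by positivity : (0:ℤ) < a)
    omega
  · rw [zc_snoc]
    refine linearIndependent_finSnoc.2 ⟨hz.1, fun hmem => ?_⟩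
    have := hFspan _ hmem
    rw [hFb] at this; exact one_ne_zero this
  · intro x hx
    rw [zc_snoc, Fin.range_snoc, Submodule.mem_span_insert] at hx
    obtain ⟨β, y, hy, hxy⟩ := hx
    have hβ : β = f x := by
      have := hF x
      rw [hxy, map_add, map_smul, hFb, hFspan y hy] at this
      simpa using this
    have hx2 : vc (x - f x • b') ∈ Submodule.span ℝ (Set.range (zc z)) := by
      rw [vc_sub, vc_smul, ← hβ, hxy]
      simpa using hy
    obtain ⟨m, hm⟩ := hz.2 _ hx2
    refine ⟨Fin.snoc m (f x), ?_⟩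
    rw [Fin.sum_univ_castSucc]
    simp only [Fin.snoc_castSucc, Fin.snoc_last]
    rw [← hm]; abel
  · rw [hu2, hb', smul_add, add_assoc, Finset.smul_sum, ← Finset.sum_add_distrib]
    congr 1
    refine Finset.sum_congr rfl fun j _ => ?_
    rw [smul_smul, ← add_smul]
    congr 1
    have h1 := Int.emod_nonneg (n j) ha0
    have h2 := Int.mul_ediv_add_emod (n j) a
    rw [Int.toNat_of_nonneg h1]
    exact h2.symm

lemma tsum_le_of_inj {A B α : Type*} {Z : Set A} {Y : Set B} (F : A → ENNReal) (G : α → B → ENNReal)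
    (rec : α → B → A)
    (h : ∀ z ∈ Z, F z ≠ 0 → ∃ a, ∃ y ∈ Y, F z ≤ G a y ∧ z = rec a y) :
    ∑' z : Z, F z.1 ≤ ∑' a, ∑' y : Y, G a y.1 := by
  classical
  have h' : ∀ z : (Function.support fun z : Z => F z.1), ∃ p : α × Y, F z.1.1 ≤ G p.1 p.2.1 ∧ z.1.1 = rec p.1 p.2.1 := by
    intro z
    obtain ⟨a, y, hy, h1, h2⟩ := h z.1.1 z.1.2 z.2
    exact ⟨(a, ⟨y, hy⟩), h1, h2⟩
  choose φ h1 h2 using h'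
  have hinj : Function.Injective φ := by
    intro z w hzw
    apply Subtype.ext; apply Subtype.ext
    rw [h2 z, h2 w, hzw]
  rw [← ENNReal.tsum_prod (f := fun a (y : Y) => G a y.1), ← tsum_subtype_support]
  calc _ ≤ ∑' z : (Function.support fun z : Z => F z.1), G (φ z).1 (φ z).2.1 := ENNReal.tsum_le_tsum h1
    _ ≤ _ := ENNReal.tsum_comp_le_tsum_of_injective hinj (fun p : α × Y => G p.1 p.2.1)

lemma nu_le' {d : ℕ} {ι κ α : Type*} [Fintype ι] [Fintype κ] [Countable α]
    (μ : Measure (Xspace d))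
    {Z : Set (ι → Fin d → ℤ)} (hZ : GInv Z) {Y : Set (κ → Fin d → ℤ)} (hY : GInv Y)
    {F : (ι → Fin d → ℝ) → ENNReal} (hF : Measurable F)
    {G : α → (κ → Fin d → ℝ) → ENNReal} (hG : ∀ a, Measurable (G a))
    (rec : α → (κ → Fin d → ℤ) → (ι → Fin d → ℤ))
    (h : ∀ g : SLR d, ∀ z ∈ Z, F (act g (zc z)) ≠ 0 → ∃ a, ∃ y ∈ Y,
      F (act g (zc z)) ≤ G a (act g (zc y)) ∧ z = rec a y) :
    ∫⁻ y, F y ∂(nu μ Z) ≤ ∑' a, ∫⁻ y, G a y ∂(nu μ Y) := by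
  refine nu_le μ hZ hY hF hG fun g => ?_
  exact tsum_le_of_inj (fun z => F (act g (zc z))) (fun a y => G a (act g (zc y))) rec (h g)

lemma nu_le_set {d : ℕ} {ι κ : Type*} [Fintype ι] [Fintype κ]
    (μ : Measure (Xspace d))
    {Z : Set (ι → Fin d → ℤ)} (hZ : GInv Z) {Y : Set (κ → Fin d → ℤ)} (hY : GInv Y)
    {F : Set (ι → Fin d → ℝ)} (hF : MeasurableSet F)
    {G : Set (κ → Fin d → ℝ)} (hG : MeasurableSet G)
    (rec : (κ → Fin d → ℤ) → (ι → Fin d → ℤ))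
    (h : ∀ g : SLR d, ∀ z ∈ Z, act g (zc z) ∈ F → ∃ y ∈ Y, act g (zc y) ∈ G ∧ z = rec y) :
    nu μ Z F ≤ nu μ Y G := by
  rw [← lintegral_indicator_one hF, ← lintegral_indicator_one hG]
  refine (nu_le' μ hZ hY (α := Unit) (measurable_one.indicator hF) (G := fun _ => G.indicator 1)
    (fun _ => measurable_one.indicator hG) (fun _ => rec) ?_).trans ?_
  · intro g z hz h0
    obtain ⟨y, hy, h1, h2⟩ := h g z hz (Set.mem_of_indicator_ne_zero h0)
    refine ⟨(), y, hy, ?_, h2⟩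
    rw [Set.indicator_of_mem h1, Set.indicator_of_mem (Set.mem_of_indicator_ne_zero h0)]
    simp
  · simp

lemma ginv_Sat (d r : ℕ) : GInv (Sat d r) := by
  intro γ z hz
  refine ⟨ginv_Ind d (Fin r) γ z hz.1, fun x hx => ?_⟩
  have hinv : ∀ y : Fin d → ℤ, (γ⁻¹).1.mulVec (γ.1.mulVec y) = y := by
    intro y
    rw [Matrix.mulVec_mulVec, ← Matrix.SpecialLinearGroup.coe_mul]; simp
  have hinv2 : ∀ y : Fin d → ℤ, γ.1.mulVec ((γ⁻¹).1.mulVec y) = y := by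
    intro y
    rw [Matrix.mulVec_mulVec, ← Matrix.SpecialLinearGroup.coe_mul]; simp
  set g := Matrix.SpecialLinearGroup.map (n := Fin d) (Int.castRingHom ℝ) γ⁻¹ with hg
  have h2 : vc ((γ⁻¹).1.mulVec x) ∈ Submodule.span ℝ (Set.range (zc z)) := by
    have e1 : vc ((γ⁻¹).1.mulVec x) = Matrix.mulVecLin (g : Matrix (Fin d) (Fin d) ℝ) (vc x) := by
      have := act_zc_map γ⁻¹ (fun _ : Unit => x)
      exact (congrFun this ()).symm
    have e2 : Set.range (zc z) = Matrix.mulVecLin (g : Matrix (Fin d) (Fin d) ℝ) '' (Set.range (zc fun i => γ.1.mulVec (z i))) := by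
      rw [← Set.range_comp]
      congr 1
      have := act_zc_map γ⁻¹ (fun i => γ.1.mulVec (z i))
      simp only [hinv] at this
      exact this.symm
    rw [e1, e2, Submodule.span_image]
    exact Submodule.mem_map_of_mem hx
  obtain ⟨n, hn⟩ := hz.2 _ h2
  refine ⟨n, ?_⟩
  rw [← hinv2 x, hn, Matrix.mulVec_sum]
  simp only [Matrix.mulVec_smul]

/-- coordinate box -/
def Box (d : ℕ) (ι : Type*) (ρ : ℝ) : Set (ι → Fin d → ℝ) := {w | ∀ i j, |w i j| ≤ ρ}

lemma measurableSet_Box (d : ℕ) (ι : Type*) [Fintype ι] (ρ : ℝ) : MeasurableSet (Box d ι ρ) := by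
  have : IsClosed (Box d ι ρ) := by
    have : Box d ι ρ = ⋂ i, ⋂ j, {w | |w i j| ≤ ρ} := by ext w; simp [Box]
    rw [this]
    exact isClosed_iInter fun i => isClosed_iInter fun j => isClosed_le (by fun_prop) continuous_const
  exact this.measurableSet

lemma base_finite (d : ℕ) (μ : Measure (Xspace d)) [IsProbabilityMeasure μ] (ρ : ℝ) :
    nu μ (Sat d d) (Box d (Fin d) ρ) ≠ ⊤ := by
  obtain ⟨K, hK⟩ := exists_nat_ge ((Nat.factorial d : ℝ) * |ρ| ^ d)
  set Y : Set (Fin d → Fin d → ℤ) := Set.Icc (fun _ _ => -(K:ℤ)) (fun _ _ => (K:ℤ)) with hY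
  have hYf : Finite Y := (Set.finite_Icc _ _).to_subtype
  rw [← lintegral_indicator_one (measurableSet_Box d (Fin d) ρ), 
    lintegral_nu μ (ginv_Sat d d) (measurable_one.indicator (measurableSet_Box d (Fin d) ρ))]
  have hbd : ∀ x, fhat (Sat d d) ((Box d (Fin d) ρ).indicator 1) x ≤ ∑' y : Y, (1 : ENNReal) := by
    intro x
    unfold fhat
    set g := Quotient.out x
    by_cases hne : ∃ z0 ∈ Sat d d, act g (zc z0) ∈ Box d (Fin d) ρ
    · obtain ⟨z0, hz0, hB0⟩ := hne
      have := tsum_le_of_inj (Z := Sat d d) (Y := Y) (α := Unit) 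
        (fun z => ((Box d (Fin d) ρ).indicator 1 (act g (zc z)) : ENNReal)) (fun _ _ => 1)
        (fun _ P => fun i => ∑ j, P i j • z0 j) ?_
      · simpa using this
      · intro z hz h0
        have hB : act g (zc z) ∈ Box d (Fin d) ρ := Set.mem_of_indicator_ne_zero h0
        have hli := (act_li g).2 hz0.1
        have hspan : Submodule.span ℝ (Set.range (zc z0)) = ⊤ := by
          apply LinearIndependent.span_eq_top_of_card_eq_finrank' hz0.1; simp
        have hex : ∀ i, ∃ n : Fin d → ℤ, z i = ∑ j, n j • z0 j := fun i => 
          hz0.2 (z i) (by rw [hspan]; trivial)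
        choose P hP using hex
        refine ⟨(), P, ?_, ?_, funext hP⟩
        · have hrow : ∀ i, act g (zc z) i = ∑ j, (P i j : ℝ) • act g (zc z0) j := by
            intro i
            have h1 : zc z = TA (Matrix.of fun i j => (P i j : ℝ)) (zc z0) := by
              funext i
              have : zc z i = vc (z i) := rfl
              rw [this, hP i, vc_comb]
              rfl
            rw [h1, ← TA_act]; rfl
          set W0 : Matrix (Fin d) (Fin d) ℝ := act g (zc z0) with hW0
          have hdet : W0.det = ((Matrix.of z0).det : ℤ) := by
            have : W0 = Matrix.of (zc z0) * (g : Matrix (Fin d) (Fin d) ℝ)ᵀ := by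
              ext i j
              simp [hW0, act, Matrix.mulVec, dotProduct, Matrix.mul_apply, mul_comm]
            rw [this, Matrix.det_mul, Matrix.det_transpose, g.2, mul_one]
            exact (Int.cast_det (R := ℝ) (Matrix.of z0)).symm
          have hdet0 : W0.det ≠ 0 := by
            rw [← isUnit_iff_ne_zero, ← Matrix.isUnit_iff_isUnit_det, ← Matrix.linearIndependent_rows_iff_isUnit]
            exact hli
          have hdet1 : 1 ≤ |W0.det| := by
            rw [hdet] at hdet0 ⊢
            exact_mod_cast Int.one_le_abs (by exact_mod_cast hdet0)
          have hle : ∀ i j, |(P i j : ℝ)| ≤ K := by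
            intro i j
            have h1 := Matrix.det_updateRow_sum W0 j (fun k => (P i k : ℝ))
            have h2 : (∑ k, (P i k : ℝ) • W0 k) = act g (zc z) i := (hrow i).symm
            rw [h2] at h1
            have h3 := Matrix.det_le (A := W0.updateRow j (act g (zc z) i)) (abv := AbsoluteValue.abs) (x := |ρ|) (by
              intro a b
              rw [Matrix.updateRow_apply]
              split_ifs
              · exact (hB i b).trans (le_abs_self _)
              · exact (hB0 a b).trans (le_abs_self _))
            rw [h1] at h3
            simp only [AbsoluteValue.abs_apply, smul_eq_mul, abs_mul, Fintype.card_fin, nsmul_eq_mul] at h3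
            calc |(P i j : ℝ)| ≤ |(P i j : ℝ)| * |W0.det| := le_mul_of_one_le_right (abs_nonneg _) hdet1
              _ ≤ _ := h3
              _ ≤ K := hK
          have hle' : ∀ i j, |P i j| ≤ K := fun i j => by exact_mod_cast hle i j
          exact ⟨fun i j => (abs_le.1 (hle' i j)).1, fun i j => (abs_le.1 (hle' i j)).2⟩
        · exact Set.indicator_le_self' (by simp) _
    · have : ∀ z : Sat d d, ((Box d (Fin d) ρ).indicator 1 (act g (zc z.1)) : ENNReal) = 0 := by
        intro z
        apply Set.indicator_of_notMem
        intro h; exact hne ⟨z.1, z.2, h⟩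
      simp only [this]
      simp
  refine ne_top_of_le_ne_top ?_ (lintegral_mono hbd)
  rw [lintegral_const, measure_univ, mul_one]
  rw [ENNReal.tsum_one]
  simp

lemma minkowski (d : ℕ) (s : Set (Fin d → ℝ)) (hs : ∀ x ∈ s, -x ∈ s) (hc : Convex ℝ s)
    (h : 2 ^ d < volume s) : ∃ u : Fin d → ℤ, u ≠ 0 ∧ vc u ∈ s := by
  have fund := ZSpan.isAddFundamentalDomain (Pi.basisFun ℝ (Fin d)) volume
  have hv : volume (ZSpan.fundamentalDomain (Pi.basisFun ℝ (Fin d))) = 1 := by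
    rw [ZSpan.fundamentalDomain_pi_basisFun, volume_pi_pi]; simp
  have : Countable (Submodule.span ℤ (Set.range (Pi.basisFun ℝ (Fin d)))).toAddSubgroup :=
    inferInstanceAs (Countable (Submodule.span ℤ (Set.range (Pi.basisFun ℝ (Fin d)))))
  obtain ⟨x, hx0, hxs⟩ := exists_ne_zero_mem_lattice_of_measure_mul_two_pow_lt_measure 
    (L := (Submodule.span ℤ (Set.range (Pi.basisFun ℝ (Fin d)))).toAddSubgroup)
    (s := s) fund hs hc (by
      rw [hv]; simpa using h)
  have h2 : (x : Fin d → ℝ) ∈ Submodule.span ℤ (Set.range (Pi.basisFun ℝ (Fin d))) := x.2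
  rw [Module.Basis.mem_span_iff_repr_mem] at h2
  choose u hu using h2
  have hux : vc u = (x : Fin d → ℝ) := by
    funext i
    have := hu i
    simpa [vc] using this
  refine ⟨u, ?_, hux ▸ hxs⟩
  rintro rfl
  apply hx0
  apply Subtype.ext
  rw [← hux]
  funext i; simp [vc]

def Unb (d r : ℕ) (hr : r < d) : Set (Fin r → Fin d → ℝ) :=
  {v | ∀ i j, |v i j - (Pi.single (Fin.castLE hr.le i) 1 : Fin d → ℝ) j| < 1 / (2 * d)}

lemma isOpen_Unb (d r : ℕ) (hr : r < d) : IsOpen (Unb d r hr) := by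
  have : Unb d r hr = ⋂ i, ⋂ j, {v | |v i j - (Pi.single (Fin.castLE hr.le i) 1 : Fin d → ℝ) j| < 1 / (2 * d)} := by
    ext; simp [Unb]
  rw [this]
  refine isOpen_iInter_of_finite fun i => isOpen_iInter_of_finite fun j => isOpen_lt (by fun_prop) continuous_const

lemma mem_Unb (d r : ℕ) (hr : r < d) : (fun i : Fin r => (Pi.single (Fin.castLE hr.le i) 1 : Fin d → ℝ)) ∈ Unb d r hr := by
  intro i j
  have : 0 < d := by omega
  simp only [sub_self, abs_zero]; positivity

lemma not_span {d r : ℕ} (hr : r < d) {g : SLR d} {z : Fin r → Fin d → ℤ} (hz : z ∈ Sat d r)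
    (hv : act g (zc z) ∈ Unb d r hr) {u : Fin d → ℤ} (hu : u ≠ 0)
    (hb : ∀ i : Fin r, |(g.1.mulVec (vc u)) (Fin.castLE hr.le i)| ≤ 1/4) :
    vc u ∉ Submodule.span ℝ (Set.range (zc z)) := by
  intro hmem
  obtain ⟨n, hn⟩ := hz.2 u hmem
  have hd : (0:ℝ) < d := by exact_mod_cast (by omega : 0 < d)
  have hgu : g.1.mulVec (vc u) = ∑ j, (n j : ℝ) • act g (zc z) j := by
    rw [hn, vc_comb, Matrix.mulVec_sum]
    simp only [Matrix.mulVec_smul]; rfl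
  have hn0 : ∃ j, n j ≠ 0 := by
    by_contra hcon
    push Not at hcon
    apply hu; rw [hn]; simp [hcon]
  obtain ⟨j0, hj0⟩ := hn0
  obtain ⟨j, -, hj⟩ := Finset.exists_max_image Finset.univ (fun j => |(n j : ℝ)|) ⟨j0, Finset.mem_univ _⟩
  have h1 : 1 ≤ |(n j : ℝ)| := by
    refine le_trans ?_ (hj j0 (Finset.mem_univ _))
    exact_mod_cast Int.one_le_abs hj0
  have h2 : (g.1.mulVec (vc u)) (Fin.castLE hr.le j) - n j = 
      ∑ k, (n k : ℝ) * (act g (zc z) k (Fin.castLE hr.le j) - (Pi.single (Fin.castLE hr.le k) 1 : Fin d → ℝ) (Fin.castLE hr.le j)) := by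
    rw [hgu]
    simp only [Finset.sum_apply, Pi.smul_apply, smul_eq_mul, mul_sub, Finset.sum_sub_distrib]
    congr 1
    rw [Finset.sum_eq_single j]
    · simp
    · intro b _ hb
      rw [Pi.single_eq_of_ne, mul_zero]
      intro h; apply hb; exact (Fin.castLE_injective hr.le h).symm
    · simp
  have h3 : |(g.1.mulVec (vc u)) (Fin.castLE hr.le j) - n j| ≤ |(n j : ℝ)| * (1/2) := by
    rw [h2]
    calc _ ≤ ∑ k : Fin r, |(n k : ℝ) * (act g (zc z) k (Fin.castLE hr.le j) - (Pi.single (Fin.castLE hr.le k) 1 : Fin d → ℝ) (Fin.castLE hr.le j))| := Finset.abs_sum_le_sum_abs _ _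
      _ ≤ ∑ k : Fin r, |(n j : ℝ)| * (1/(2*d)) := by
        refine Finset.sum_le_sum fun k _ => ?_
        rw [abs_mul]
        exact mul_le_mul (hj k (Finset.mem_univ _)) (hv k _).le (abs_nonneg _) (abs_nonneg _)
      _ = |(n j : ℝ)| * (r * (1/(2*d))) := by simp; ring
      _ ≤ _ := by
        gcongr
        have : (r:ℝ) ≤ d := by exact_mod_cast hr.le
        field_simp
        linarith
  have h4 := hb j
  have h5 : |(n j : ℝ)| ≤ |(g.1.mulVec (vc u)) (Fin.castLE hr.le j)| + |(g.1.mulVec (vc u)) (Fin.castLE hr.le j) - n j| := by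
    have := abs_sub ((g.1.mulVec (vc u)) (Fin.castLE hr.le j)) ((g.1.mulVec (vc u)) (Fin.castLE hr.le j) - n j)
    simpa using this
  linarith

lemma descend {d r : ℕ} (hr : r < d) {g : SLR d} {z : Fin r → Fin d → ℤ} (hz : z ∈ Sat d r)
    (hv : act g (zc z) ∈ Unb d r hr) : ∃ b : Fin d → ℤ,
      (Fin.snoc z b : Fin (r+1) → Fin d → ℤ) ∈ Sat d (r+1) ∧ 
      act g (zc (Fin.snoc z b : Fin (r+1) → Fin d → ℤ)) ∈ Box d (Fin (r+1)) (2 * 4 ^ d + 2 * d) := by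
  have hd : (1:ℝ) ≤ d := by exact_mod_cast (by omega : 1 ≤ d)
  set w : Fin d → ℝ := fun i => (1/4) * (if i.val < r then 1 else 8 * 4 ^ d) with hw
  have hw0 : ∀ i, 0 < w i := by intro i; simp only [hw]; split_ifs <;> positivity
  set B : Set (Fin d → ℝ) := Set.pi Set.univ (fun i => Set.Icc (-w i) (w i)) with hB
  have hvol : 2 ^ d < volume B := by
    rw [hB, volume_pi_pi]
    simp only [Real.volume_Icc]
    rw [← ENNReal.ofReal_prod_of_nonneg (fun i _ => by linarith [hw0 i])]
    have e : (2:ENNReal)^d = ENNReal.ofReal (2^d) := by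
      rw [ENNReal.ofReal_pow (by norm_num)]; simp
    rw [e, ENNReal.ofReal_lt_ofReal_iff_of_nonneg (by positivity)]
    have e2 : ∏ i, (w i - -w i) = 2 ^ d * ((1/4)^d * ∏ i : Fin d, (if i.val < r then (1:ℝ) else 8 * 4 ^ d)) := by
      have : ∀ i, w i - -w i = 2 * ((1/4) * (if i.val < r then 1 else 8 * 4 ^ d)) := fun i => by simp only [hw]; ring
      simp only [this, Finset.prod_mul_distrib]
      simp
    rw [e2]
    have h8 : (8:ℝ) * 4 ^ d ≤ ∏ i : Fin d, (if i.val < r then (1:ℝ) else 8 * 4 ^ d) := by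
      have h1 : ∀ i ∈ Finset.univ, (1:ℝ) ≤ (fun i : Fin d => if i.val < r then (1:ℝ) else 8 * 4 ^ d) i := by
        intro i _
        dsimp only
        split_ifs
        · rfl
        · have : (1:ℝ) ≤ 4 ^ d := one_le_pow₀ (by norm_num)
          linarith
      have h2 : (1:ℝ) ≤ ∏ i ∈ Finset.univ.erase (⟨r, hr⟩ : Fin d), (if i.val < r then (1:ℝ) else 8 * 4 ^ d) :=
        Finset.prod_induction _ (fun x => (1:ℝ) ≤ x) (fun a b ha hb => one_le_mul_of_one_le_of_one_le ha hb) le_rfl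
          (fun i _ => h1 i (Finset.mem_univ _))
      rw [← Finset.mul_prod_erase Finset.univ _ (Finset.mem_univ (⟨r, hr⟩ : Fin d))]
      simp only [lt_irrefl, if_false]
      exact le_mul_of_one_le_right (by positivity) h2
    have h9 : (1/4:ℝ)^d * (8 * 4 ^ d) = 8 := by
      rw [mul_left_comm, ← mul_pow]; norm_num
    have : (8:ℝ) ≤ (1/4)^d * ∏ i : Fin d, (if i.val < r then (1:ℝ) else 8 * 4 ^ d) := by
      exact h9.symm.le.trans (mul_le_mul_of_nonneg_left h8 (by positivity))
    have h2 : (0:ℝ) < 2 ^ d := by positivity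
    nlinarith
  have hBm : MeasurableSet B := MeasurableSet.univ_pi fun i => measurableSet_Icc
  have hconv : Convex ℝ ((fun x : Fin d → ℝ => g.1.mulVec x) ⁻¹' B) := by
    have : Convex ℝ B := convex_pi fun i _ => convex_Icc _ _
    exact this.linear_preimage (Matrix.mulVecLin g.1)
  obtain ⟨u, hu0, hu⟩ := minkowski d ((fun x : Fin d → ℝ => g.1.mulVec x) ⁻¹' B) (by
      intro x hx i hi
      have := hx i hi
      simp only [Matrix.mulVec_neg, Pi.neg_apply, Set.mem_Icc] at this ⊢
      constructor <;> linarith [this.1, this.2]) hconv (by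
      rw [(vol_mulVec g).measure_preimage hBm.nullMeasurableSet]; exact hvol)
  have hu' : ∀ i, |g.1.mulVec (vc u) i| ≤ w i := fun i => abs_le.2 (hu i (Set.mem_univ _))
  have hns : vc u ∉ Submodule.span ℝ (Set.range (zc z)) := by
    refine not_span hr hz hv hu0 fun i => ?_
    have := hu' (Fin.castLE hr.le i)
    simpa [hw] using this
  obtain ⟨a, b, c, ha, hc, hs, hub⟩ := gen hz hns
  refine ⟨b, hs, ?_⟩
  have ha' : (1:ℝ) ≤ a := by exact_mod_cast ha
  have hvb : ∀ i j, |act g (zc z) i j| ≤ 2 := by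
    intro i j
    have h1 := hv i j
    have h2 : |(Pi.single (Fin.castLE hr.le i) 1 : Fin d → ℝ) j| ≤ 1 := by
      rw [Pi.single_apply]; split_ifs <;> simp
    have h3 : 1 / (2 * (d:ℝ)) ≤ 1 := by
      rw [div_le_one (by linarith)]; linarith
    have := abs_sub_abs_le_abs_sub (act g (zc z) i j) ((Pi.single (Fin.castLE hr.le i) 1 : Fin d → ℝ) j)
    linarith
  have h4 : (1:ℝ) ≤ 4 ^ d := one_le_pow₀ (by norm_num)
  intro i j
  induction i using Fin.lastCases with
  | last => 
    have e : act g (zc (Fin.snoc z b : Fin (r+1) → Fin d → ℤ)) (Fin.last r) = g.1.mulVec (vc b) := by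
      simp only [act]; congr 1
      funext k; simp [zc, vc]
    rw [e]
    have h1 : g.1.mulVec (vc u) j = a * g.1.mulVec (vc b) j + ∑ k, (c k : ℝ) * act g (zc z) k j := by
      rw [hub, vc_add, vc_smul, vc_comb, Matrix.mulVec_add, Matrix.mulVec_smul, Matrix.mulVec_sum]
      simp only [Matrix.mulVec_smul, Pi.add_apply, Pi.smul_apply, Finset.sum_apply, smul_eq_mul]
      simp [act]
    have h2 : |∑ k, (c k : ℝ) * act g (zc z) k j| ≤ a * (2 * d) := by
      calc _ ≤ ∑ k : Fin r, |(c k : ℝ) * act g (zc z) k j| := Finset.abs_sum_le_sum_abs _ _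
        _ ≤ ∑ k : Fin r, (a:ℝ) * 2 := by
          refine Finset.sum_le_sum fun k _ => ?_
          rw [abs_mul, Nat.abs_cast]
          have : (c k : ℝ) ≤ a := by exact_mod_cast (hc k).le
          exact mul_le_mul this (hvb k j) (abs_nonneg _) (by positivity)
        _ = a * (2 * r) := by simp; ring
        _ ≤ _ := by
          have : (r:ℝ) ≤ d := by exact_mod_cast hr.le
          gcongr
    have h3 : |g.1.mulVec (vc u) j| ≤ 2 * 4 ^ d := by
      refine (hu' j).trans ?_
      simp only [hw]
      split_ifs <;> linarith
    have h5 : (a:ℝ) * |g.1.mulVec (vc b) j| ≤ a * (2 * 4 ^ d + 2 * d) := by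
      have : (a:ℝ) * |g.1.mulVec (vc b) j| = |g.1.mulVec (vc u) j - ∑ k, (c k : ℝ) * act g (zc z) k j| := by
        rw [h1, add_sub_cancel_right, abs_mul, Nat.abs_cast]
      rw [this]
      refine (abs_sub _ _).trans ?_
      nlinarith
    exact le_of_mul_le_mul_left h5 (by linarith)
  | cast i => 
    have e : act g (zc (Fin.snoc z b : Fin (r+1) → Fin d → ℤ)) (Fin.castSucc i) = act g (zc z) i := by
      simp only [act]; congr 1
      funext k; simp [zc]
    rw [e]
    have := hvb i j
    linarith

lemma box_finite_of_prop1 {d r : ℕ} {μ : Measure (Xspace d)} {Z : Set (Fin r → Fin d → ℤ)} (h : Prop1 μ Z) (ρ : ℝ) :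
    nu μ Z (Box d (Fin r) ρ) ≠ ⊤ := by
  obtain ⟨c, hc, h⟩ := h
  rw [h, Measure.smul_apply, smul_eq_mul]
  refine ENNReal.mul_ne_top hc ?_
  have : Box d (Fin r) ρ ⊆ Set.Icc (fun _ _ => -ρ) (fun _ _ => ρ) := by
    intro w hw
    exact ⟨fun i j => (abs_le.1 (hw i j)).1, fun i j => (abs_le.1 (hw i j)).2⟩
  exact ((Metric.isBounded_Icc _ _).subset this).measure_lt_top.ne

lemma sat_aux {d : ℕ} {μ : Measure (Xspace d)} [IsProbabilityMeasure μ] (hμ : InvM μ) :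
    ∀ s r, r + s = d → (∀ ρ, nu μ (Sat d r) (Box d (Fin r) ρ) ≠ ⊤) ∧ (r < d → Prop1 μ (Sat d r)) := by
  intro s
  induction s with
  | zero => 
    intro r hr
    obtain rfl : r = d := by omega
    exact ⟨base_finite r μ, fun h => absurd h (lt_irrefl _)⟩
  | succ s ih =>
    intro r hr
    have hrd : r < d := by omega
    have key : Prop1 μ (Sat d r) := by
      refine prop1_of_fin hrd hμ (ginv_Sat d r) (fun z hz => hz.1) (isOpen_Unb d r hrd) (mem_Unb d r hrd) ?_
      refine ne_top_of_le_ne_top ((ih (r+1) (by omega)).1 (2 * 4 ^ d + 2 * d)) ?_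
      refine nu_le_set μ (ginv_Sat d r) (ginv_Sat d (r+1)) (isOpen_Unb d r hrd).measurableSet (measurableSet_Box _ _ _)
        (fun y => Fin.init y) ?_
      intro g z hz hv
      obtain ⟨b, h1, h2⟩ := descend hrd hz hv
      exact ⟨_, h1, h2, by simp⟩
    exact ⟨box_finite_of_prop1 key, fun _ => key⟩

lemma prop1_Sat {d r : ℕ} (hr : r < d) {μ : Measure (Xspace d)} [IsProbabilityMeasure μ] (hμ : InvM μ) :
    Prop1 μ (Sat d r) := (sat_aux hμ (d - r) r (by omega)).2 hr

def TT (d r i : ℕ) (h : i ≤ r) : Set (Fin r → Fin d → ℤ) :=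
  {z | LinearIndependent ℝ (zc z) ∧ (fun j : Fin i => z (Fin.castLE h j)) ∈ Sat d i}

lemma ginv_TT (d r i : ℕ) (h : i ≤ r) : GInv (TT d r i h) := by
  intro γ z hz
  exact ⟨ginv_Ind d (Fin r) γ z hz.1, ginv_Sat d i γ _ hz.2⟩

def rowN {i r : ℕ} (hi : i < r) (α : Σ a : ℕ, (Fin i → Fin (a+1))) : Fin r → ℕ :=
  fun j => if h : j.1 < i then (α.2 ⟨j.1, h⟩).1 else if j.1 = i then α.1 + 1 else 0

lemma sum_rowN {d i r : ℕ} (hi : i < r) (α : Σ a : ℕ, (Fin i → Fin (a+1))) (y : Fin r → Fin d → ℤ) :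
    ∑ j, (rowN hi α j : ℤ) • y j = ((α.1 + 1 : ℕ) : ℤ) • y ⟨i, hi⟩ + ∑ j : Fin i, ((α.2 j).1 : ℤ) • y (Fin.castLE hi.le j) := by
  rw [← Fintype.sum_of_injective (Fin.castLE (Nat.succ_le_of_lt hi)) (Fin.castLE_injective _)
    (fun j => (rowN hi α (Fin.castLE (Nat.succ_le_of_lt hi) j) : ℤ) • y (Fin.castLE (Nat.succ_le_of_lt hi) j)) _ ?_ (fun j => rfl)]
  · rw [Fin.sum_univ_castSucc, add_comm]
    congr 1
    · simp [rowN]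
      rfl
    · refine Finset.sum_congr rfl fun j _ => ?_
      simp [rowN]
  · intro j hj
    have : ¬ j.1 < i + 1 := by
      intro h; apply hj; exact ⟨⟨j.1, h⟩, rfl⟩
    have h1 : ¬ j.1 < i := by omega
    have h2 : ¬ j.1 = i := by omega
    simp [rowN, h1, h2]

lemma li_of_TA {d : ℕ} {ι : Type*} [Fintype ι] {A : Matrix ι ι ℝ} {w : ι → Fin d → ℝ}
    (h : LinearIndependent ℝ (TA A w)) : LinearIndependent ℝ w := by
  rw [linearIndependent_iff_card_le_finrank_span] at h ⊢
  refine h.trans ?_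
  apply Submodule.finrank_mono
  rw [Submodule.span_le]
  rintro _ ⟨i, rfl⟩
  exact Submodule.sum_mem _ fun j _ => Submodule.smul_mem _ _ (Submodule.subset_span ⟨j, rfl⟩)

lemma TT_step {d r i : ℕ} (hi : i < r) {z : Fin r → Fin d → ℤ} (hz : z ∈ TT d r i hi.le) :
    ∃ α : Σ a : ℕ, (Fin i → Fin (a+1)), ∃ y ∈ TT d r (i+1) hi, 
      z = Function.update y ⟨i, hi⟩ (∑ j, (rowN hi α j : ℤ) • y j) ∧
      zc z = TA ((1 : Matrix (Fin r) (Fin r) ℝ).updateRow ⟨i, hi⟩ fun j => (rowN hi α j : ℝ)) (zc y) := by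
  have hu : vc (z ⟨i, hi⟩) ∉ Submodule.span ℝ (Set.range (zc fun j : Fin i => z (Fin.castLE hi.le j))) := by
    have := (linearIndependent_iff_notMem_span.1 hz.1) ⟨i, hi⟩
    refine fun hmem => this (Submodule.span_mono ?_ hmem)
    rintro _ ⟨j, rfl⟩
    refine ⟨Fin.castLE hi.le j, ?_, rfl⟩
    simp only [Set.mem_sdiff, Set.mem_univ, true_and, Set.mem_singleton_iff]
    intro h
    have := congrArg Fin.val h
    simp at this
    exact absurd this (by have := j.2; omega)
  obtain ⟨a, b, c, ha, hc, hs, hub⟩ := gen hz.2 hu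
  obtain ⟨a, rfl⟩ : ∃ a', a = a' + 1 := ⟨a - 1, by omega⟩
  set α : Σ a : ℕ, (Fin i → Fin (a+1)) := ⟨a, fun j => ⟨c j, hc j⟩⟩ with hα
  set y := Function.update z ⟨i, hi⟩ b with hy
  have hyj : ∀ j : Fin i, y (Fin.castLE hi.le j) = z (Fin.castLE hi.le j) := by
    intro j
    rw [hy, Function.update_of_ne]
    intro h
    have := congrArg Fin.val h
    simp at this
    exact absurd this (by have := j.2; omega)
  have hzy : z = Function.update y ⟨i, hi⟩ (∑ j, (rowN hi α j : ℤ) • y j) := by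
    rw [sum_rowN]
    simp only [hyj]
    have : y ⟨i, hi⟩ = b := by simp [hy]
    rw [this]
    rw [← hub, hy]
    simp
  have hzc : zc z = TA ((1 : Matrix (Fin r) (Fin r) ℝ).updateRow ⟨i, hi⟩ fun j => (rowN hi α j : ℝ)) (zc y) := by
    funext k
    have e : zc z k = vc (z k) := rfl
    rw [e, hzy]
    by_cases hk : k = ⟨i, hi⟩
    · subst hk
      rw [Function.update_self, vc_comb]
      simp [TA]
    · rw [Function.update_of_ne hk]
      simp only [TA, Matrix.updateRow_ne hk, Matrix.one_apply, ite_smul, one_smul, zero_smul]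
      simp; rfl
  refine ⟨α, y, ⟨?_, ?_⟩, hzy, hzc⟩
  · exact li_of_TA (hzc ▸ hz.1)
  · have : (fun j : Fin (i+1) => y (Fin.castLE hi j)) = Fin.snoc (fun j : Fin i => z (Fin.castLE hi.le j)) b := by
      funext j
      induction j using Fin.lastCases with
      | last => 
        rw [Fin.snoc_last]
        have : Fin.castLE hi (Fin.last i) = ⟨i, hi⟩ := rfl
        rw [this]; simp [hy]
      | cast j => 
        rw [Fin.snoc_castSucc, ← hyj]; rfl
    rw [this]; exact hs

lemma det_rowN {i r : ℕ} (hi : i < r) (α : Σ a : ℕ, (Fin i → Fin (a+1))) :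
    ((1 : Matrix (Fin r) (Fin r) ℝ).updateRow ⟨i, hi⟩ fun j => (rowN hi α j : ℝ)).det = (α.1 + 1 : ℕ) := by
  have := Matrix.det_updateRow_sum (1 : Matrix (Fin r) (Fin r) ℝ) ⟨i, hi⟩ fun j => (rowN hi α j : ℝ)
  have e : (∑ k, (fun j => (rowN hi α j : ℝ)) k • (1 : Matrix (Fin r) (Fin r) ℝ) k) = fun j => (rowN hi α j : ℝ) := by
    funext j
    simp [Finset.sum_apply, Matrix.one_apply]
  rw [e] at this
  rw [this]
  simp [rowN]

lemma sum_const_ne_top {d i : ℕ} (h : i + 2 ≤ d) :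
    ∑' α : (Σ a : ℕ, (Fin i → Fin (a+1))), ENNReal.ofReal (|((α.1 + 1 : ℕ) : ℝ)|⁻¹ ^ d) ≠ ⊤ := by
  rw [ENNReal.tsum_sigma' (f := fun α : (Σ a : ℕ, (Fin i → Fin (a+1))) => ENNReal.ofReal (|((α.1 + 1 : ℕ) : ℝ)|⁻¹ ^ d))]
  simp only [tsum_fintype, Finset.sum_const, Finset.card_univ, Fintype.card_fun, Fintype.card_fin, nsmul_eq_mul]
  have hle : ∀ a : ℕ, (((a+1)^i : ℕ) : ENNReal) * ENNReal.ofReal (|((a + 1 : ℕ) : ℝ)|⁻¹ ^ d) ≤ ENNReal.ofReal (1 / ((a+1 : ℕ):ℝ)^2) := by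
    intro a
    rw [← ENNReal.ofReal_natCast, ← ENNReal.ofReal_mul (by positivity)]
    apply ENNReal.ofReal_le_ofReal
    rw [Nat.abs_cast, Nat.cast_pow]
    obtain ⟨e, rfl⟩ : ∃ e, d = i + 2 + e := ⟨d - (i+2), by omega⟩
    have h1 : (1:ℝ) ≤ ((a+1:ℕ):ℝ) := by exact_mod_cast (by omega : 1 ≤ a + 1)
    set x : ℝ := ((a+1:ℕ):ℝ)
    have : x ^ i * x⁻¹ ^ (i + 2 + e) = (1 / x ^ 2) * (x⁻¹) ^ e := by
      rw [pow_add, pow_add]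
      have : x ≠ 0 := by positivity
      have h3 : x ^ i * x⁻¹ ^ i = 1 := by rw [← mul_pow, mul_inv_cancel₀ this, one_pow]
      rw [← mul_assoc, ← mul_assoc, h3, one_mul, inv_pow, one_div]
    rw [this]
    exact mul_le_of_le_one_right (by positivity) (pow_le_one₀ (by positivity) (inv_le_one_of_one_le₀ h1))
  refine ne_top_of_le_ne_top ?_ (ENNReal.tsum_le_tsum hle)
  have hs : Summable fun a : ℕ => 1 / ((a+1 : ℕ):ℝ)^2 :=
    (summable_nat_add_iff 1).2 (Real.summable_one_div_nat_pow.2 (by norm_num : 1 < 2))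
  exact hs.tsum_ofReal_ne_top

lemma TT_bound {d r : ℕ} (hr : r < d) {μ : Measure (Xspace d)} [IsProbabilityMeasure μ] (hμ : InvM μ) :
    ∀ s i, ∀ hi : i ≤ r, i + s = r → ∃ C : ENNReal, C ≠ ⊤ ∧ ∀ F : (Fin r → Fin d → ℝ) → ENNReal, Measurable F → 
      ∫⁻ y, F y ∂(nu μ (TT d r i hi)) ≤ C * ∫⁻ y, F y := by
  intro s
  induction s with
  | zero => 
    intro i hi h
    obtain rfl : i = r := by omega
    obtain ⟨c, hc, h⟩ := prop1_Sat hr hμ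
    refine ⟨c, hc, fun F hF => ?_⟩
    have : TT d i i hi = Sat d i := by
      ext z; simp only [TT, Fin.castLE_rfl, id]
      exact ⟨fun h => h.2, fun h => ⟨h.1, h⟩⟩
    rw [this, h, lintegral_smul_measure, smul_eq_mul]
  | succ s ih =>
    intro i hi h
    have hir : i < r := by omega
    obtain ⟨C, hC, hb⟩ := ih (i+1) hir (by omega)
    refine ⟨(∑' α : (Σ a : ℕ, (Fin i → Fin (a+1))), ENNReal.ofReal (|((α.1 + 1 : ℕ) : ℝ)|⁻¹ ^ d)) * C,
      ENNReal.mul_ne_top (sum_const_ne_top (by omega)) hC, fun F hF => ?_⟩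
    set M : (Σ a : ℕ, (Fin i → Fin (a+1))) → Matrix (Fin r) (Fin r) ℝ := fun α => 
      (1 : Matrix (Fin r) (Fin r) ℝ).updateRow ⟨i, hir⟩ fun j => (rowN hir α j : ℝ) with hM
    have hMm : ∀ α, Measurable fun w : Fin r → Fin d → ℝ => F (TA (M α) w) := fun α => hF.comp (continuous_TA _).measurable
    refine (nu_le' μ (ginv_TT d r i hi) (ginv_TT d r (i+1) hir) hF (G := fun α w => F (TA (M α) w)) hMm
      (fun α y => Function.update y ⟨i, hir⟩ (∑ j, (rowN hir α j : ℤ) • y j)) ?_).trans ?_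
    · intro g z hz _
      obtain ⟨α, y, hy, h1, h2⟩ := TT_step hir hz
      refine ⟨α, y, hy, ?_, h1⟩
      rw [h2, TA_act]
    · rw [mul_assoc, ← ENNReal.tsum_mul_right]
      refine ENNReal.tsum_le_tsum fun α => ?_
      refine (hb _ (hMm α)).trans ?_
      rw [lintegral_TA (by rw [hM, det_rowN]; positivity) hF, hM, det_rowN]
      rw [mul_left_comm]

lemma prop1_Ind {d r : ℕ} (hr : r < d) {μ : Measure (Xspace d)} [IsProbabilityMeasure μ] (hμ : InvM μ)
    {Z : Set (Fin r → Fin d → ℤ)} (hZ : GInv Z) (hI : Z ⊆ Ind d (Fin r)) :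
    Prop1 μ Z := by
  refine prop1_of_fin hr hμ hZ hI (isOpen_Unb d r hr) (mem_Unb d r hr) ?_
  obtain ⟨C, hC, hb⟩ := TT_bound hr hμ r 0 (Nat.zero_le _) (by omega)
  have hTT : TT d r 0 (Nat.zero_le _) = Ind d (Fin r) := by
    ext z
    refine ⟨fun h => h.1, fun h => ⟨h, ?_, ?_⟩⟩
    · exact linearIndependent_empty_type
    · intro x hx
      refine ⟨fun _ => 0, ?_⟩
      rw [Set.range_eq_empty, Submodule.span_empty, Submodule.mem_bot] at hx
      simp only [Finset.univ_eq_empty, Finset.sum_empty]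
      apply vc_inj; rw [hx]; funext j; simp [vc]
  rw [hTT] at hb
  have hm := (isOpen_Unb d r hr).measurableSet
  refine ne_top_of_le_ne_top ?_ (nu_mono μ hZ (ginv_Ind d _) hI _)
  rw [← lintegral_indicator_one hm]
  refine ne_top_of_le_ne_top ?_ (hb _ (measurable_one.indicator hm))
  rw [lintegral_indicator_one hm]
  refine ENNReal.mul_ne_top hC ?_
  have : Unb d r hr ⊆ Set.Icc (fun _ _ => -2) (fun _ _ => 2) := by
    intro v hv
    have hd : (1:ℝ) ≤ d := by exact_mod_cast (by omega : 1 ≤ d)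
    have hvb : ∀ i j, |v i j| ≤ 2 := by
      intro i j
      have h1 := hv i j
      have h2 : |(Pi.single (Fin.castLE hr.le i) 1 : Fin d → ℝ) j| ≤ 1 := by
        rw [Pi.single_apply]; split_ifs <;> simp
      have h3 : 1 / (2 * (d:ℝ)) ≤ 1 := by
        rw [div_le_one (by linarith)]; linarith
      have := abs_sub_abs_le_abs_sub (v i j) ((Pi.single (Fin.castLE hr.le i) 1 : Fin d → ℝ) j)
      linarith
    exact ⟨fun i j => (abs_le.1 (hvb i j)).1, fun i j => (abs_le.1 (hvb i j)).2⟩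
  exact ((Metric.isBounded_Icc _ _).subset this).measure_lt_top.ne

lemma prop1_gen {d : ℕ} {ι : Type*} [Fintype ι] (hr : Fintype.card ι < d) {μ : Measure (Xspace d)} [IsProbabilityMeasure μ] (hμ : InvM μ)
    {Z : Set (ι → Fin d → ℤ)} (hZ : GInv Z) (hI : Z ⊆ Ind d ι) :
    Prop1 μ Z := by
  set e := Fintype.equivFin ι
  set Y : Set (Fin (Fintype.card ι) → Fin d → ℤ) := {y | (fun i => y (e i)) ∈ Z} with hY
  have hYG : GInv Y := by
    intro γ y hy
    exact hZ γ _ hy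
  have hYI : Y ⊆ Ind d _ := by
    intro y hy
    have := hI hy
    exact (linearIndependent_equiv e (f := zc y)).1 this
  obtain ⟨c, hc, h⟩ := prop1_Ind hr hμ hYG hYI
  refine ⟨c, hc, prop1_ri e μ hYG hZ (fun z => ?_) h⟩
  rfl

lemma gram_det_ne {r d : ℕ} (W : Matrix (Fin r) (Fin d) ℝ) : 
    (W * Wᵀ).det ≠ 0 ↔ LinearIndependent ℝ W.row := by
  rw [← isUnit_iff_ne_zero, ← Matrix.isUnit_iff_isUnit_det, ← Matrix.linearIndependent_rows_iff_isUnit,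
    linearIndependent_iff_card_eq_finrank_span, linearIndependent_iff_card_eq_finrank_span, 
    Set.finrank, Set.finrank, ← Matrix.rank_eq_finrank_span_row, ← Matrix.rank_eq_finrank_span_row,
    Matrix.rank_self_mul_transpose]

def gramZ {d r : ℕ} {κ : Type*} (z : κ → Fin d → ℤ) (σ : Fin r → κ) : Matrix (Fin r) (Fin r) ℤ :=
  Matrix.of fun a b => z (σ a) ⬝ᵥ z (σ b)

lemma gramZ_real {d r : ℕ} {κ : Type*} (z : κ → Fin d → ℤ) (σ : Fin r → κ) :
    ((gramZ z σ).det : ℝ) = ((Matrix.of (zc (z ∘ σ))) * (Matrix.of (zc (z ∘ σ)))ᵀ).det := by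
  rw [Int.cast_det]
  congr 1
  ext a b
  simp [gramZ, Matrix.mul_apply, dotProduct, zc]

lemma exists_sigma {d : ℕ} {κ : Type*} [Fintype κ] (z : κ → Fin d → ℤ) :
    ∃ (r : ℕ) (σ : Fin r → κ) (q : κ → Fin r → ℚ), LinearIndependent ℝ (zc (z ∘ σ)) ∧ (∀ i a, |q i a| ≤ 1) ∧
      ∀ i, zc z i = ∑ a, (q i a : ℝ) • zc z (σ a) := by
  classical
  have hex := Submodule.exists_fun_fin_finrank_span_eq ℝ (Set.range (zc z))
  generalize hr : Module.finrank ℝ (Submodule.span ℝ (Set.range (zc z))) = r at hex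
  obtain ⟨f, hf, hspan, hli⟩ := hex
  choose σ0 hσ0 using hf
  have hne : Nonempty (Fin r → κ) := ⟨σ0⟩
  obtain ⟨σ, hσ⟩ := Finite.exists_max fun σ : Fin r → κ => |(gramZ z σ).det|
  have hli0 : LinearIndependent ℝ (zc (z ∘ σ0)) := by
    have : zc (z ∘ σ0) = f := funext hσ0
    rw [this]; exact hli
  have hdet0 : (gramZ z σ0).det ≠ 0 := by
    have := (gram_det_ne (Matrix.of (zc (z ∘ σ0)))).2 hli0
    rw [← gramZ_real] at this
    exact_mod_cast this
  have hdet : (gramZ z σ).det ≠ 0 := by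
    have h1 := hσ σ0
    have h2 := abs_pos.2 hdet0
    exact abs_pos.1 (h2.trans_le h1)
  have hliσ : LinearIndependent ℝ (zc (z ∘ σ)) := by
    apply (gram_det_ne (Matrix.of (zc (z ∘ σ)))).1
    rw [← gramZ_real]
    exact_mod_cast hdet
  have hsp : Submodule.span ℝ (Set.range (zc (z ∘ σ))) = Submodule.span ℝ (Set.range (zc z)) := by
    apply Submodule.eq_of_le_of_finrank_eq
    · apply Submodule.span_mono
      rintro _ ⟨a, rfl⟩
      exact ⟨σ a, rfl⟩
    · rw [finrank_span_eq_card hliσ, Fintype.card_fin, hr]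
  have hq : ∀ i, ∃ q : Fin r → ℝ, ∑ a, q a • zc z (σ a) = zc z i := by
    intro i
    have : zc z i ∈ Submodule.span ℝ (Set.range (zc (z ∘ σ))) := by
      rw [hsp]; exact Submodule.subset_span ⟨i, rfl⟩
    exact (Submodule.mem_span_range_iff_exists_fun ℝ).1 this
  choose q hq using hq
  set W : Matrix (Fin r) (Fin d) ℝ := Matrix.of (zc (z ∘ σ)) with hW
  have hWdet : (W * Wᵀ).det = ((gramZ z σ).det : ℝ) := (gramZ_real z σ).symm
  -- bound
  have hle : ∀ i a, |q i a| ≤ 1 := by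
    intro i a
    have h1 := hσ (Function.update σ a i)
    have h2 : ((gramZ z (Function.update σ a i)).det : ℝ) = (q i a)^2 * (gramZ z σ).det := by
      rw [gramZ_real, ← hWdet]
      set M : Matrix (Fin r) (Fin r) ℝ := (1 : Matrix (Fin r) (Fin r) ℝ).updateRow a (q i) with hM
      have hMW : Matrix.of (zc (z ∘ (Function.update σ a i))) = M * W := by
        ext b j
        rw [Matrix.mul_apply]
        by_cases hb : b = a
        · subst hb
          have := congrFun (hq i) j
          simp only [Finset.sum_apply, Pi.smul_apply, smul_eq_mul] at this
          simp only [hM, Matrix.updateRow_self, Matrix.of_apply, hW]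
          have e : zc (z ∘ Function.update σ b i) b j = zc z i j := by simp [zc]
          rw [e, ← this]; rfl
        · simp only [hM, Matrix.updateRow_ne hb, Matrix.of_apply, Matrix.one_apply]
          simp [zc, Function.update_of_ne hb, hW]
      have hMdet : M.det = q i a := by
        have := Matrix.det_updateRow_sum (1 : Matrix (Fin r) (Fin r) ℝ) a (q i)
        have e : (∑ k, (q i) k • (1 : Matrix (Fin r) (Fin r) ℝ) k) = q i := by
          funext j
          simp [Finset.sum_apply, Matrix.one_apply]
        rw [e] at this
        rw [hM, this]; simp
      rw [hMW, Matrix.transpose_mul, ← Matrix.mul_assoc, Matrix.mul_assoc M, Matrix.det_mul, Matrix.det_mul, Matrix.det_transpose, hMdet]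
      ring
    have h3 : |((gramZ z (Function.update σ a i)).det : ℝ)| ≤ |((gramZ z σ).det : ℝ)| := by exact_mod_cast h1
    have h4 : 0 < |((gramZ z σ).det : ℝ)| := by
      rw [abs_pos]; exact_mod_cast hdet
    rw [h2, abs_mul] at h3
    have h5 : |(q i a)^2| ≤ 1 := by
      by_contra hcon
      push Not at hcon
      nlinarith
    rw [abs_pow] at h5
    exact (sq_le_one_iff₀ (abs_nonneg _)).1 h5
  -- rationality
  have hrat : ∀ i a, ∃ p : ℚ, (p : ℝ) = q i a := by
    intro i a
    set G := gramZ z σ with hG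
    set GR : Matrix (Fin r) (Fin r) ℝ := G.map (fun x : ℤ => (x:ℝ)) with hGR
    have h1 := Matrix.det_updateRow_sum GR a (q i)
    have e : (∑ k, (q i) k • GR k) = fun c => ((z i ⬝ᵥ z (σ c) : ℤ) : ℝ) := by
      funext c
      have : ((z i ⬝ᵥ z (σ c) : ℤ) : ℝ) = zc z i ⬝ᵥ zc z (σ c) := by simp [dotProduct, zc]
      rw [this, ← hq i, sum_dotProduct]
      simp only [Finset.sum_apply, Pi.smul_apply, smul_eq_mul, smul_dotProduct]
      refine Finset.sum_congr rfl fun k _ => ?_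
      congr 1
      simp [hGR, hG, gramZ, zc, dotProduct]
    have e2 : GR.updateRow a (fun c => ((z i ⬝ᵥ z (σ c) : ℤ) : ℝ)) = (G.updateRow a (fun c => z i ⬝ᵥ z (σ c))).map (fun x : ℤ => (x:ℝ)) := by
      ext b c
      rw [Matrix.map_apply, Matrix.updateRow_apply, Matrix.updateRow_apply]
      split_ifs <;> simp [hGR]
    rw [e, e2] at h1
    have e3 : ∀ H : Matrix (Fin r) (Fin r) ℤ, (H.map (fun x : ℤ => (x:ℝ))).det = (H.det : ℝ) := fun H => (Int.cast_det (R := ℝ) H).symm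
    rw [hGR, e3, e3] at h1
    refine ⟨((G.updateRow a (fun c => z i ⬝ᵥ z (σ c))).det : ℚ) / (G.det : ℚ), ?_⟩
    rw [Rat.cast_div, Rat.cast_intCast, Rat.cast_intCast, h1, smul_eq_mul, mul_div_assoc, div_self (by exact_mod_cast hdet), mul_one]
  choose p hp using hrat
  refine ⟨r, σ, p, hliσ, fun i a => ?_, fun i => ?_⟩
  · have := hle i a
    rw [← hp] at this
    exact_mod_cast this
  · simp only [hp]; exact (hq i).symm

lemma exists_S {d : ℕ} {κ : Type*} [Fintype κ] [DecidableEq κ] (z : κ → Fin d → ℤ) :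
    ∃ (S : Finset κ) (q : κ → S → ℚ), LinearIndependent ℝ (fun s : S => zc z s) ∧ (∀ i a, |q i a| ≤ 1) ∧
      (∀ s t : S, q s t = if s = t then 1 else 0) ∧
      ∀ i, zc z i = ∑ a : S, (q i a : ℝ) • zc z a := by
  classical
  obtain ⟨r, σ, q, hli, hq, hz⟩ := exists_sigma z
  have hinj : Function.Injective σ := by
    intro a b hab
    apply hli.injective
    funext j
    simp [zc, hab]
  set S : Finset κ := Finset.univ.image σ with hS
  let e : Fin r ≃ S := Equiv.ofBijective (fun a => ⟨σ a, Finset.mem_image_of_mem _ (Finset.mem_univ _)⟩) ⟨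
    fun a b h => hinj (congrArg Subtype.val h), fun s => by
      obtain ⟨a, -, ha⟩ := Finset.mem_image.1 s.2
      exact ⟨a, Subtype.ext ha⟩⟩
  have he : ∀ s : S, σ (e.symm s) = s := fun s => by
    have := e.apply_symm_apply s
    exact congrArg Subtype.val this
  have hliS : LinearIndependent ℝ (fun s : S => zc z s) := by
    rw [← linearIndependent_equiv e]
    exact hli
  have hsum : ∀ i, zc z i = ∑ a : S, (q i (e.symm a) : ℝ) • zc z a := by
    intro i
    rw [hz i, ← e.symm.sum_comp]
    simp only [he]
  refine ⟨S, fun i s => q i (e.symm s), hliS, fun i a => hq _ _, fun s t => ?_, hsum⟩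
  have h1 := hsum s
  have h2 : zc z s = ∑ a : S, (if s = a then (1:ℝ) else 0) • zc z a := by
    simp
  rw [h2] at h1
  have := (Fintype.linearIndependent_iff.1 hliS) (fun a => (if s = a then (1:ℝ) else 0) - (q s (e.symm a) : ℝ)) (by
    simp only [sub_smul, Finset.sum_sub_distrib]
    rw [h1, sub_self]) t
  have h3 : (q s (e.symm t) : ℝ) = if s = t then 1 else 0 := by linarith
  split_ifs at h3 ⊢ <;> exact_mod_cast h3

def Lq {σ κ : Type*} [Fintype σ] (q : κ → σ → ℚ) : Submodule ℤ (σ → ℤ) where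
  carrier := {x | ∀ i, ∃ n : ℤ, ∑ s, q i s * x s = n}
  add_mem' := by
    intro x y hx hy i
    obtain ⟨n, hn⟩ := hx i
    obtain ⟨m, hm⟩ := hy i
    refine ⟨n + m, ?_⟩
    push_cast
    rw [← hn, ← hm, ← Finset.sum_add_distrib]
    refine Finset.sum_congr rfl fun s _ => ?_
    simp; ring
  zero_mem' := fun i => ⟨0, by simp⟩
  smul_mem' := by
    intro c x hx i
    obtain ⟨n, hn⟩ := hx i
    refine ⟨c * n, ?_⟩
    push_cast
    rw [← hn, Finset.mul_sum]
    refine Finset.sum_congr rfl fun s _ => ?_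
    simp; ring

lemma mem_Lq {σ κ : Type*} [Fintype σ] (q : κ → σ → ℚ) (x : σ → ℤ) : 
  x ∈ Lq q ↔ ∀ i, ∃ n : ℤ, ∑ s, q i s * x s = n := Iff.rfl

lemma exists_A {σ κ : Type*} [Fintype σ] [DecidableEq σ] [Fintype κ] (q : κ → σ → ℚ) : 
    ∃ A : Matrix σ σ ℤ, A.det ≠ 0 ∧ 
      (∀ x : σ → ℤ, (∀ i, ∃ n : ℤ, ∑ s, q i s * x s = n) → ∃ c, x = A.mulVec c) ∧ 
      (∀ i s, ∃ n : ℤ, (A.det : ℚ) * q i s = n) := by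
  obtain ⟨D, hD0, hD⟩ : ∃ D : ℤ, D ≠ 0 ∧ ∀ i s, ∃ n : ℤ, (D:ℚ) * q i s = n := by
    refine ⟨∏ i, ∏ s, ((q i s).den : ℤ), ?_, fun i s => ?_⟩
    · rw [Finset.prod_ne_zero_iff]; intro i _
      rw [Finset.prod_ne_zero_iff]; intro s _
      exact_mod_cast (q i s).den_nz
    · have h1 : ((q i s).den : ℤ) ∣ ∏ i, ∏ s, ((q i s).den : ℤ) :=
        (Finset.dvd_prod_of_mem (fun s => ((q i s).den : ℤ)) (Finset.mem_univ s)).trans 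
          (Finset.dvd_prod_of_mem (fun i => ∏ s, ((q i s).den : ℤ)) (Finset.mem_univ i))
      obtain ⟨m, hm⟩ := h1
      refine ⟨m * (q i s).num, ?_⟩
      rw [hm]; push_cast
      have := Rat.mul_den_eq_num (q i s)
      rw [← this]; ring
  have hDm : ∀ x : σ → ℤ, D • x ∈ Lq q := by
    intro x i
    choose n hn using hD i
    refine ⟨∑ s, n s * x s, ?_⟩
    push_cast
    refine Finset.sum_congr rfl fun s _ => ?_
    rw [← hn]; simp; ring
  let f : (σ → ℤ) →ₗ[ℤ] Lq q := LinearMap.codRestrict (Lq q) (D • LinearMap.id) (fun x => hDm x)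
  have hf : Function.Injective f := by
    intro x y hxy
    have : D • x = D • y := congrArg Subtype.val hxy
    exact smul_right_injective _ hD0 this
  have hrank : Module.finrank ℤ (Lq q) = Fintype.card σ := by
    apply le_antisymm
    · have := Submodule.finrank_le (Lq q)
      rwa [Module.finrank_fintype_fun_eq_card] at this
    · have := LinearMap.finrank_le_finrank_of_injective hf
      rwa [Module.finrank_fintype_fun_eq_card] at this
  let b : Module.Basis σ ℤ (Lq q) := (Module.finBasisOfFinrankEq ℤ (Lq q) hrank).reindex (Fintype.equivFin σ).symm
  set A : Matrix σ σ ℤ := Matrix.of fun s t => (b t : σ → ℤ) s with hA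
  have hAx : ∀ x ∈ Lq q, ∃ c, x = A.mulVec c := by
    intro x hx
    refine ⟨fun t => b.repr ⟨x, hx⟩ t, ?_⟩
    have := congrArg Subtype.val (b.sum_repr ⟨x, hx⟩)
    funext s
    have h2 := congrFun this s
    simp only [Submodule.coe_sum, Finset.sum_apply, Submodule.coe_smul, Pi.smul_apply, smul_eq_mul] at h2
    rw [← h2]
    simp [hA, Matrix.mulVec, dotProduct, mul_comm]
  have hAm : ∀ c, A.mulVec c ∈ Lq q := by
    intro c
    have : A.mulVec c = ((∑ t, c t • b t : Lq q) : σ → ℤ) := by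
      funext s
      simp [hA, Matrix.mulVec, dotProduct, mul_comm]
    rw [this]; exact Subtype.mem _
  refine ⟨A, ?_, hAx, ?_⟩
  · have : ∀ t : σ, ∃ c, D • (Pi.single t 1 : σ → ℤ) = A.mulVec c := fun t => hAx _ (hDm _)
    choose C hC using this
    have hAC : A * (Matrix.of fun s t => C t s) = D • (1 : Matrix σ σ ℤ) := by
      ext s t
      have := congrFun (hC t) s
      simp only [Pi.smul_apply, Pi.single_apply, Matrix.mulVec, dotProduct] at this
      rw [Matrix.mul_apply]
      simp only [Matrix.of_apply, ← this]
      simp [Matrix.one_apply]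
    have := congrArg Matrix.det hAC
    rw [Matrix.det_mul, Matrix.det_smul, Matrix.det_one, mul_one] at this
    intro h0
    rw [h0, zero_mul] at this
    exact pow_ne_zero _ hD0 this.symm
  · intro i s
    have h1 := hAm (A.adjugate.mulVec (Pi.single s 1))
    rw [Matrix.mulVec_mulVec, Matrix.mul_adjugate, Matrix.smul_mulVec, Matrix.one_mulVec] at h1
    obtain ⟨n, hn⟩ := h1 i
    refine ⟨n, ?_⟩
    rw [← hn]
    simp [Pi.single_apply, mul_comm]

/-- the convergent sum -/
def KK (d e : ℕ) : ENNReal := ∑' D : ℕ, ((2 * (D + 1) + 1)^e : ℕ) * ENNReal.ofReal (((D + 1 : ℕ) : ℝ)⁻¹ ^ d)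

lemma KK_ne_top {d e : ℕ} (h : e + 2 ≤ d) : KK d e ≠ ⊤ := by
  have hle : ∀ a : ℕ, (((2 * (a + 1) + 1)^e : ℕ) : ENNReal) * ENNReal.ofReal (((a + 1 : ℕ) : ℝ)⁻¹ ^ d) ≤ ENNReal.ofReal (3 ^ e * (1 / ((a+1 : ℕ):ℝ)^2)) := by
    intro a
    rw [← ENNReal.ofReal_natCast, ← ENNReal.ofReal_mul (by positivity)]
    apply ENNReal.ofReal_le_ofReal
    obtain ⟨f, rfl⟩ : ∃ f, d = e + 2 + f := ⟨d - (e+2), by omega⟩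
    have h1 : (1:ℝ) ≤ ((a+1:ℕ):ℝ) := by exact_mod_cast (by omega : 1 ≤ a + 1)
    have h2 : (((2 * (a + 1) + 1)^e : ℕ) : ℝ) ≤ 3 ^ e * ((a+1:ℕ):ℝ)^e := by
      rw [← mul_pow, Nat.cast_pow]
      gcongr
      push_cast at h1 ⊢
      linarith
    set x : ℝ := ((a+1:ℕ):ℝ)
    have : x ^ e * x⁻¹ ^ (e + 2 + f) = (1 / x ^ 2) * (x⁻¹) ^ f := by
      rw [pow_add, pow_add]
      have : x ≠ 0 := by positivity
      have h3 : x ^ e * x⁻¹ ^ e = 1 := by rw [← mul_pow, mul_inv_cancel₀ this, one_pow]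
      rw [← mul_assoc, ← mul_assoc, h3, one_mul, inv_pow, one_div]
    calc _ ≤ 3 ^ e * x ^ e * x⁻¹ ^ (e + 2 + f) := by gcongr
      _ = 3 ^ e * ((1 / x ^ 2) * (x⁻¹) ^ f) := by rw [mul_assoc, this]
      _ ≤ 3 ^ e * (1 / x ^ 2) := by
        gcongr
        exact mul_le_of_le_one_right (by positivity) (pow_le_one₀ (by positivity) (inv_le_one_of_one_le₀ h1))
  refine ne_top_of_le_ne_top ?_ (ENNReal.tsum_le_tsum hle)
  have hs : Summable fun a : ℕ => 1 / ((a+1 : ℕ):ℝ)^2 :=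
    (summable_nat_add_iff 1).2 (Real.summable_one_div_nat_pow.2 (by norm_num : 1 < 2))
  exact (hs.mul_left _).tsum_ofReal_ne_top

/-- normalised coefficient families -/
def QS {κ : Type*} [DecidableEq κ] (S : Finset κ) : Set (κ → S → ℚ) :=
  {q | (∀ i a, |q i a| ≤ 1) ∧ ∀ s t : S, q s t = if s = t then 1 else 0}

lemma sum_QS {κ : Type*} [Fintype κ] [DecidableEq κ] (S : Finset κ) (d : ℕ) (D : QS S → ℤ) (hD0 : ∀ q, D q ≠ 0)
    (hD : ∀ q i s, ∃ n : ℤ, (D q : ℚ) * q.1 i s = n) :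
    ∑' q : QS S, ENNReal.ofReal (|(D q : ℝ)|⁻¹ ^ d) ≤ KK d (S.card * (Fintype.card κ - S.card)) := by
  have hD' : ∀ q i s, ∃ n : ℤ, ((|D q| : ℤ) : ℚ) * q.1 i s = n := by
    intro q i s
    obtain ⟨n, hn⟩ := hD q i s
    rcases abs_choice (D q) with h | h
    · exact ⟨n, by rw [h, hn]⟩
    · exact ⟨-n, by rw [h]; push_cast; rw [← hn]; ring⟩
  choose n hn using hD'
  have hb : ∀ q i s, |n q i s| ≤ |D q| := by
    intro q i s
    have h1 : |(n q i s : ℚ)| ≤ ((|D q| : ℤ) : ℚ) := by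
      rw [← hn, abs_mul, Int.cast_abs, abs_abs]
      exact mul_le_of_le_one_right (abs_nonneg _) (q.2.1 i s)
    exact_mod_cast h1
  have hD2 : ∀ q, ((|D q|.toNat - 1 : ℕ) : ℤ) + 1 = |D q| := by
    intro q
    have := abs_pos.2 (hD0 q)
    omega
  let φ : QS S → Σ D : ℕ, ({i // i ∉ S} → S → Fin (2 * (D+1) + 1)) := fun q => ⟨|D q|.toNat - 1, 
    fun i s => ⟨(n q i s + |D q|).toNat, by
      have h1 := abs_le.1 (hb q i s)
      have h2 := hD2 q
      omega⟩⟩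
  let ψ : (Σ D : ℕ, ({i // i ∉ S} → S → Fin (2 * (D+1) + 1))) → κ → S → ℚ := fun p i s =>
    if h : i ∈ S then (if (⟨i, h⟩ : S) = s then 1 else 0) else ((((p.2 ⟨i, h⟩ s).1 : ℤ) - (p.1 + 1) : ℤ) : ℚ) / ((p.1 + 1 : ℤ) : ℚ)
  have hψ : ∀ q, ψ (φ q) = q.1 := by
    intro q
    funext i s
    by_cases h : i ∈ S
    · simp only [ψ, h, dif_pos]
      exact (q.2.2 ⟨i, h⟩ s).symm
    · simp only [ψ, φ, h, dif_neg, not_false_eq_true]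
      rw [hD2]
      have h1 := abs_le.1 (hb q i s)
      rw [Int.toNat_of_nonneg (by omega), add_sub_cancel_right, ← hn, mul_comm, mul_div_assoc, div_self, mul_one]
      have := abs_pos.2 (hD0 q)
      exact_mod_cast this.ne'
  have hφ : Function.Injective φ := by
    intro q q' h
    apply Subtype.ext
    rw [← hψ, ← hψ, h]
  have hval : ∀ q : QS S, ENNReal.ofReal (|(D q : ℝ)|⁻¹ ^ d) = 
      (fun p : Σ D : ℕ, ({i // i ∉ S} → S → Fin (2 * (D+1) + 1)) => ENNReal.ofReal (((p.1 + 1 : ℕ) : ℝ)⁻¹ ^ d)) (φ q) := by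
    intro q
    have : (((|D q|.toNat - 1) + 1 : ℕ) : ℝ) = |(D q : ℝ)| := by
      have := hD2 q
      rw [← Int.cast_abs, ← this]; push_cast; rfl
    simp only [φ]
    rw [this]
  simp only [hval]
  refine (ENNReal.tsum_comp_le_tsum_of_injective hφ (fun p : Σ D : ℕ, ({i // i ∉ S} → S → Fin (2 * (D+1) + 1)) => ENNReal.ofReal (((p.1 + 1 : ℕ) : ℝ)⁻¹ ^ d))).trans ?_
  rw [ENNReal.tsum_sigma', KK]
  refine ENNReal.tsum_le_tsum fun a => ?_
  simp only [tsum_fintype, Finset.sum_const, Finset.card_univ, Fintype.card_fun, Fintype.card_fin, nsmul_eq_mul]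
  apply le_of_eq
  congr 2
  rw [← pow_mul]
  congr 1
  simp [Fintype.card_subtype_compl]

lemma nu_biUnion {d : ℕ} {ι β : Type*} [Fintype ι] (μ : Measure (Xspace d)) (T : Finset β) {Z : Set (ι → Fin d → ℤ)} (hZ : GInv Z)
    (Y : β → Set (ι → Fin d → ℤ)) (hY : ∀ b, GInv (Y b)) (h : Z ⊆ ⋃ b ∈ T, Y b) 
    {F : (ι → Fin d → ℝ) → ENNReal} (hF : Measurable F) :
    ∫⁻ y, F y ∂(nu μ Z) ≤ ∑ b ∈ T, ∫⁻ y, F y ∂(nu μ (Y b)) := by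
  rw [lintegral_nu μ hZ hF]
  simp only [lintegral_nu μ (hY _) hF]
  rw [← lintegral_finsetSum _ fun b _ => measurable_fhat (hY b) hF]
  refine lintegral_mono fun x => ?_
  unfold fhat
  refine (ENNReal.tsum_mono_subtype (fun z => F (act (Quotient.out x) (zc z))) h).trans ?_
  exact ENNReal.tsum_biUnion_le (fun z => F (act (Quotient.out x) (zc z))) T Y

lemma zc_inj {d : ℕ} {ι : Type*} : Function.Injective (zc (d := d) (ι := ι)) := by
  intro z y h
  funext i
  exact vc_inj (congrFun h i)

def ZS {d : ℕ} {κ : Type*} [Fintype κ] [DecidableEq κ] (Z : Set (κ → Fin d → ℤ)) (S : Finset κ) : Set (κ → Fin d → ℤ) :=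
  {z | z ∈ Z ∧ LinearIndependent ℝ (fun s : S => zc z s) ∧ ∃ q ∈ QS S, ∀ i, zc z i = ∑ a : S, (q i a : ℝ) • zc z a}

lemma ginv_ZS {d : ℕ} {κ : Type*} [Fintype κ] [DecidableEq κ] {Z : Set (κ → Fin d → ℤ)} (hZ : GInv Z) (S : Finset κ) :
    GInv (ZS Z S) := by
  intro γ z hz
  obtain ⟨h1, h2, q, hq, h3⟩ := hz
  refine ⟨hZ γ z h1, ?_, q, hq, ?_⟩
  · exact ginv_Ind d S γ (fun s : S => z s) h2
  · rw [← act_zc_map]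
    have : zc z = TA (Matrix.of fun i a => (q i a : ℝ)) (fun s : S => zc z s) := funext h3
    intro i
    conv_lhs => rw [this, ← TA_act]
    rfl

lemma dep_S {d : ℕ} {κ : Type*} [Fintype κ] [DecidableEq κ] (μ : Measure (Xspace d)) 
    {Z : Set (κ → Fin d → ℤ)} (hZ : GInv Z) (S : Finset κ) {c : ENNReal} (hc : nu μ (Ind d S) = c • volume)
    {Ω : Set (κ → Fin d → ℝ)} (hΩ : MeasurableSet Ω) {Ω' : Set (S → Fin d → ℝ)} (hΩ' : MeasurableSet Ω')
    (h : ∀ g, ∀ z ∈ ZS Z S, act g (zc z) ∈ Ω → (fun s : S => act g (zc z) s) ∈ Ω') :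
    nu μ (ZS Z S) Ω ≤ KK d (S.card * (Fintype.card κ - S.card)) * (c * volume Ω') := by
  choose A hA0 hAx hAD using fun q : QS S => exists_A q.1
  set AR : QS S → Matrix S S ℝ := fun q => (A q).map (fun x : ℤ => (x : ℝ)) with hAR
  have hdet : ∀ q, (AR q).det = ((A q).det : ℝ) := fun q => (Int.cast_det (R := ℝ) (A q)).symm
  have hcount : Countable (QS S) := inferInstance
  rw [← lintegral_indicator_one hΩ]
  refine (nu_le' μ (ginv_ZS hZ S) (ginv_Ind d S) (α := QS S) (measurable_one.indicator hΩ) 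
    (G := fun q w => Ω'.indicator 1 (TA (AR q) w))
    (fun q => (measurable_one.indicator hΩ').comp (continuous_TA _).measurable)
    (fun q w => Function.invFun zc (TA (Matrix.of fun i a => (q.1 i a : ℝ)) (TA (AR q) (zc w)))) ?_).trans ?_
  · intro g z hz h0
    have hmem : act g (zc z) ∈ Ω := Set.mem_of_indicator_ne_zero h0
    have hΩ'm := h g z hz hmem
    obtain ⟨h1, h2, q, hq, h3⟩ := hz
    have hcol : ∀ j, ∃ c : S → ℤ, (fun s : S => z s j) = (A ⟨q, hq⟩).mulVec c := by
      intro j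
      apply hAx
      intro i
      refine ⟨z i j, ?_⟩
      have := congrFun (h3 i) j
      simp only [Finset.sum_apply, Pi.smul_apply, smul_eq_mul, zc] at this
      exact_mod_cast this.symm
    choose w hw using hcol
    have hzw : (fun s : S => zc z s) = TA (AR ⟨q, hq⟩) (zc fun t j => w j t) := by
      funext s j
      have := congrFun (hw j) s
      simp only [Matrix.mulVec, dotProduct] at this
      simp only [TA, zc, Finset.sum_apply, Pi.smul_apply, smul_eq_mul, hAR, Matrix.map_apply]
      exact_mod_cast this
    refine ⟨⟨q, hq⟩, fun t j => w j t, ?_, ?_, ?_⟩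
    · exact li_of_TA (hzw ▸ h2)
    · have : TA (AR ⟨q, hq⟩) (act g (zc fun t j => w j t)) = fun s : S => act g (zc z) s := by
        rw [TA_act, ← hzw]; rfl
      simp only [this]
      rw [Set.indicator_of_mem hmem, Set.indicator_of_mem hΩ'm]
      simp
    · dsimp only
      rw [← hzw]
      have : zc z = TA (Matrix.of fun i a => (q i a : ℝ)) (fun s : S => zc z s) := funext h3
      rw [← this, Function.leftInverse_invFun zc_inj]
  · have : ∀ q : QS S, ∫⁻ w, Ω'.indicator 1 (TA (AR q) w) ∂(nu μ (Ind d S)) = ENNReal.ofReal (|((A q).det : ℝ)|⁻¹ ^ d) * (c * volume Ω') := by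
      intro q
      rw [hc, lintegral_smul_measure, lintegral_TA (by rw [hdet]; exact_mod_cast hA0 q) (measurable_one.indicator hΩ'),
        lintegral_indicator_one hΩ', hdet, smul_eq_mul, mul_left_comm]
    simp only [this]
    rw [ENNReal.tsum_mul_right]
    gcongr
    exact sum_QS S d (fun q => (A q).det) hA0 hAD

lemma dep_bound {d : ℕ} {κ : Type*} [Fintype κ] [DecidableEq κ] (μ : Measure (Xspace d)) 
    {Z : Set (κ → Fin d → ℤ)} (hZ : GInv Z) (hdep : ∀ z ∈ Z, ¬ LinearIndependent ℝ (zc z))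
    (c : Finset κ → ENNReal) (hc : ∀ S, S ≠ Finset.univ → nu μ (Ind d S) = c S • volume)
    {Ω : Set (κ → Fin d → ℝ)} (hΩ : MeasurableSet Ω) {Ω' : ∀ S : Finset κ, Set (S → Fin d → ℝ)} (hΩ' : ∀ S, MeasurableSet (Ω' S))
    (h : ∀ S, S ≠ Finset.univ → ∀ g, ∀ z ∈ ZS Z S, act g (zc z) ∈ Ω → (fun s : S => act g (zc z) s) ∈ Ω' S) :
    nu μ Z Ω ≤ ∑ S ∈ Finset.univ.erase Finset.univ, KK d (S.card * (Fintype.card κ - S.card)) * (c S * volume (Ω' S)) := by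
  rw [← lintegral_indicator_one hΩ]
  refine (nu_biUnion μ (Finset.univ.erase Finset.univ) hZ (ZS Z) (ginv_ZS hZ) ?_ (measurable_one.indicator hΩ)).trans ?_
  · intro z hz
    obtain ⟨S, q, h1, h2, h3, h4⟩ := exists_S z
    simp only [Set.mem_iUnion]
    refine ⟨S, ?_, hz, h1, q, ⟨h2, h3⟩, h4⟩
    rw [Finset.mem_erase]
    refine ⟨?_, Finset.mem_univ _⟩
    rintro rfl
    apply hdep z hz
    have := (linearIndependent_equiv (Equiv.subtypeUnivEquiv (fun x : κ => Finset.mem_univ x)) (f := zc z)).1 h1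
    exact this
  · refine Finset.sum_le_sum fun S hS => ?_
    have hS' := (Finset.mem_erase.1 hS).1
    rw [lintegral_indicator_one hΩ]
    exact dep_S μ hZ S (hc S hS') hΩ (hΩ' S) (h S hS')

lemma tsum_pow' {V : Type*} (a : V → ENNReal) (m : ℕ) :
    (∑' v, a v) ^ m = ∑' z : Fin m → V, ∏ i, a (z i) := by
  induction m with
  | zero => simp [tsum_fintype]
  | succ m ih =>
    rw [pow_succ', ih, ← (Fin.consEquiv (fun _ : Fin (m+1) => V)).tsum_eq, ENNReal.tsum_prod', ← ENNReal.tsum_mul_right]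
    refine tsum_congr fun v => ?_
    rw [← ENNReal.tsum_mul_left]
    refine tsum_congr fun z => ?_
    simp [Fin.consEquiv, Fin.prod_univ_succ]

def Cu (d : ℕ) (R : ℝ) : Set (Fin d → ℝ) := {x | ∀ j, x j ∈ Set.Ico (-R) R}

def Dc (d : ℕ) (ι : Type*) (R : ℝ) : Set (ι → Fin d → ℝ) := {w | ∀ i, w i ∈ Cu d R}

lemma Cu_eq (d : ℕ) (R : ℝ) : Cu d R = Set.univ.pi fun _ => Set.Ico (-R) R := by
  ext x; simp [Cu]

lemma Dc_eq (d : ℕ) (ι : Type*) (R : ℝ) : Dc d ι R = Set.univ.pi fun _ => Cu d R := by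
  ext x; simp [Dc]

lemma measurableSet_Cu (d : ℕ) (R : ℝ) : MeasurableSet (Cu d R) := by
  rw [Cu_eq]; exact MeasurableSet.univ_pi fun _ => measurableSet_Ico

lemma measurableSet_Dc (d : ℕ) (ι : Type*) [Fintype ι] (R : ℝ) : MeasurableSet (Dc d ι R) := by
  rw [Dc_eq]; exact MeasurableSet.univ_pi fun _ => measurableSet_Cu d R

lemma vol_Cu (d : ℕ) (R : ℝ) : volume (Cu d R) = ENNReal.ofReal (2 * R) ^ d := by
  rw [Cu_eq, volume_pi_pi]; simp [Real.volume_Ico, two_mul]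

lemma vol_Dc (d : ℕ) (ι : Type*) [Fintype ι] (R : ℝ) :
    volume (Dc d ι R) = (ENNReal.ofReal (2 * R) ^ d) ^ Fintype.card ι := by
  rw [Dc_eq, volume_pi_pi]; simp [vol_Cu]

def NN {d : ℕ} (C : Set (Fin d → ℝ)) (g : SLR d) : ENNReal :=
  ∑' v : Fin d → ℤ, C.indicator 1 (g.1.mulVec (vc v))

lemma ginv_univ (d : ℕ) (ι : Type*) : GInv (Set.univ : Set (ι → Fin d → ℤ)) := fun _ _ _ => trivial

lemma fhat_pow {d : ℕ} (m : ℕ) (C : Set (Fin d → ℝ)) (x : Xspace d) :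
    fhat (Set.univ : Set (Fin m → Fin d → ℤ)) ({w | ∀ i, w i ∈ C}.indicator 1) x
      = NN C (Quotient.out x) ^ m := by
  classical
  unfold NN fhat
  rw [tsum_pow', tsum_univ (f := fun z : Fin m → Fin d → ℤ => ({w : Fin m → Fin d → ℝ | ∀ i, w i ∈ C}.indicator 1 (act (Quotient.out x) (zc z)) : ENNReal))]
  refine tsum_congr fun z => ?_
  simp only [Set.indicator_apply, Set.mem_ofPred_eq, Pi.one_apply]
  rw [Finset.prod_ite_zero]
  simp [act]
  rfl

lemma NN_dom {d : ℕ} (n : ℕ) (g : SLR d) :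
    NN (Cu d n) g ≤ (2 * n : ENNReal) ^ d * NN (Cu d 1) g := by
  classical
  let α := {a : Fin d → ℤ // a ∈ Fintype.piFinset fun _ : Fin d => Finset.Ico (-(n:ℤ)) n}
  let fl : (Fin d → ℤ) → Fin d → ℤ := fun v j => ⌊g.1.mulVec (vc v) j⌋
  let ch : α → Fin d → ℤ := fun a => if h : ∃ v, fl v = a.1 then h.choose else 0
  have hch : ∀ a v, fl v = a.1 → fl (ch a) = a.1 := by
    intro a v h
    have h' : ∃ v, fl v = a.1 := ⟨v, h⟩
    simp only [ch, dif_pos h']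
    exact h'.choose_spec
  have := tsum_le_of_inj (Z := (Set.univ : Set (Fin d → ℤ))) (Y := (Set.univ : Set (Fin d → ℤ))) (α := α)
    (fun v => ((Cu d n).indicator 1 (g.1.mulVec (vc v)) : ENNReal))
    (fun _ v => ((Cu d 1).indicator 1 (g.1.mulVec (vc v)) : ENNReal))
    (fun a w => w + ch a) ?_
  · rw [tsum_univ (f := fun v : Fin d → ℤ => ((Cu d n).indicator 1 (g.1.mulVec (vc v)) : ENNReal))] at this
    refine this.trans (le_of_eq ?_)
    simp only [tsum_univ (f := fun v : Fin d → ℤ => ((Cu d 1).indicator 1 (g.1.mulVec (vc v)) : ENNReal))]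
    rw [tsum_fintype, Finset.sum_const, nsmul_eq_mul]
    unfold NN
    congr 1
    have hc : (Finset.univ : Finset α).card = (2 * n) ^ d := by
      rw [Finset.card_univ, Fintype.card_coe, Fintype.card_piFinset]
      simp
      congr 1; omega
    rw [hc]; push_cast; rfl
  · intro v _ h0
    have hv : g.1.mulVec (vc v) ∈ Cu d n := Set.mem_of_indicator_ne_zero h0
    let a : α := ⟨fl v, by
      rw [Fintype.mem_piFinset]
      intro j
      rw [Finset.mem_Ico]
      refine ⟨Int.le_floor.2 ?_, Int.floor_lt.2 ?_⟩
      · push_cast; exact (hv j).1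
      · exact_mod_cast (hv j).2⟩
    refine ⟨a, v - ch a, trivial, ?_, by simp⟩
    have hm : g.1.mulVec (vc (v - ch a)) ∈ Cu d 1 := by
      intro j
      rw [vc_sub, Matrix.mulVec_sub, Pi.sub_apply]
      have h1 : ⌊g.1.mulVec (vc (ch a)) j⌋ = ⌊g.1.mulVec (vc v) j⌋ := congrFun (hch a v rfl) j
      have h2 := Int.abs_sub_lt_one_of_floor_eq_floor h1.symm
      rw [abs_lt] at h2
      exact ⟨h2.1.le, h2.2⟩
    rw [Set.indicator_of_mem hm, Set.indicator_of_mem hv]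
    simp

open scoped Pointwise in
lemma NN_lim {d : ℕ} (g : SLR d) :
    Filter.Tendsto (fun n : ℕ => NN (Cu d n) g / (2 * n : ENNReal) ^ d) Filter.atTop (nhds 1) := by
  classical
  let s : Set (Fin d → ℝ) := (fun x => g.1.mulVec x) ⁻¹' Cu d 1
  have hcont : Continuous fun x : Fin d → ℝ => g.1.mulVec x := by fun_prop
  have hsm : MeasurableSet s := hcont.measurable (measurableSet_Cu d 1)
  have hvol : volume s = 2 ^ d := by
    rw [(vol_mulVec g).measure_preimage (measurableSet_Cu d 1).nullMeasurableSet, vol_Cu]; simp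
  have hb : Bornology.IsBounded s := by
    have h1 : Bornology.IsBounded (Cu d 1) := by
      rw [Cu_eq]; exact Bornology.IsBounded.pi fun _ => Metric.isBounded_Ico _ _
    have hc2 : Continuous fun x : Fin d → ℝ => (g⁻¹).1.mulVec x := by fun_prop
    have h2 : IsCompact ((fun x : Fin d → ℝ => (g⁻¹).1.mulVec x) '' closure (Cu d 1)) :=
      h1.isCompact_closure.image hc2
    refine h2.isBounded.subset ?_
    intro x hx
    refine ⟨g.1.mulVec x, subset_closure hx, ?_⟩
    simp only [Matrix.mulVec_mulVec]
    rw [← Matrix.SpecialLinearGroup.coe_mul]; simp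
  have hfr : volume (frontier s) = 0 := by
    have hsub : frontier s ⊆ (fun x => g.1.mulVec x) ⁻¹' frontier (Cu d 1) := hcont.frontier_preimage_subset _
    refine measure_mono_null hsub ?_
    rw [(vol_mulVec g).measure_preimage isClosed_frontier.measurableSet.nullMeasurableSet]
    have hc : Convex ℝ (Cu d 1) := by
      rw [Cu_eq]; exact convex_pi fun _ _ => convex_Ico _ _
    exact hc.addHaar_frontier volume
  have key := tendsto_card_div_pow_atTop_volume s hb hsm hfr
  have hcard : ∀ n : ℕ, 0 < n → NN (Cu d n) g = (Nat.card ↑(s ∩ (n:ℝ)⁻¹ • (Submodule.span ℤ (Set.range (Pi.basisFun ℝ (Fin d))) : Set (Fin d → ℝ))) : ENNReal) := by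
    intro n hn
    have hn0 : (0:ℝ) < n := by positivity
    have hn' : (n:ℝ) ≠ 0 := by positivity
    let T : Set (Fin d → ℤ) := {v | g.1.mulVec (vc v) ∈ Cu d n}
    have hscale : ∀ x : Fin d → ℝ, g.1.mulVec x ∈ Cu d n ↔ (n:ℝ)⁻¹ • x ∈ s := by
      intro x
      simp only [s, Cu, Set.mem_preimage, Set.mem_ofPred_eq, Matrix.mulVec_smul, Pi.smul_apply, smul_eq_mul, Set.mem_Ico]
      refine forall_congr' fun j => ?_
      rw [inv_mul_lt_iff₀ hn0, le_inv_mul_iff₀ hn0]; simp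
    have hT : T.Finite := by
      obtain ⟨M, hM⟩ := hb.exists_norm_le
      obtain ⟨K, hK⟩ := exists_nat_ge (n * M)
      refine (Set.finite_Icc (fun _ : Fin d => -(K:ℤ)) (fun _ => (K:ℤ))).subset ?_
      intro v hv
      have h1 := hM _ ((hscale _).1 hv)
      have h2 : ∀ j, |v j| ≤ (K:ℤ) := by
        intro j
        have h3 := (norm_le_pi_norm ((n:ℝ)⁻¹ • vc v) j).trans h1
        simp only [Pi.smul_apply, smul_eq_mul, Real.norm_eq_abs, abs_mul, abs_inv, Nat.abs_cast] at h3
        rw [inv_mul_le_iff₀ hn0] at h3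
        have h4 : |(v j : ℝ)| ≤ K := h3.trans hK
        exact_mod_cast h4
      exact ⟨fun j => (abs_le.1 (h2 j)).1, fun j => (abs_le.1 (h2 j)).2⟩
    have himg : s ∩ (n:ℝ)⁻¹ • (Submodule.span ℤ (Set.range (Pi.basisFun ℝ (Fin d))) : Set (Fin d → ℝ)) = (fun v => (n:ℝ)⁻¹ • vc v) '' T := by
      ext x
      simp only [Set.mem_inter_iff, Set.mem_smul_set, Set.mem_image, SetLike.mem_coe, T, Set.mem_ofPred_eq]
      constructor
      · rintro ⟨hx, y, hy, rfl⟩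
        rw [Module.Basis.mem_span_iff_repr_mem] at hy
        have : ∀ j, ∃ a : ℤ, (a:ℝ) = y j := by
          intro j
          obtain ⟨a, ha⟩ := hy j
          exact ⟨a, by simpa using ha⟩
        choose v hv using this
        have hvy : vc v = y := funext hv
        exact ⟨v, by rw [hvy]; exact (hscale y).2 hx, by rw [hvy]⟩
      · rintro ⟨v, hv, rfl⟩
        refine ⟨(hscale _).1 hv, vc v, ?_, rfl⟩
        rw [Module.Basis.mem_span_iff_repr_mem]
        intro j
        exact ⟨v j, by simp [vc]⟩
    rw [himg, Nat.card_image_of_injective]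
    · have : Finite T := hT
      unfold NN
      have h1 : ∀ v, ((Cu d n).indicator 1 (g.1.mulVec (vc v)) : ENNReal) = T.indicator 1 v := by
        intro v; simp only [Set.indicator_apply]; rfl
      simp only [h1]
      rw [← tsum_subtype T]
      simp
      rw [← hT.cast_ncard_eq]; exact ENat.toENNReal_coe _
    · intro v w hvw
      have := smul_right_injective (Fin d → ℝ) (inv_ne_zero hn') hvw
      exact vc_inj this
  have hv : volume.real s = 2 ^ d := by simp [Measure.real, hvol]
  rw [hv] at key
  have k2 := (ENNReal.tendsto_ofReal key)
  have k3 := ENNReal.Tendsto.div_const k2 (b := 2 ^ d) (Or.inr (by simp))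
  have : ENNReal.ofReal (2^d) / 2^d = 1 := by
    rw [ENNReal.ofReal_pow (by norm_num)]; simp [ENNReal.div_self]
  rw [this] at k3
  refine k3.congr' ?_
  filter_upwards [Filter.eventually_gt_atTop 0] with n hn
  rw [hcard n hn, ENNReal.ofReal_div_of_pos (by positivity), ENNReal.ofReal_natCast, ENNReal.ofReal_pow (by positivity), ENNReal.ofReal_natCast, Fintype.card_fin, mul_pow, mul_comm (2 ^ d), div_eq_mul_inv, div_eq_mul_inv, div_eq_mul_inv, ENNReal.mul_inv (by simp) (by simp), mul_assoc]

lemma nu_apply {d : ℕ} {ι : Type*} [Fintype ι] (μ : Measure (Xspace d))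
    {Z : Set (ι → Fin d → ℤ)} (hZ : GInv Z) {s : Set (ι → Fin d → ℝ)} (hs : MeasurableSet s) :
    nu μ Z s = ∫⁻ x, fhat Z (s.indicator 1) x ∂μ := by
  rw [← lintegral_indicator_one hs, lintegral_nu μ hZ (measurable_one.indicator hs)]

lemma ginv_compl {d : ℕ} {ι : Type*} {Z : Set (ι → Fin d → ℤ)} (hZ : GInv Z) : GInv Zᶜ := by
  intro γ z hz h
  apply hz
  have := hZ γ⁻¹ _ h
  simp only [Matrix.mulVec_mulVec] at this
  rw [← Matrix.SpecialLinearGroup.coe_mul] at this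
  simpa using this

lemma ginv_inter {d : ℕ} {ι : Type*} {Z Y : Set (ι → Fin d → ℤ)} (hZ : GInv Z) (hY : GInv Y) : GInv (Z ∩ Y) :=
  fun γ z hz => ⟨hZ γ z hz.1, hY γ z hz.2⟩

lemma fhat_split {d : ℕ} {ι : Type*} {Z Y : Set (ι → Fin d → ℤ)} (F : (ι → Fin d → ℝ) → ENNReal)
    (x : Xspace d) : fhat Z F x = fhat (Z ∩ Y) F x + fhat (Z ∩ Yᶜ) F x := by
  unfold fhat
  have hd : Disjoint (Z ∩ Y) (Z ∩ Yᶜ) := by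
    rw [Set.disjoint_left]; intro z h1 h2; exact h2.2 h1.2
  have := ENNReal.summable.tsum_union_disjoint (f := fun z => F (act (Quotient.out x) (zc z))) hd ENNReal.summable
  rw [Set.inter_union_compl] at this
  exact this

lemma nu_split {d : ℕ} {ι : Type*} [Fintype ι] (μ : Measure (Xspace d))
    {Z Y : Set (ι → Fin d → ℤ)} (hZ : GInv Z) (hY : GInv Y) {s : Set (ι → Fin d → ℝ)} (hs : MeasurableSet s) :
    nu μ Z s = nu μ (Z ∩ Y) s + nu μ (Z ∩ Yᶜ) s := by
  have hm : Measurable (s.indicator 1 : (ι → Fin d → ℝ) → ENNReal) := measurable_one.indicator hs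
  rw [nu_apply μ hZ hs, nu_apply μ (ginv_inter hZ hY) hs, nu_apply μ (ginv_inter hZ (ginv_compl hY)) hs,
    ← lintegral_add_left (measurable_fhat (ginv_inter hZ hY) hm)]
  exact lintegral_congr fun x => fhat_split _ x

lemma card_S_lt {κ : Type*} [Fintype κ] {S : Finset κ} (h : S ≠ Finset.univ) : S.card < Fintype.card κ := by
  rw [← Finset.card_univ]; exact Finset.card_lt_card (Finset.ssubset_univ_iff.2 h)

lemma am_gm {a m k : ℕ} (hm : m ≤ 2 * k) : a * (m - a) ≤ k ^ 2 := by
  rcases le_total a m with h | h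
  · obtain ⟨b, rfl⟩ := Nat.exists_eq_add_of_le h
    have : a + b - a = b := by omega
    rw [this]
    zify at hm ⊢
    nlinarith [sq_nonneg ((a:ℤ) - b), sq_nonneg ((a:ℤ)+b)]
  · have : m - a = 0 := by omega
    rw [this]; positivity

/-- the dependent part, on cubes -/
lemma dep_cube {d m k : ℕ} (hm : m ≤ 2 * k) (hd : k ^ 2 + 3 ≤ d) (μ : Measure (Xspace d)) [IsProbabilityMeasure μ] (hμ : InvM μ) :
    ∃ K : ENNReal, K ≠ ⊤ ∧ ∀ n : ℕ, 1 ≤ n →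
      nu μ (Set.univ ∩ (Ind d (Fin m))ᶜ) (Dc d (Fin m) n) * (2 * n : ENNReal) ^ d ≤ K * ((2 * n : ENNReal) ^ d) ^ m := by
  classical
  have hmd : 2 * k < d := by nlinarith [sq_nonneg ((k:ℤ) - 1), Nat.sub_add_cancel (show 0 ≤ k by omega), sq_nonneg ((k:ℤ)-1)]
  have hP : ∀ S : Finset (Fin m), ∃ c : ENNReal, S ≠ Finset.univ → c ≠ ⊤ ∧ nu μ (Ind d S) = c • volume := by
    intro S
    by_cases h : S = Finset.univ
    · exact ⟨0, fun h' => absurd h h'⟩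
    · have hc : Fintype.card S < d := by
        have := card_S_lt h
        simp at this ⊢; omega
      obtain ⟨c, h1, h2⟩ := prop1_gen hc hμ (ginv_Ind d S) subset_rfl
      exact ⟨c, fun _ => ⟨h1, h2⟩⟩
  choose c hc using hP
  refine ⟨∑ S ∈ Finset.univ.erase (Finset.univ : Finset (Fin m)), KK d (S.card * (Fintype.card (Fin m) - S.card)) * c S, ?_, ?_⟩
  · refine ENNReal.sum_ne_top.2 fun S hS => ENNReal.mul_ne_top (KK_ne_top ?_) (hc S (Finset.ne_of_mem_erase hS)).1
    have := am_gm (a := S.card) hm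
    simp; omega
  · intro n hn
    have hG : GInv (Set.univ ∩ (Ind d (Fin m))ᶜ) := ginv_inter (ginv_univ d (Fin m)) (ginv_compl (ginv_Ind d (Fin m)))
    have hb := dep_bound μ hG (fun z hz => hz.2) c (fun S hS => (hc S hS).2) (measurableSet_Dc d (Fin m) n)
      (Ω' := fun S => Dc d S n) (fun S => measurableSet_Dc d S n) (fun S _ g z _ h s => h s)
    refine (mul_le_mul_left hb _).trans ?_
    rw [Finset.sum_mul, Finset.sum_mul]
    refine Finset.sum_le_sum fun S hS => ?_
    rw [vol_Dc]
    have h2 : ENNReal.ofReal (2 * (n:ℝ)) = 2 * n := by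
      rw [ENNReal.ofReal_mul (by norm_num)]; simp
    rw [h2, mul_assoc, mul_assoc, mul_assoc, ← pow_succ]
    gcongr
    · exact one_le_pow₀ (by
        have : (1:ENNReal) ≤ n := by exact_mod_cast hn
        calc (1:ENNReal) ≤ 1 * n := by simpa
          _ ≤ 2 * n := by gcongr; norm_num)
    · have := card_S_lt (Finset.ne_of_mem_erase hS)
      simp at this ⊢; omega

lemma const_one {d m k : ℕ} (hm : m ≤ 2 * k) (hd : k ^ 2 + 3 ≤ d) (μ : Measure (Xspace d)) [IsProbabilityMeasure μ] (hμ : InvM μ) :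
    nu μ (Ind d (Fin m)) = volume := by
  have hmd : 2 * k < d := by nlinarith [sq_nonneg ((k:ℤ) - 1)]
  obtain ⟨c, hc, hcv⟩ := prop1_gen (ι := Fin m) (by simp; omega) hμ (ginv_Ind d (Fin m)) subset_rfl
  obtain ⟨K, hK, hKb⟩ := dep_cube hm hd μ hμ
  have h2 : ∀ n : ℕ, ENNReal.ofReal (2 * (n:ℝ)) = 2 * n := by
    intro n; rw [ENNReal.ofReal_mul (by norm_num)]; simp
  have hA0 : ∀ n : ℕ, 1 ≤ n → (2 * n : ENNReal) ^ d ≠ 0 := fun n hn => by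
    apply pow_ne_zero; simp; omega
  have hAt : ∀ n : ℕ, (2 * n : ENNReal) ^ d ≠ ⊤ := fun n => by
    apply ENNReal.pow_ne_top; exact ENNReal.mul_ne_top (by simp) (by simp)
  have hsp : ∀ n : ℕ, nu μ Set.univ (Dc d (Fin m) n) = c * ((2 * n : ENNReal) ^ d) ^ m + nu μ (Set.univ ∩ (Ind d (Fin m))ᶜ) (Dc d (Fin m) n) := by
    intro n
    rw [nu_split μ (ginv_univ d (Fin m)) (ginv_Ind d (Fin m)) (measurableSet_Dc d (Fin m) n), Set.univ_inter, hcv]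
    simp [vol_Dc, h2]
  have hm1 : ∀ n : ℕ, nu μ Set.univ (Dc d (Fin m) n) = ∫⁻ x, NN (Cu d n) (Quotient.out x) ^ m ∂μ := by
    intro n
    rw [nu_apply μ (ginv_univ d (Fin m)) (measurableSet_Dc d (Fin m) n)]
    exact lintegral_congr fun x => fhat_pow m (Cu d n) x
  have hmeas : ∀ n : ℕ, Measurable fun x : Xspace d => NN (Cu d n) (Quotient.out x) ^ m := by
    intro n
    have := measurable_fhat (ginv_univ d (Fin m)) (F := (Dc d (Fin m) n).indicator 1) (measurable_one.indicator (measurableSet_Dc d (Fin m) n))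
    convert this using 2 with x
    exact (fhat_pow m (Cu d n) x).symm
  let F : ℕ → Xspace d → ENNReal := fun n x => NN (Cu d n) (Quotient.out x) ^ m / ((2 * n : ENNReal) ^ d) ^ m
  have hFeq : ∀ n x, F n x = (NN (Cu d n) (Quotient.out x) / (2 * n : ENNReal) ^ d) ^ m := by
    intro n x
    simp only [F]
    rw [div_eq_mul_inv, div_eq_mul_inv, ENNReal.inv_pow, ← mul_pow]
  have hint : ∀ n, ∫⁻ x, F n x ∂μ = (c * ((2 * n : ENNReal) ^ d) ^ m + nu μ (Set.univ ∩ (Ind d (Fin m))ᶜ) (Dc d (Fin m) n)) / ((2 * n : ENNReal) ^ d) ^ m := by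
    intro n
    simp only [F, div_eq_mul_inv]
    rw [lintegral_mul_const _ (hmeas n), ← hm1, hsp]
  have hlim1 : Filter.Tendsto (fun n => ∫⁻ x, F (n+1) x ∂μ) Filter.atTop (nhds (∫⁻ x, 1 ∂μ)) := by
    refine tendsto_lintegral_of_dominated_convergence (fun x => NN (Cu d ((1:ℕ):ℝ)) (Quotient.out x) ^ m) ?_ ?_ ?_ ?_
    · intro n; exact (hmeas _).div_const _
    · intro n
      refine Filter.Eventually.of_forall fun x => ?_
      rw [hFeq]
      refine pow_le_pow_left₀ (by simp) ?_ m
      rw [ENNReal.div_le_iff (hA0 _ (by omega)) (hAt _), mul_comm]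
      simpa using NN_dom (n+1) (Quotient.out x : SLR d)
    · rw [← hm1, hsp]
      refine ENNReal.add_ne_top.2 ⟨ENNReal.mul_ne_top hc (ENNReal.pow_ne_top (hAt _)), ?_⟩
      have := hKb 1 le_rfl
      intro htop
      rw [htop, ENNReal.top_mul (hA0 1 le_rfl)] at this
      exact ENNReal.mul_ne_top hK (ENNReal.pow_ne_top (hAt 1)) (top_le_iff.1 this)
    · refine Filter.Eventually.of_forall fun x => ?_
      simp only [hFeq]
      have := ((ENNReal.continuous_pow m).tendsto 1).comp (NN_lim (Quotient.out x : SLR d))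
      rw [one_pow] at this
      exact (Filter.tendsto_add_atTop_iff_nat 1).2 this
  have hlim2 : Filter.Tendsto (fun n => ∫⁻ x, F (n+1) x ∂μ) Filter.atTop (nhds c) := by
    have hz : Filter.Tendsto (fun n : ℕ => c + K / ((n + 1 : ℕ) : ENNReal)) Filter.atTop (nhds (c + 0)) := by
      refine tendsto_const_nhds.add ?_
      have := ENNReal.Tendsto.const_div (f := Filter.atTop) (m := fun n : ℕ => ((n+1:ℕ) : ENNReal)) (b := ⊤) (a := K)
        ((Filter.tendsto_add_atTop_iff_nat 1).2 ENNReal.tendsto_nat_nhds_top) (Or.inr hK)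
      simpa using this
    rw [add_zero] at hz
    refine tendsto_of_tendsto_of_tendsto_of_le_of_le tendsto_const_nhds hz ?_ ?_
    · intro n
      simp only [hint]
      rw [ENNReal.le_div_iff_mul_le (Or.inl (pow_ne_zero _ (hA0 _ (by omega)))) (Or.inl (ENNReal.pow_ne_top (hAt _)))]
      exact le_self_add
    · intro n
      simp only [hint]
      have hB0 := pow_ne_zero m (hA0 (n+1) (by omega))
      have hBt : (((2 * (n+1:ℕ) : ENNReal) ^ d) ^ m) ≠ ⊤ := ENNReal.pow_ne_top (hAt (n+1))
      rw [ENNReal.add_div, ENNReal.mul_div_cancel_right hB0 hBt]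
      gcongr c + ?_
      rw [ENNReal.div_le_iff hB0 hBt]
      have h3 := hKb (n+1) (by omega)
      have h4 : ((n + 1 : ℕ) : ENNReal) ≤ (2 * (n+1:ℕ) : ENNReal) ^ d := by
        have : (n+1) ≤ (2 * (n+1)) ^ d := (by omega : n + 1 ≤ 2 * (n+1)).trans (Nat.le_self_pow (by omega) _)
        exact_mod_cast this
      rw [div_eq_mul_inv, mul_assoc, mul_comm _ (((2 * (n+1:ℕ) : ENNReal) ^ d) ^ m), ← mul_assoc, ← div_eq_mul_inv, 
        ENNReal.le_div_iff_mul_le (Or.inl (by simp)) (Or.inl (by simp))]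
      exact (mul_le_mul_right h4 _).trans h3
  have := tendsto_nhds_unique hlim1 hlim2
  rw [hcv, ← this]
  simp

def Prim (d : ℕ) (ι : Type*) : Set (ι → Fin d → ℤ) := {z | ∀ i, IsPrimitiveVec (z i)}

lemma prim_iff {d : ℕ} (v : Fin d → ℤ) : IsPrimitiveVec v ↔ ∀ c : ℤ, (∀ j, c ∣ v j) → c ∣ 1 := by
  constructor
  · rintro ⟨_, h⟩ c hc
    rw [← h]; exact Finset.dvd_gcd fun j _ => hc j
  · intro h
    have h1 : Finset.univ.gcd v ∣ 1 := h _ fun j => Finset.gcd_dvd (Finset.mem_univ j)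
    refine ⟨?_, ?_⟩
    · rintro rfl
      have := h 2 (fun j => by simp)
      norm_num at this
    · rw [← Finset.normalize_gcd]
      exact normalize_eq_one.2 (isUnit_of_dvd_one h1)

lemma ginv_Prim (d : ℕ) (ι : Type*) : GInv (Prim d ι) := by
  intro γ z hz i
  have := hz i
  rw [prim_iff] at this ⊢
  intro c hc
  apply this
  intro j
  have hinv : (γ⁻¹).1.mulVec (γ.1.mulVec (z i)) = z i := by
    rw [Matrix.mulVec_mulVec, ← Matrix.SpecialLinearGroup.coe_mul]; simp
  rw [← hinv]
  simp only [Matrix.mulVec, dotProduct] at hc ⊢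
  exact Finset.dvd_sum fun l _ => Dvd.dvd.mul_left (hc l) _

lemma prim_mul_inj {d : ℕ} {a b : ℕ} {v w : Fin d → ℤ} (hv : IsPrimitiveVec v) (hw : IsPrimitiveVec w)
    (h : ((a + 1 : ℕ) : ℤ) • v = ((b + 1 : ℕ) : ℤ) • w) : a = b ∧ v = w := by
  have hg : ∀ (a : ℕ) (v : Fin d → ℤ), IsPrimitiveVec v → Finset.univ.gcd (((a + 1 : ℕ) : ℤ) • v) = ((a+1 : ℕ) : ℤ) := by
    intro a v hv
    have : Finset.univ.gcd (((a + 1 : ℕ) : ℤ) • v) = Finset.univ.gcd (fun j => ((a + 1 : ℕ) : ℤ) * v j) := rfl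
    rw [this, Finset.gcd_mul_left, hv.2, mul_one, Int.normalize_of_nonneg (by positivity)]
  have h1 : ((a+1 : ℕ) : ℤ) = ((b+1 : ℕ) : ℤ) := by rw [← hg a v hv, ← hg b w hw, h]
  have h2 : a = b := by omega
  subst h2
  exact ⟨rfl, smul_right_injective _ (by positivity : ((a + 1 : ℕ) : ℤ) ≠ 0) h⟩

lemma exists_prim {d : ℕ} {v : Fin d → ℤ} (hv : v ≠ 0) : ∃ a : ℕ, ∃ w, IsPrimitiveVec w ∧ v = ((a + 1 : ℕ) : ℤ) • w := by
  obtain ⟨j0, hj0⟩ := Function.ne_iff.1 hv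
  obtain ⟨w, hw, hw1⟩ := Finset.extract_gcd v (s := Finset.univ) ⟨j0, Finset.mem_univ _⟩
  have hg0 : Finset.univ.gcd v ≠ 0 := by
    intro h
    rw [Finset.gcd_eq_zero_iff] at h
    exact hj0 (h j0 (Finset.mem_univ _))
  have hgn : 0 ≤ Finset.univ.gcd v := by
    rw [← Finset.normalize_gcd]; exact Int.nonneg_of_normalize_eq_self (normalize_idem _)
  obtain ⟨a, ha⟩ : ∃ a : ℕ, Finset.univ.gcd v = ((a + 1 : ℕ) : ℤ) := by
    obtain ⟨b, hb⟩ := Int.eq_ofNat_of_zero_le hgn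
    refine ⟨b - 1, ?_⟩
    rw [hb] at hg0 ⊢
    have : b ≠ 0 := by simpa using hg0
    congr 1; omega
  have hvw : v = ((a + 1 : ℕ) : ℤ) • w := by
    funext j
    have := hw j (Finset.mem_univ j)
    rw [ha] at this
    simpa using this
  refine ⟨a, w, ⟨?_, hw1⟩, hvw⟩
  rintro rfl
  exact hv (by rw [hvw]; simp)

def zet (d : ℕ) : ENNReal := ∑' a : ℕ, ENNReal.ofReal (((a + 1 : ℕ) : ℝ)⁻¹ ^ d)

lemma dgl_li {d m : ℕ} (a : Fin m → ℕ) (z : Fin m → Fin d → ℤ) :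
    (fun i => ((a i + 1 : ℕ) : ℤ) • z i) ∈ Ind d (Fin m) ↔ z ∈ Ind d (Fin m) := by
  have : zc (fun i => ((a i + 1 : ℕ) : ℤ) • z i) = (fun i => Units.mk0 ((a i + 1 : ℕ) : ℝ) (by positivity)) • zc z := by
    funext i j
    simp [zc, Units.smul_def]
  simp only [Ind, Set.mem_ofPred_eq, this]
  exact ⟨fun h => by simpa [smul_smul] using h.units_smul (fun i => (Units.mk0 ((a i + 1 : ℕ) : ℝ) (by positivity))⁻¹), fun h => h.units_smul _⟩

lemma prim_const {d m k : ℕ} (hm : m ≤ 2 * k) (hd : k ^ 2 + 3 ≤ d) (μ : Measure (Xspace d)) [IsProbabilityMeasure μ] (hμ : InvM μ) :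
    nu μ (Prim d (Fin m) ∩ Ind d (Fin m)) = (zet d ^ m)⁻¹ • volume := by
  classical
  have hmd : 2 * k < d := by nlinarith [sq_nonneg ((k:ℤ) - 1)]
  have hG := ginv_inter (ginv_Prim d (Fin m)) (ginv_Ind d (Fin m))
  obtain ⟨c, hc, hcv⟩ := prop1_gen (ι := Fin m) (by simp; omega) hμ hG Set.inter_subset_right
  have h1 := const_one hm hd μ hμ
  let D := Dc d (Fin m) (1/2)
  have hD : MeasurableSet D := measurableSet_Dc d (Fin m) (1/2)
  have hvD : volume D = 1 := by simp only [D]; rw [vol_Dc]; norm_num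
  have hF : Measurable (D.indicator 1 : (Fin m → Fin d → ℝ) → ENNReal) := measurable_one.indicator hD
  let A : (Fin m → ℕ) → Matrix (Fin m) (Fin m) ℝ := fun a => Matrix.diagonal fun i => ((a i + 1 : ℕ) : ℝ)
  have hdet : ∀ a, (A a).det ≠ 0 := by
    intro a; simp only [A]; rw [Matrix.det_diagonal]
    exact Finset.prod_ne_zero_iff.2 fun i _ => by positivity
  have hTA : ∀ a (z : Fin m → Fin d → ℤ), TA (A a) (zc z) = zc (fun i => ((a i + 1 : ℕ) : ℤ) • z i) := by
    intro a z
    funext i j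
    simp [TA, A, zc, Matrix.diagonal_apply, ite_apply]
  have key : ∫⁻ y, D.indicator 1 y ∂(nu μ (Ind d (Fin m))) = ∑' a : Fin m → ℕ, ∫⁻ y, D.indicator 1 (TA (A a) y) ∂(nu μ (Prim d (Fin m) ∩ Ind d (Fin m))) := by
    rw [lintegral_nu μ (ginv_Ind d (Fin m)) hF]
    have hm' : ∀ a, Measurable fun y : Fin m → Fin d → ℝ => (D.indicator 1 (TA (A a) y) : ENNReal) := fun a =>
      hF.comp (continuous_TA (A a)).measurable
    simp only [fun a => lintegral_nu μ hG (hm' a)]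
    rw [← lintegral_tsum fun a => (measurable_fhat hG (hm' a)).aemeasurable]
    refine lintegral_congr fun x => ?_
    unfold fhat
    let e : (Fin m → ℕ) × ↑(Prim d (Fin m) ∩ Ind d (Fin m)) → Ind d (Fin m) :=
      fun p => ⟨fun i => ((p.1 i + 1 : ℕ) : ℤ) • p.2.1 i, (dgl_li _ _).2 p.2.2.2⟩
    have he : Function.Bijective e := by
      constructor
      · rintro ⟨a, z, hz⟩ ⟨b, w, hw⟩ h
        have h' := congrArg Subtype.val h
        have h2 : ∀ i, a i = b i ∧ z i = w i := fun i => prim_mul_inj (hz.1 i) (hw.1 i) (congrFun h' i)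
        have ha : a = b := funext fun i => (h2 i).1
        have hzw : z = w := funext fun i => (h2 i).2
        subst ha hzw; rfl
      · rintro ⟨z, hz⟩
        have hz0 : ∀ i, z i ≠ 0 := by
          intro i h0
          apply LinearIndependent.ne_zero i hz
          funext j; simp [zc, h0]
        choose a w hw hzw using fun i => exists_prim (hz0 i)
        have hz' : (fun i => ((a i + 1 : ℕ) : ℤ) • w i) = z := (funext hzw).symm
        refine ⟨(a, ⟨w, hw, (dgl_li a w).1 (by rw [hz']; exact hz)⟩), ?_⟩
        exact Subtype.ext hz'
    rw [← (Equiv.ofBijective e he).tsum_eq, ENNReal.tsum_prod']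
    refine tsum_congr fun a => tsum_congr fun z => ?_
    simp only [TA_act, hTA]
    rfl
  rw [lintegral_indicator_one hD, h1, hvD, hcv] at key
  simp only [lintegral_smul_measure, lintegral_TA (hdet _) hF, lintegral_indicator_one hD, hvD, mul_one, smul_eq_mul] at key
  rw [ENNReal.tsum_mul_left] at key
  have hz : ∑' a : Fin m → ℕ, ENNReal.ofReal (|(A a).det|⁻¹ ^ d) = zet d ^ m := by
    unfold zet
    rw [tsum_pow']
    refine tsum_congr fun a => ?_
    simp only [A]
    rw [Matrix.det_diagonal, abs_of_nonneg (Finset.prod_nonneg fun i _ => by positivity), ← Finset.prod_inv_distrib, ← Finset.prod_pow, ENNReal.ofReal_prod_of_nonneg]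
    intro i _; positivity
  rw [hz] at key
  rw [hcv, ENNReal.eq_inv_of_mul_eq_one_left key.symm]

lemma li_ri {d : ℕ} {ι κ : Type*} (e : κ ≃ ι) (z : ι → Fin d → ℤ) :
    z ∈ Ind d ι ↔ (fun i => z (e i)) ∈ Ind d κ := by
  simp only [Ind, Set.mem_ofPred_eq]
  exact (linearIndependent_equiv (R := ℝ) e (f := zc z)).symm

lemma const_one_gen {d k : ℕ} {ι : Type*} [Fintype ι] (hm : Fintype.card ι ≤ 2 * k) (hd : k ^ 2 + 3 ≤ d)
    (μ : Measure (Xspace d)) [IsProbabilityMeasure μ] (hμ : InvM μ) : nu μ (Ind d ι) = (1 : ENNReal) • volume :=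
  prop1_ri (Fintype.equivFin ι) μ (ginv_Ind d _) (ginv_Ind d _) (fun z => li_ri _ z) 
    (by rw [const_one hm hd μ hμ, one_smul])

lemma prim_const_gen {d k : ℕ} {ι : Type*} [Fintype ι] (hm : Fintype.card ι ≤ 2 * k) (hd : k ^ 2 + 3 ≤ d)
    (μ : Measure (Xspace d)) [IsProbabilityMeasure μ] (hμ : InvM μ) :
    nu μ (Prim d ι ∩ Ind d ι) = (zet d ^ Fintype.card ι)⁻¹ • volume :=
  prop1_ri (Fintype.equivFin ι) μ (ginv_inter (ginv_Prim d _) (ginv_Ind d _)) (ginv_inter (ginv_Prim d _) (ginv_Ind d _))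
    (fun z => and_congr ((Fintype.equivFin ι).forall_congr_right (q := fun b => IsPrimitiveVec (z b))).symm (li_ri _ z)) (prim_const hm hd μ hμ)

def PP {d r1 r2 : ℕ} (W1 : Set (Fin r1 → Fin d → ℝ)) (W2 : Set (Fin r2 → Fin d → ℝ)) : Set (Fin r1 ⊕ Fin r2 → Fin d → ℝ) :=
  {w | (fun a => w (Sum.inl a)) ∈ W1 ∧ (fun a => w (Sum.inr a)) ∈ W2}

lemma measurableSet_PP {d r1 r2 : ℕ} {W1 : Set (Fin r1 → Fin d → ℝ)} {W2 : Set (Fin r2 → Fin d → ℝ)} (h1 : MeasurableSet W1)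
    (h2 : MeasurableSet W2) : MeasurableSet (PP W1 W2) :=
  ((measurable_ri Sum.inl) h1).inter ((measurable_ri Sum.inr) h2)

lemma vol_PP {d r1 r2 : ℕ} {W1 : Set (Fin r1 → Fin d → ℝ)} {W2 : Set (Fin r2 → Fin d → ℝ)} (h1 : MeasurableSet W1)
    (h2 : MeasurableSet W2) : volume (PP W1 W2) = volume W1 * volume W2 := by
  have h := volume_measurePreserving_sumPiEquivProdPi (fun _ : Fin r1 ⊕ Fin r2 => Fin d → ℝ)
  have h3 := h.measure_preimage (s := W1 ×ˢ W2) (h1.prod h2).nullMeasurableSet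
  rw [Measure.volume_eq_prod, Measure.prod_prod] at h3
  rw [← h3]; rfl

def eS {r1 r2 : ℕ} (S : Finset (Fin r1 ⊕ Fin r2)) : Fin S.toLeft.card ⊕ Fin S.toRight.card → S :=
  Sum.elim (fun a => ⟨Sum.inl (S.toLeft.orderEmbOfFin rfl a), Finset.mem_toLeft.1 (Finset.orderEmbOfFin_mem _ _ _)⟩)
    (fun a => ⟨Sum.inr (S.toRight.orderEmbOfFin rfl a), Finset.mem_toRight.1 (Finset.orderEmbOfFin_mem _ _ _)⟩)

lemma eS_bij {r1 r2 : ℕ} (S : Finset (Fin r1 ⊕ Fin r2)) : Function.Bijective (eS S) := by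
  constructor
  · rintro (a | a) (b | b) h <;> simp [eS] at h ⊢ <;> exact h
  · rintro ⟨a | a, h⟩
    · have h1 : a ∈ Set.range (S.toLeft.orderEmbOfFin rfl) := by
        rw [Finset.range_orderEmbOfFin]; exact Finset.mem_toLeft.2 h
      obtain ⟨b, hb⟩ := h1
      exact ⟨Sum.inl b, by simp [eS, hb]⟩
    · have h1 : a ∈ Set.range (S.toRight.orderEmbOfFin rfl) := by
        rw [Finset.range_orderEmbOfFin]; exact Finset.mem_toRight.2 h
      obtain ⟨b, hb⟩ := h1
      exact ⟨Sum.inr b, by simp [eS, hb]⟩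

lemma fhat_sq {d k : ℕ} (W : Set (Fin k → Fin d → ℝ)) (x : Xspace d) :
    fhat (Prim d (Fin k)) (W.indicator 1) x ^ 2 = fhat (Prim d (Fin k ⊕ Fin k)) ((PP W W).indicator 1) x := by
  classical
  unfold fhat
  let e : Prim d (Fin k) × Prim d (Fin k) ≃ Prim d (Fin k ⊕ Fin k) :=
    { toFun := fun p => ⟨Sum.elim p.1.1 p.2.1, by rintro (i | i); exacts [p.1.2 i, p.2.2 i]⟩
      invFun := fun z => (⟨fun i => z.1 (Sum.inl i), fun i => z.2 _⟩, ⟨fun i => z.1 (Sum.inr i), fun i => z.2 _⟩)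
      left_inv := fun p => rfl
      right_inv := fun z => by
        apply Subtype.ext; funext i; rcases i with i | i <;> rfl }
  rw [← e.tsum_eq, ENNReal.tsum_prod', sq, ← ENNReal.tsum_mul_right]
  refine tsum_congr fun z => ?_
  rw [← ENNReal.tsum_mul_left]
  refine tsum_congr fun w => ?_
  have : act (Quotient.out x) (zc (e (z, w)).1) ∈ PP W W ↔ act (Quotient.out x) (zc z.1) ∈ W ∧ act (Quotient.out x) (zc w.1) ∈ W := Iff.rfl
  simp only [Set.indicator_apply, this, Pi.one_apply]
  by_cases h1 : act (Quotient.out x) (zc z.1) ∈ W <;> by_cases h2 : act (Quotient.out x) (zc w.1) ∈ W <;> simp [h1, h2]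

/-- the projection bounds, closed up -/
def WW {d : ℕ} (Er : (r : ℕ) → Set (Fin r → Fin d → ℝ)) (r : ℕ) : Set (Fin r → Fin d → ℝ) :=
  if r = 0 then Set.univ else closure (Er r)

lemma measurableSet_WW {d : ℕ} (Er : (r : ℕ) → Set (Fin r → Fin d → ℝ)) (r : ℕ) : MeasurableSet (WW Er r) := by
  unfold WW; split_ifs
  · exact MeasurableSet.univ
  · exact isClosed_closure.measurableSet

lemma second_moment {d k : ℕ} (hk : 1 ≤ k) (hd : k ^ 2 + 3 ≤ d) (μ : Measure (Xspace d)) [IsProbabilityMeasure μ] (hμ : InvM μ)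
    (Er : (r : ℕ) → Set (Fin r → Fin d → ℝ))
    (hE : ∀ r, 1 ≤ r → r ≤ k → ∀ j : Fin r → Fin k, StrictMono j → ∀ v ∈ Er k, (fun a => v (j a)) ∈ Er r) :
    ∫⁻ x, fhat (Prim d (Fin k)) ((closure (Er k)).indicator 1) x ^ 2 ∂μ ≤
      ((zet d ^ k)⁻¹ * volume (closure (Er k))) ^ 2 + 
      ∑ S ∈ Finset.univ.erase (Finset.univ : Finset (Fin k ⊕ Fin k)), KK d (S.card * (2 * k - S.card)) *
        (if S = ∅ then 0 else volume (WW Er S.toLeft.card) * volume (WW Er S.toRight.card)) := by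
  classical
  have hC : MeasurableSet (closure (Er k)) := isClosed_closure.measurableSet
  have hcard : Fintype.card (Fin k ⊕ Fin k) = 2 * k := by simp; ring
  simp only [fhat_sq]
  rw [← nu_apply μ (ginv_Prim d _) (measurableSet_PP hC hC), nu_split μ (ginv_Prim d _) (ginv_Ind d _) (measurableSet_PP hC hC),
    prim_const_gen hcard.le hd μ hμ]
  refine add_le_add (le_of_eq ?_) ?_
  · rw [Measure.smul_apply, vol_PP hC hC, hcard, smul_eq_mul, mul_pow, sq (volume (closure (Er k))), mul_comm 2 k, pow_mul, ← ENNReal.inv_pow]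
  · have hb := dep_bound μ (ginv_inter (ginv_Prim d (Fin k ⊕ Fin k)) (ginv_compl (ginv_Ind d (Fin k ⊕ Fin k)))) (fun z hz => hz.2) (fun _ => 1)
      (fun S hS => const_one_gen (by have := card_S_lt hS; simp at this ⊢; omega) hd μ hμ)
      (measurableSet_PP hC hC)
      (Ω' := fun S => if S = ∅ then ∅ else (fun w : S → Fin d → ℝ => fun i => w (eS S i)) ⁻¹' PP (WW Er S.toLeft.card) (WW Er S.toRight.card)) ?_ ?_
    · refine hb.trans (Finset.sum_le_sum fun S _ => ?_)
      rw [hcard, one_mul]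
      gcongr
      split_ifs with h
      · simp
      · have h2 := (vol_ri (d := d) (Equiv.ofBijective _ (eS_bij S))).measure_preimage
          (measurableSet_PP (measurableSet_WW Er S.toLeft.card) (measurableSet_WW Er S.toRight.card)).nullMeasurableSet
        rw [vol_PP (measurableSet_WW Er S.toLeft.card) (measurableSet_WW Er S.toRight.card)] at h2
        exact h2.le
    · intro S
      split_ifs
      · exact MeasurableSet.empty
      · exact (measurable_ri _) (measurableSet_PP (measurableSet_WW Er _) (measurableSet_WW Er _))
    · intro S hS g z hz hw
      have hwc : ∀ (r : ℕ) (j : Fin r → Fin k), StrictMono j → ∀ w ∈ closure (Er k), (fun a => w (j a)) ∈ WW Er r := by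
        intro r j hj w hw
        unfold WW
        split_ifs with h0
        · trivial
        · have hrk : r ≤ k := by
            have := Fintype.card_le_of_injective j hj.injective
            simpa using this
          exact map_mem_closure (f := fun w : Fin k → Fin d → ℝ => fun a => w (j a)) (by fun_prop) hw
            (fun v hv => hE r (by omega) hrk j hj v hv)
      split_ifs with h
      · exfalso
        subst h
        obtain ⟨hzP, -, q, hq, hq2⟩ := hz
        have h3 := (hzP.1 (Sum.inl ⟨0, hk⟩)).1
        apply h3
        have h4 := hq2 (Sum.inl ⟨0, hk⟩)
        simp at h4
        funext j
        have := congrFun h4 j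
        simpa [zc] using this
      · exact ⟨hwc _ _ (S.toLeft.orderEmbOfFin rfl).strictMono _ hw.1, hwc _ _ (S.toRight.orderEmbOfFin rfl).strictMono _ hw.2⟩

lemma zet_ne_zero (d : ℕ) : zet d ≠ 0 := by
  intro h
  unfold zet at h
  rw [ENNReal.tsum_eq_zero] at h
  have := h 0
  simp at this

lemma first_moment {d k : ℕ} (hd : k ^ 2 + 3 ≤ d) (μ : Measure (Xspace d)) [IsProbabilityMeasure μ] (hμ : InvM μ)
    {U : Set (Fin k → Fin d → ℝ)} (hU : MeasurableSet U) :
    (zet d ^ k)⁻¹ * volume U ≤ ∫⁻ x, fhat (Prim d (Fin k)) (U.indicator 1) x ∂μ := by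
  rw [← nu_apply μ (ginv_Prim d _) hU]
  have h1 := prim_const (m := k) (k := k) (by omega) hd μ hμ
  have h2 := nu_mono μ (ginv_inter (ginv_Prim d (Fin k)) (ginv_Ind d (Fin k))) (ginv_Prim d (Fin k)) Set.inter_subset_left
  rw [h1] at h2
  simpa using h2 U

/-- Proposition 5.4 (second moment bound for the rank-`k` primitive Siegel transform):
for `2n ≥ k² + 3` and a Jordan measurable `E ⊆ (ℝ^{2n})^k` admitting projection bounds
`(E_r)`, the variance of the rank-`k` primitive Siegel transform of `χ_E` is at most
`Ĉ · max{vol_{r₁}(E_{r₁})·vol_{r₂}(E_{r₂}) : 1 ≤ r₁+r₂ ≤ 2k-1}` with `Ĉ = Ĉ(n,k)`. -/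
theorem stmt11 (n k : ℕ) (hk : 1 ≤ k) (hn : 1 ≤ n) (hnk : k^2 + 3 ≤ 2*n) :
    ∃ C > (0:ℝ),
      ∀ (E : Set (Fin k → Fin (2*n) → ℝ)) (Er : (r : ℕ) → Set (Fin r → Fin (2*n) → ℝ)),
        Er k = E →
        (∀ r, 1 ≤ r → r ≤ k → JordanMeasurable (Er r)) →
        (∀ r, 1 ≤ r → r ≤ k → ∀ j : Fin r → Fin k, StrictMono j →
          ∀ v ∈ E, (fun a => v (j a)) ∈ Er r) →
        ∀ μ : Measure (Xspace (2*n)), IsProbabilityMeasure μ →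
          (∀ γ : SLR (2*n), Measure.map (fun x => γ • x) μ = μ) →
          ∀ Φ : Xspace (2*n) → ℝ,
            (∀ g : SLR (2*n), Φ (QuotientGroup.mk g) =
              (Nat.card {v : Fin k → (Fin (2*n) → ℤ) |
                (∀ l, IsPrimitiveVec (v l)) ∧
                (fun i => (g : Matrix (Fin (2*n)) (Fin (2*n)) ℝ).mulVec
                  (fun j => ((v i j : ℤ) : ℝ))) ∈ E} : ℝ)) →
            0 ≤ (∫ x, (Φ x)^2 ∂μ) - (∫ x, Φ x ∂μ)^2 ∧
            (∫ x, (Φ x)^2 ∂μ) - (∫ x, Φ x ∂μ)^2 ≤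
              C * sSup {x : ℝ | ∃ r1 r2 : ℕ, r1 ≤ k ∧ r2 ≤ k ∧ 1 ≤ r1 + r2 ∧
                r1 + r2 ≤ 2*k - 1 ∧ x = jvol (2*n) r1 (Er r1) * jvol (2*n) r2 (Er r2)} := by
  classical
  generalize 2 * n = d at *
  let κ := Fin k ⊕ Fin k
  have hcardκ : Fintype.card κ = 2 * k := by simp [κ]; ring
  let C0 : ENNReal := ∑ S ∈ Finset.univ.erase (Finset.univ : Finset κ), KK d (S.card * (2 * k - S.card))
  have hC0 : C0 ≠ ⊤ := by
    refine ENNReal.sum_ne_top.2 fun S _ => KK_ne_top ?_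
    have := am_gm (a := S.card) (m := 2 * k) (k := k) le_rfl
    omega
  refine ⟨C0.toReal + 1, by positivity, ?_⟩
  intro E Er hEk hJ hproj μ hprob hμ Φ hΦ
  subst hEk
  set X := {x : ℝ | ∃ r1 r2 : ℕ, r1 ≤ k ∧ r2 ≤ k ∧ 1 ≤ r1 + r2 ∧
                r1 + r2 ≤ 2*k - 1 ∧ x = jvol d r1 (Er r1) * jvol d r2 (Er r2)} with hX
  have hjn : ∀ r, 0 ≤ jvol d r (Er r) := by
    intro r; unfold jvol; split_ifs
    · norm_num
    · positivity
  have hXn : ∀ x ∈ X, 0 ≤ x := by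
    rintro x ⟨r1, r2, -, -, -, -, rfl⟩
    exact mul_nonneg (hjn _) (hjn _)
  have hM0 : 0 ≤ sSup X := Real.sSup_nonneg hXn
  have hXb : BddAbove X := by
    have : X.Finite := by
      refine ((Set.finite_Iic k).prod (Set.finite_Iic k)).image (fun p : ℕ × ℕ => jvol d p.1 (Er p.1) * jvol d p.2 (Er p.2)) |>.subset ?_
      rintro x ⟨r1, r2, h1, h2, -, -, rfl⟩
      exact ⟨(r1, r2), ⟨h1, h2⟩, rfl⟩
    exact this.bddAbove
  have hfin : ∀ r, 1 ≤ r → r ≤ k → volume (Er r) ≠ ⊤ := fun r h1 h2 => (hJ r h1 h2).1.measure_lt_top.ne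
  have hclo : ∀ r, 1 ≤ r → r ≤ k → volume (closure (Er r)) = volume (Er r) := fun r h1 h2 =>
    measure_closure_of_null_frontier (hJ r h1 h2).2
  have hWW : ∀ r, r ≤ k → volume (WW Er r) = ENNReal.ofReal (jvol d r (Er r)) := by
    intro r hr
    unfold WW jvol
    by_cases h : r = 0
    · subst h
      simp only [if_true]
      rw [volume_pi, Measure.pi_of_empty]; simp
    · rw [if_neg h, if_neg h, hclo r (by omega) hr, ENNReal.ofReal_toReal (hfin r (by omega) hr)]
  set p : ENNReal := (zet d ^ k)⁻¹ with hp
  have hpt : p ≠ ⊤ := ENNReal.inv_ne_top.2 (pow_ne_zero _ (zet_ne_zero d))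
  set V := volume (Er k) with hV
  have hVt : V ≠ ⊤ := hfin k hk le_rfl
  -- the measurable majorant and minorant
  let G := fhat (Prim d (Fin k)) ((closure (Er k)).indicator 1)
  let L := fhat (Prim d (Fin k)) ((interior (Er k)).indicator 1)
  have hGm : Measurable G := measurable_fhat (ginv_Prim d _) (measurable_one.indicator isClosed_closure.measurableSet)
  have hG2 : ∫⁻ x, G x ^ 2 ∂μ ≤ (p * V) ^ 2 + C0 * ENNReal.ofReal (sSup X) := by
    refine (second_moment hk hnk μ hμ Er hproj).trans ?_
    rw [hclo k hk le_rfl]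
    gcongr
    simp only [C0]
    rw [Finset.sum_mul]
    refine Finset.sum_le_sum fun S hS => ?_
    gcongr
    split_ifs with h
    · simp
    · have hl : S.toLeft.card ≤ k := by simpa using Finset.card_le_univ S.toLeft
      have hr : S.toRight.card ≤ k := by simpa using Finset.card_le_univ S.toRight
      have hs : S.toLeft.card + S.toRight.card = S.card := Finset.card_toLeft_add_card_toRight
      have hs1 : S.card < 2 * k := by rw [← hcardκ]; exact card_S_lt (Finset.ne_of_mem_erase hS)
      have hs2 : 0 < S.card := Finset.card_pos.2 (Finset.nonempty_iff_ne_empty.2 h)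
      rw [hWW _ hl, hWW _ hr, ← ENNReal.ofReal_mul (hjn _)]
      exact ENNReal.ofReal_le_ofReal (le_csSup hXb ⟨_, _, hl, hr, by omega, by omega, rfl⟩)
  have hBt : (p * V) ^ 2 + C0 * ENNReal.ofReal (sSup X) ≠ ⊤ :=
    ENNReal.add_ne_top.2 ⟨ENNReal.pow_ne_top (ENNReal.mul_ne_top hpt hVt), ENNReal.mul_ne_top hC0 ENNReal.ofReal_ne_top⟩
  have hL1 : p * V ≤ ∫⁻ x, L x ∂μ := by
    have := first_moment hnk μ hμ (U := interior (Er k)) isOpen_interior.measurableSet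
    rwa [measure_interior_of_null_frontier (hJ k hk le_rfl).2] at this
  have hΦ0 : ∀ x, 0 ≤ Φ x := by
    intro x; rw [← Quotient.out_eq x]
    exact (hΦ (Quotient.out x)).symm ▸ Nat.cast_nonneg _
  have hΦG : ∀ x, G x ≠ ⊤ → ENNReal.ofReal (Φ x) ≤ G x ∧ L x ≤ ENNReal.ofReal (Φ x) := by
    intro x hx
    have h1 := hΦ (Quotient.out x)
    have h2 : (QuotientGroup.mk (Quotient.out x) : Xspace d) = x := Quotient.out_eq x
    rw [h2] at h1
    set T := {v : Fin k → (Fin d → ℤ) | (∀ l, IsPrimitiveVec (v l)) ∧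
                (fun i => ((Quotient.out x : SLR d) : Matrix (Fin d) (Fin d) ℝ).mulVec
                  (fun j => ((v i j : ℤ) : ℝ))) ∈ Er k} with hT
    have hF : ∀ A : Set (Fin k → Fin d → ℝ), fhat (Prim d (Fin k)) (A.indicator 1) x = 
        ∑' z : Fin k → Fin d → ℤ, (if z ∈ Prim d (Fin k) ∧ act (Quotient.out x) (zc z) ∈ A then 1 else 0) := by
      intro A
      unfold fhat
      rw [tsum_subtype (Prim d (Fin k)) (fun z => (A.indicator 1 (act (Quotient.out x) (zc z)) : ENNReal))]
      refine tsum_congr fun z => ?_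
      by_cases h1 : z ∈ Prim d (Fin k) <;> by_cases h2 : act (Quotient.out x) (zc z) ∈ A <;> simp [h1, h2]
    have hmono : ∀ A B : Set (Fin k → Fin d → ℝ), A ⊆ B → fhat (Prim d (Fin k)) (A.indicator 1) x ≤ fhat (Prim d (Fin k)) (B.indicator 1) x := by
      intro A B hAB
      refine ENNReal.tsum_le_tsum fun z => ?_
      exact Set.indicator_le_indicator_of_subset hAB (fun _ => by simp) _
    have hTe : fhat (Prim d (Fin k)) ((Er k).indicator 1) x = T.encard := by
      have h5 : (T.encard : ENNReal) = ∑' _ : T, (1 : ENNReal) := ENNReal.tsum_one.symm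
      rw [hF, h5, tsum_subtype T (fun _ => (1 : ENNReal))]
      refine tsum_congr fun z => ?_
      rw [Set.indicator_apply]; exact if_congr Iff.rfl rfl rfl
    have hTf : T.Finite := by
      rw [← Set.encard_ne_top_iff]
      intro htop
      rw [htop] at hTe
      have := hmono _ _ (subset_closure (s := Er k))
      rw [hTe] at this
      exact hx (top_le_iff.1 (by simpa using this))
    have hΦe : ENNReal.ofReal (Φ x) = fhat (Prim d (Fin k)) ((Er k).indicator 1) x := by
      rw [h1, hTe, ENNReal.ofReal_natCast, ← hTf.cast_ncard_eq]
      exact (ENat.toENNReal_coe _).symm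
    rw [hΦe]
    exact ⟨hmono _ _ subset_closure, hmono _ _ interior_subset⟩
  have hae : ∀ᵐ x ∂μ, G x ≠ ⊤ := by
    have h1 := ae_lt_top (hGm.pow_const 2) (hG2.trans_lt hBt.lt_top).ne
    filter_upwards [h1] with x hx h
    rw [h] at hx
    simp at hx
  by_cases hmeas : AEStronglyMeasurable Φ μ
  · have hsq : ∫⁻ x, ENNReal.ofReal (Φ x ^ 2) ∂μ ≤ (p * V) ^ 2 + C0 * ENNReal.ofReal (sSup X) := by
      refine (lintegral_mono_ae ?_).trans hG2
      filter_upwards [hae] with x hx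
      rw [ENNReal.ofReal_pow (hΦ0 x)]
      exact pow_le_pow_left₀ (by simp) (hΦG x hx).1 2
    have hint2 : Integrable (fun x => Φ x ^ 2) μ := by
      refine ⟨hmeas.pow 2, ?_⟩
      rw [hasFiniteIntegral_iff_ofReal (Filter.Eventually.of_forall fun x => sq_nonneg _)]
      exact hsq.trans_lt hBt.lt_top
    have hLp : MemLp Φ 2 μ := (memLp_two_iff_integrable_sq hmeas).2 hint2
    have hint1 : Integrable Φ μ := hLp.integrable (by norm_num)
    have hvar := ProbabilityTheory.variance_eq_sub hLp
    have hvar0 := ProbabilityTheory.variance_nonneg Φ μ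
    have e2 : ∫ x, Φ x ^ 2 ∂μ ≤ ((p * V) ^ 2 + C0 * ENNReal.ofReal (sSup X)).toReal := by
      rw [integral_eq_lintegral_of_nonneg_ae (Filter.Eventually.of_forall fun x => sq_nonneg _) hint2.1]
      exact ENNReal.toReal_mono hBt hsq
    have e1 : (p * V).toReal ≤ ∫ x, Φ x ∂μ := by
      rw [integral_eq_lintegral_of_nonneg_ae (Filter.Eventually.of_forall hΦ0) hmeas]
      refine ENNReal.toReal_mono ?_ (hL1.trans (lintegral_mono_ae ?_))
      · have := hint1.2
        rw [hasFiniteIntegral_iff_ofReal (Filter.Eventually.of_forall hΦ0)] at this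
        exact this.ne
      · filter_upwards [hae] with x hx using (hΦG x hx).2
    constructor
    · rw [hvar] at hvar0
      simpa using hvar0
    · rw [ENNReal.toReal_add (ENNReal.pow_ne_top (ENNReal.mul_ne_top hpt hVt)) (ENNReal.mul_ne_top hC0 ENNReal.ofReal_ne_top), 
        ENNReal.toReal_pow, ENNReal.toReal_mul (a := C0), ENNReal.toReal_ofReal hM0] at e2
      have e3 : (p * V).toReal ^ 2 ≤ (∫ x, Φ x ∂μ) ^ 2 := pow_le_pow_left₀ (by positivity) e1 2
      nlinarith
  · have h1 : ∫ x, Φ x ∂μ = 0 := integral_non_aestronglyMeasurable hmeas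
    have h2 : ∫ x, Φ x ^ 2 ∂μ = 0 := by
      apply integral_non_aestronglyMeasurable
      intro h
      apply hmeas
      have := Real.continuous_sqrt.comp_aestronglyMeasurable h
      refine this.congr (Filter.Eventually.of_forall fun x => ?_)
      exact Real.sqrt_sq (hΦ0 x)
    rw [h1, h2]
    norm_num
    positivity
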